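/- arXiv:2511.01637 — 2 statements merged into one kernel-verified Lean document; each statement's English description precedes it below -/
import Mathlib

section
/- Let f : ℂ → ℂ be a nonconstant entire function and let n ≥ 7 be an integer. If f^n and (f^n)′ share the value 1 CM, then f^n = (f^n)′ identically; that is, f(z) = c·e^{z/n} for some c ∈ ℂ \ {0}. (Yang–Zhang; the paper's Theorem 2.D.) -/
namespace YangZhang

open Real Set Metric Filter Topology

/-- Jensen's inequality: `log ‖u 0‖` is at most the average over a circle of any upper bound for
`log ‖u‖`. -/
lemma log_norm_le_circleAverage {u : ℂ → ℂ} (hu : Differentiable ℂ u) (h0 : u 0 ≠ 0) {R : ℝ}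
    (hR : 0 < R) {v : ℂ → ℝ} (hv : CircleIntegrable v 0 R)
    (h : ∀ z, ‖z‖ = R → ‖u z‖ ≤ exp (v z)) : log ‖u 0‖ ≤ circleAverage v 0 R := by
  have ha : AnalyticOnNhd ℂ u univ := fun z _ => hu.analyticAt z
  have haB : AnalyticOnNhd ℂ u (closedBall 0 |R|) := ha.mono (subset_univ _)
  have hJ : log ‖u 0‖ ≤ circleAverage (fun z => log ‖u z‖) 0 R := by
    rw [haB.circleAverage_log_norm hR.ne' h0]
    have : 0 ≤ ∑ᶠ w, MeromorphicOn.divisor u (closedBall 0 |R|) w * log (R * ‖0 - w‖⁻¹) := by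
      refine finsum_nonneg fun w => ?_
      by_cases hw : w ∈ closedBall (0 : ℂ) |R|
      · have h1 : (0 : ℝ) ≤ MeromorphicOn.divisor u (closedBall 0 |R|) w :=
          mod_cast MeromorphicOn.AnalyticOnNhd.divisor_nonneg haB w
        refine mul_nonneg h1 ?_
        rcases eq_or_ne w 0 with rfl | hw0
        · simp
        · apply log_nonneg
          rw [mem_closedBall_zero_iff, abs_of_pos hR] at hw
          have : 0 < ‖w‖ := norm_pos_iff.2 hw0
          rw [zero_sub, norm_neg, ← div_eq_mul_inv, one_le_div this]
          exact hw
      · simp [Function.locallyFinsuppWithin.apply_eq_zero_of_notMem _ hw]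
    linarith
  refine hJ.trans ?_
  set w : ℂ → ℝ := fun z => if u z = 0 then v z else log ‖u z‖ with hw
  have hcod : (fun z => log ‖u z‖) =ᶠ[codiscreteWithin (sphere (0 : ℂ) |R|)] w := by
    have h1 : u ⁻¹' {0}ᶜ ∈ codiscrete ℂ := ha.preimage_zero_mem_codiscrete (x := 0) h0
    filter_upwards [codiscreteWithin_mono (subset_univ _) h1] with z hz
    have : u z ≠ 0 := hz
    simp [hw, this]
  have hli : CircleIntegrable (fun z => log ‖u z‖) 0 R :=
    MeromorphicOn.circleIntegrable_log_norm (fun z _ => (hu.analyticAt z).meromorphicAt)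
  rw [circleAverage_congr_codiscreteWithin hcod hR.ne']
  refine circleAverage_mono (hli.congr_codiscreteWithin hcod) hv fun z hz => ?_
  simp only [hw]
  split_ifs with hz0
  · exact le_rfl
  · rw [mem_sphere_zero_iff_norm, abs_of_pos hR] at hz
    exact (log_le_iff_le_exp (norm_pos_iff.2 hz0)).2 (h z hz)

/-- The polynomial with the given list of roots. -/
noncomputable def rootsProd (l : List ℂ) (z : ℂ) : ℂ := (l.map fun a => z - a).prod

/-- The product of the denominators of the Blaschke factors for the disc of radius `R`. -/
noncomputable def blaschkeDenom (R : ℝ) (l : List ℂ) (z : ℂ) : ℂ :=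
  (l.map fun a => ((R : ℂ) ^ 2 - (starRingEnd ℂ) a * z) / R).prod

lemma rootsProd_cons (a : ℂ) (l : List ℂ) (z : ℂ) :
    rootsProd (a :: l) z = (z - a) * rootsProd l z := by simp [rootsProd]

lemma blaschkeDenom_cons (R : ℝ) (a : ℂ) (l : List ℂ) (z : ℂ) :
    blaschkeDenom R (a :: l) z = ((R : ℂ) ^ 2 - (starRingEnd ℂ) a * z) / R * blaschkeDenom R l z :=
  by simp [blaschkeDenom]

lemma differentiable_rootsProd (l : List ℂ) : Differentiable ℂ (rootsProd l) := by
  induction l with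
  | nil => exact differentiable_const (1 : ℂ)
  | cons a l ih =>
    rw [show rootsProd (a :: l) = fun z => (z - a) * rootsProd l z from
      funext (rootsProd_cons a l)]
    fun_prop

lemma differentiable_blaschkeDenom (R : ℝ) (l : List ℂ) :
    Differentiable ℂ (blaschkeDenom R l) := by
  induction l with
  | nil => exact differentiable_const (1 : ℂ)
  | cons a l ih =>
    rw [show blaschkeDenom R (a :: l) = _ from funext (blaschkeDenom_cons R a l)]
    fun_prop

lemma norm_blaschke_factor_sq (R : ℝ) (hR : 0 < R) (a z : ℂ) :
    ‖((R : ℂ) ^ 2 - (starRingEnd ℂ) a * z) / R‖ ^ 2 * R ^ 2 =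
      ‖z - a‖ ^ 2 * R ^ 2 + (R ^ 2 - ‖a‖ ^ 2) * (R ^ 2 - ‖z‖ ^ 2) := by
  rw [norm_div, Complex.norm_real, norm_eq_abs, abs_of_pos hR, div_pow,
    div_mul_cancel₀ _ (by positivity)]
  simp only [← Complex.normSq_eq_norm_sq, Complex.normSq_apply]
  simp [pow_two]
  ring

lemma norm_rootsProd_eq {R : ℝ} (hR : 0 < R) (l : List ℂ) {z : ℂ} (hz : ‖z‖ = R) :
    ‖rootsProd l z‖ = ‖blaschkeDenom R l z‖ := by
  induction l with
  | nil => simp [rootsProd, blaschkeDenom]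
  | cons a l ih =>
    rw [rootsProd_cons, blaschkeDenom_cons, norm_mul, norm_mul, ih]
    congr 1
    have h := norm_blaschke_factor_sq R hR a z
    rw [hz, sub_self, mul_zero, add_zero] at h
    exact ((pow_left_inj₀ (norm_nonneg _) (norm_nonneg _) two_ne_zero).1
      (mul_right_cancel₀ (by positivity) h)).symm

lemma norm_rootsProd_le {R : ℝ} (hR : 0 < R) {l : List ℂ} (hl : ∀ a ∈ l, ‖a‖ ≤ R) {z : ℂ}
    (hz : ‖z‖ ≤ R) : ‖rootsProd l z‖ ≤ ‖blaschkeDenom R l z‖ := by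
  induction l with
  | nil => simp [rootsProd, blaschkeDenom]
  | cons a l ih =>
    rw [rootsProd_cons, blaschkeDenom_cons, norm_mul, norm_mul]
    have ha : ‖a‖ ≤ R := hl a (by simp)
    refine mul_le_mul ?_ (ih fun b hb => hl b (by simp [hb])) (norm_nonneg _) (norm_nonneg _)
    have h := norm_blaschke_factor_sq R hR a z
    have h1 : 0 ≤ (R ^ 2 - ‖a‖ ^ 2) * (R ^ 2 - ‖z‖ ^ 2) := by
      apply mul_nonneg <;> rw [sub_nonneg] <;> gcongr
    refine le_of_sq_le_sq ?_ (norm_nonneg _)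
    refine le_of_mul_le_mul_right (a := R ^ 2) (by linarith) (by positivity)

lemma blaschkeDenom_ne_zero {R : ℝ} (hR : 0 < R) {l : List ℂ} {z : ℂ}
    (hl : ∀ a ∈ l, ‖a‖ * ‖z‖ < R ^ 2) : blaschkeDenom R l z ≠ 0 := by
  induction l with
  | nil => simp [blaschkeDenom]
  | cons a l ih =>
    rw [blaschkeDenom_cons]
    refine mul_ne_zero (div_ne_zero ?_ (by simpa using hR.ne')) (ih fun b hb => hl b (by simp [hb]))
    intro h
    have h1 : ‖a‖ * ‖z‖ = R ^ 2 := by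
      have := congrArg norm (sub_eq_zero.1 h)
      simpa using this.symm
    exact (hl a (by simp)).ne h1

/-- Removal of the zeros in a disc, with Jensen's bound for their number. -/
lemma exists_rootsProd_mul {u : ℂ → ℂ} (hu : Differentiable ℂ u) (h0 : u 0 ≠ 0) {s R M : ℝ}
    (hs : 0 < s) (hsR : s < R) (hM : ∀ z, ‖z‖ = R → ‖u z‖ ≤ M) :
    ∃ (l : List ℂ) (g : ℂ → ℂ), Differentiable ℂ g ∧ (∀ z, u z = rootsProd l z * g z) ∧
      (∀ a ∈ l, ‖a‖ ≤ s) ∧ (∀ z, ‖z‖ ≤ s → g z ≠ 0) ∧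
      l.length * log (R / s) ≤ log (M / ‖u 0‖) := by
  have hR : 0 < R := hs.trans hsR
  have hlog : 0 < log (R / s) := log_pos ((one_lt_div hs).2 hsR)
  have hbound : ∀ (l : List ℂ) (g : ℂ → ℂ), Differentiable ℂ g →
      (∀ z, u z = rootsProd l z * g z) → (∀ a ∈ l, ‖a‖ ≤ s) →
      l.length * log (R / s) ≤ log (M / ‖u 0‖) := by
    intro l g hg hug hl
    have h1 : ‖blaschkeDenom R l 0 * g 0‖ ≤ M := by
      refine Complex.norm_le_of_forall_mem_frontier_norm_le (U := ball 0 R) isBounded_ball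
        ((differentiable_blaschkeDenom R l).mul hg).diffContOnCl ?_
        (subset_closure (mem_ball_self hR))
      intro z hz
      rw [frontier_ball _ hR.ne', mem_sphere_zero_iff_norm] at hz
      have := hM z hz
      rw [hug z, norm_mul, norm_rootsProd_eq hR l hz, ← norm_mul] at this
      exact this
    have h2 : ‖rootsProd l 0‖ * (R / s) ^ l.length ≤ ‖blaschkeDenom R l 0‖ := by
      clear hug h1
      induction l with
      | nil => simp [rootsProd, blaschkeDenom]
      | cons a l ih =>
        have ih' := ih fun b hb => hl b (by simp [hb])
        have ha := hl a (by simp)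
        rw [rootsProd_cons, blaschkeDenom_cons, norm_mul, norm_mul, List.length_cons, pow_succ]
        have h3 : ‖(0 : ℂ) - a‖ * (R / s) ≤ ‖((R : ℂ) ^ 2 - (starRingEnd ℂ) a * 0) / R‖ := by
          have : ‖((R : ℂ) ^ 2 - (starRingEnd ℂ) a * 0) / R‖ = R := by
            simp [abs_of_pos hR]; field_simp
          rw [this, zero_sub, norm_neg]
          calc ‖a‖ * (R / s) ≤ s * (R / s) := by gcongr
            _ = R := by field_simp
        calc ‖(0 : ℂ) - a‖ * ‖rootsProd l 0‖ * ((R / s) ^ l.length * (R / s))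
            = (‖(0 : ℂ) - a‖ * (R / s)) * (‖rootsProd l 0‖ * (R / s) ^ l.length) := by ring
          _ ≤ _ := by gcongr
    have h3 : (R / s) ^ l.length ≤ M / ‖u 0‖ := by
      rw [le_div_iff₀ (norm_pos_iff.2 h0)]
      calc (R / s) ^ l.length * ‖u 0‖ = (‖rootsProd l 0‖ * (R / s) ^ l.length) * ‖g 0‖ := by
            rw [hug 0, norm_mul]; ring
        _ ≤ ‖blaschkeDenom R l 0‖ * ‖g 0‖ := by gcongr
        _ ≤ M := by rwa [← norm_mul]
    rw [← log_pow]
    exact log_le_log (by positivity) h3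
  by_contra hcon
  have key : ∀ k : ℕ, ∃ (l : List ℂ) (g : ℂ → ℂ), Differentiable ℂ g ∧
      (∀ z, u z = rootsProd l z * g z) ∧ (∀ a ∈ l, ‖a‖ ≤ s) ∧ l.length = k := by
    intro k
    induction k with
    | zero => exact ⟨[], u, hu, by simp [rootsProd], by simp, rfl⟩
    | succ k ih =>
      obtain ⟨l, g, hg, hug, hl, hk⟩ := ih
      have : ∃ a, ‖a‖ ≤ s ∧ g a = 0 := by
        by_contra! hne
        exact hcon ⟨l, g, hg, hug, hl, fun z hz => hne z hz, hbound l g hg hug hl⟩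
      obtain ⟨a, ha, hga⟩ := this
      refine ⟨a :: l, dslope g a, ?_, fun z => ?_, ?_, by simp [hk]⟩
      · have := (Complex.differentiableOn_dslope (s := univ) (c := a) (f := g) univ_mem).2
          hg.differentiableOn
        exact differentiableOn_univ.1 this
      · have h1 := sub_smul_dslope g a z
        rw [hga, sub_zero, smul_eq_mul] at h1
        rw [hug z, rootsProd_cons, ← h1]; ring
      · simpa [ha] using hl
  obtain ⟨k, hk⟩ := exists_nat_gt (log (M / ‖u 0‖) / log (R / s))
  obtain ⟨l, g, hg, hug, hl, rfl⟩ := key k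
  have := hbound l g hg hug hl
  rw [div_lt_iff₀ hlog] at hk
  linarith

lemma norm_deriv_le_of_ne_zero {G : ℂ → ℂ} (hG : Differentiable ℂ G) {r s M L : ℝ}
    (hr : 0 ≤ r) (hrs : r < s) (hne : ∀ z, ‖z‖ < s → G z ≠ 0) (hM : ∀ z, ‖z‖ < s → ‖G z‖ ≤ M)
    (hL0 : 0 < L) (hL : log (M / ‖G 0‖) ≤ L) {z : ℂ} (hz : ‖z‖ ≤ r) :
    ‖deriv G z‖ ≤ 8 * L * s / (s - r) ^ 2 * ‖G z‖ := by
  have hs : 0 < s := hr.trans_lt hrs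
  have hG0 : G 0 ≠ 0 := hne 0 (by simpa using hs)
  have hG0' : 0 < ‖G 0‖ := norm_pos_iff.2 hG0
  have hdG : Differentiable ℂ (deriv G) :=
    differentiableOn_univ.1 (hG.differentiableOn.deriv isOpen_univ)
  have hex : DifferentiableOn ℂ (fun w => deriv G w / G w) (ball 0 s) :=
    hdG.differentiableOn.div hG.differentiableOn fun w hw => hne w (mem_ball_zero_iff.1 hw)
  obtain ⟨h, h0, hh⟩ := (DifferentiableOn.isExactOn_ball hex).with_val_at 0 0
  have hhd : DifferentiableOn ℂ h (ball 0 s) := fun w hw =>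
    (hh w hw).differentiableAt.differentiableWithinAt
  have hconst : ∀ w ∈ ball (0 : ℂ) s, G w * Complex.exp (-h w) = G 0 := by
    intro w hw
    have hd : ∀ x ∈ ball (0 : ℂ) s, HasDerivAt (fun x => G x * Complex.exp (-h x)) 0 x := by
      intro x hx
      have h1 := (hG x).hasDerivAt.mul ((hh x hx).neg.cexp)
      have hx0 : G x ≠ 0 := hne x (mem_ball_zero_iff.1 hx)
      refine h1.congr_deriv ?_
      rw [mul_neg, mul_neg, mul_left_comm, mul_div_cancel₀ _ hx0, mul_comm, Pi.neg_apply,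
        add_neg_cancel]
    have := (convex_ball (0 : ℂ) s).is_const_of_fderivWithin_eq_zero (𝕜 := ℂ)
      (f := fun x => G x * Complex.exp (-h x))
      (fun x hx => (hd x hx).differentiableAt.differentiableWithinAt)
      (fun x hx => by
        rw [fderivWithin_of_isOpen isOpen_ball hx]
        ext
        simpa using (hd x hx).deriv) hw (mem_ball_self hs)
    simpa [h0] using this
  have hre : MapsTo h (ball 0 s) {w | w.re ≤ L} := by
    intro w hw
    have h1 : G w = G 0 * Complex.exp (h w) := by
      rw [← hconst w hw, mul_assoc, ← Complex.exp_add]; simp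
    have h2 : exp (h w).re ≤ M / ‖G 0‖ := by
      rw [le_div_iff₀ hG0', mul_comm, ← Complex.norm_exp, ← norm_mul, ← h1]
      exact hM w (mem_ball_zero_iff.1 hw)
    have h3 := (le_log_iff_exp_le ((exp_pos _).trans_le h2)).2 h2
    exact h3.trans hL
  have hδ : 0 < (s - r) / 2 := by linarith
  have hsub : ∀ w, ‖w - z‖ ≤ (s - r) / 2 → ‖w‖ ≤ (s + r) / 2 := fun w hw => by
    have := norm_add_le (w - z) z
    rw [sub_add_cancel] at this
    linarith
  have hbd : ∀ w ∈ sphere z ((s - r) / 2), ‖h w‖ ≤ 4 * L * s / (s - r) := by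
    intro w hw
    have hw1 := hsub w (mem_sphere_iff_norm.1 hw).le
    have hw2 : ‖w‖ < s := by linarith
    have := Complex.borelCaratheodory_zero hL0 hhd hre hs (mem_ball_zero_iff.2 hw2) h0
    refine this.trans ?_
    have h5 : 0 < s - r := by linarith
    rw [div_le_div_iff₀ (by linarith) h5]
    have h6 : ‖w‖ * (s - r) ≤ s * (2 * (s - ‖w‖)) := by nlinarith [norm_nonneg w]
    nlinarith
  have hdc : DiffContOnCl ℂ h (ball z ((s - r) / 2)) := by
    apply DifferentiableOn.diffContOnCl
    rw [closure_ball _ hδ.ne']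
    refine hhd.mono fun w hw => ?_
    have := hsub w (mem_closedBall_iff_norm.1 hw)
    rw [mem_ball_zero_iff]; linarith
  have hC := Complex.norm_deriv_le_of_forall_mem_sphere_norm_le hδ hdc hbd
  have hzs : z ∈ ball (0 : ℂ) s := mem_ball_zero_iff.2 (by linarith)
  have hz0 := hne z (by linarith)
  rw [(hh z hzs).deriv, norm_div, div_le_iff₀ (norm_pos_iff.2 hz0)] at hC
  refine hC.trans (le_of_eq ?_)
  have : s - r ≠ 0 := by linarith
  field_simp
  ring

lemma norm_deriv_rootsProd_mul_le {g : ℂ → ℂ} (hg : Differentiable ℂ g) {K d : ℝ} (hd : 0 < d)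
    {z : ℂ} (hK : ‖deriv g z‖ ≤ K * ‖g z‖) (l : List ℂ) (hl : ∀ a ∈ l, d ≤ ‖z - a‖) :
    ‖deriv (fun w => rootsProd l w * g w) z‖ ≤
      (l.length / d + K) * ‖rootsProd l z * g z‖ := by
  induction l with
  | nil => simpa [rootsProd] using hK
  | cons a l ih =>
    have ih' := ih fun b hb => hl b (by simp [hb])
    have ha := hl a (by simp)
    have hfun : (fun w => rootsProd (a :: l) w * g w) =
        fun w => (w - a) * (rootsProd l w * g w) := by
      funext w; rw [rootsProd_cons, mul_assoc]
    have hD : Differentiable ℂ fun w => rootsProd l w * g w :=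
      (differentiable_rootsProd l).mul hg
    have hder : deriv (fun w => rootsProd (a :: l) w * g w) z =
        rootsProd l z * g z + (z - a) * deriv (fun w => rootsProd l w * g w) z := by
      rw [hfun]
      have := (((hasDerivAt_id z).sub_const a).mul (hD z).hasDerivAt).deriv
      simpa using! this
    rw [hder, rootsProd_cons, mul_assoc, norm_mul (z - a)]
    set X := ‖rootsProd l z * g z‖
    have hX : 0 ≤ X := norm_nonneg _
    calc _ ≤ X + ‖z - a‖ * ((l.length / d + K) * X) := by
          refine (norm_add_le _ _).trans ?_
          rw [norm_mul (z - a)]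
          gcongr
      _ ≤ ‖z - a‖ / d * X + ‖z - a‖ * ((l.length / d + K) * X) := by
          gcongr
          exact le_mul_of_one_le_left hX ((one_le_div hd).2 ha)
      _ = _ := by push_cast [List.length_cons]; ring

lemma norm_deriv_le_of_mul_blaschkeDenom {g : ℂ → ℂ} (hg : Differentiable ℂ g) {K r R : ℝ}
    (hrR : r < R) {z : ℂ} (hz : ‖z‖ ≤ r) (l : List ℂ) (hl : ∀ a ∈ l, ‖a‖ ≤ R)
    (hK : ‖deriv (fun w => blaschkeDenom R l w * g w) z‖ ≤ K * ‖blaschkeDenom R l z * g z‖) :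
    ‖deriv g z‖ ≤ (l.length / (R - r) + K) * ‖g z‖ := by
  have hr : 0 ≤ r := (norm_nonneg z).trans hz
  have hR : 0 < R := hr.trans_lt hrR
  induction l generalizing K with
  | nil => simpa [blaschkeDenom] using hK
  | cons a l ih =>
    have ha := hl a (by simp)
    set D : ℂ → ℂ := fun w => blaschkeDenom R l w * g w with hDdef
    have hD : Differentiable ℂ D := (differentiable_blaschkeDenom R l).mul hg
    have hfun : (fun w => blaschkeDenom R (a :: l) w * g w) =
        fun w => ((R : ℂ) ^ 2 - (starRingEnd ℂ) a * w) / R * D w := by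
      funext w; rw [blaschkeDenom_cons, mul_assoc]
    have hder : deriv (fun w => blaschkeDenom R (a :: l) w * g w) z =
        (-(starRingEnd ℂ) a / R) * D z +
          ((R : ℂ) ^ 2 - (starRingEnd ℂ) a * z) / R * deriv D z := by
      rw [hfun]
      have h1 : HasDerivAt (fun w : ℂ => ((R : ℂ) ^ 2 - (starRingEnd ℂ) a * w) / R)
          (-(starRingEnd ℂ) a / R) z := by
        have := ((((hasDerivAt_id z).const_mul ((starRingEnd ℂ) a)).const_sub
          ((R : ℂ) ^ 2)).div_const (R : ℂ))
        simpa using! this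
      exact (h1.mul (hD z).hasDerivAt).deriv
    set b := ((R : ℂ) ^ 2 - (starRingEnd ℂ) a * z) / R with hb
    have hbR : R - r ≤ ‖b‖ := by
      rw [hb, norm_div, Complex.norm_real, norm_eq_abs, abs_of_pos hR, le_div_iff₀ hR]
      have h1 : ‖(R : ℂ) ^ 2‖ - ‖(starRingEnd ℂ) a * z‖ ≤ ‖(R : ℂ) ^ 2 - (starRingEnd ℂ) a * z‖ :=
        norm_sub_norm_le _ _
      have h2 : ‖(starRingEnd ℂ) a * z‖ ≤ R * r := by
        rw [norm_mul, RCLike.norm_conj]; gcongr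
      have h3 : ‖(R : ℂ) ^ 2‖ = R ^ 2 := by simp
      rw [h3] at h1
      nlinarith
    have hbpos : 0 < ‖b‖ := by linarith
    have hca : ‖-(starRingEnd ℂ) a / (R : ℂ)‖ ≤ 1 := by
      rw [norm_div, norm_neg, RCLike.norm_conj, Complex.norm_real, norm_eq_abs, abs_of_pos hR]
      exact div_le_one_of_le₀ ha hR.le
    have hDK : ‖deriv D z‖ ≤ (1 / (R - r) + K) * ‖D z‖ := by
      rw [hder, blaschkeDenom_cons, mul_assoc, norm_mul _ (blaschkeDenom R l z * g z)] at hK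
      have h1 : ‖b‖ * ‖deriv D z‖ ≤ 1 * ‖D z‖ + K * (‖b‖ * ‖D z‖) := by
        have h2 : b * deriv D z = ((-(starRingEnd ℂ) a / R) * D z + b * deriv D z) -
          (-(starRingEnd ℂ) a / R) * D z := by ring
        rw [← norm_mul, h2]
        refine (norm_sub_le _ _).trans ?_
        rw [add_comm, norm_mul (_ / _)]
        gcongr
      have h3 : 1 * ‖D z‖ ≤ ‖b‖ / (R - r) * ‖D z‖ := by
        gcongr
        exact (one_le_div (by linarith)).2 hbR
      refine le_of_mul_le_mul_left (h1.trans ((add_le_add_left h3 _).trans ?_)) hbpos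
      exact le_of_eq (by ring)
    have := ih (K := 1 / (R - r) + K) (fun b hb => hl b (by simp [hb])) hDK
    refine this.trans (le_of_eq ?_)
    push_cast [List.length_cons]
    ring

/-- The lemma on the logarithmic derivative, pointwise and away from the zeros. -/
lemma exists_norm_deriv_le {u : ℂ → ℂ} (hu : Differentiable ℂ u) (h0 : u 0 ≠ 0)
    {r s R M L : ℝ} (hr : 0 < r) (hrs : r < s) (hsR : s < R) (hM : ∀ z, ‖z‖ = R → ‖u z‖ ≤ M)
    (hL0 : 0 < L) (hL : log (M / ‖u 0‖) ≤ L) :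
    ∃ l : List ℂ, l.length * log (R / s) ≤ L ∧ ∀ z, ‖z‖ ≤ r → ∀ d > 0,
      (∀ a ∈ l, d ≤ ‖z - a‖) → u z ≠ 0 ∧
        ‖deriv u z‖ ≤ (l.length / d + l.length / (R - r) + 8 * L * s / (s - r) ^ 2) * ‖u z‖ := by
  have hs := hr.trans hrs
  have hR := hs.trans hsR
  obtain ⟨l, g, hg, hug, hl, hgs, hlen⟩ := exists_rootsProd_mul hu h0 hs hsR hM
  have huf : u = fun z => rootsProd l z * g z := funext hug
  refine ⟨l, hlen.trans hL, fun z hz d hd hld => ⟨?_, ?_⟩⟩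
  · rw [hug z]
    refine mul_ne_zero ?_ (hgs z (by linarith))
    intro h
    rw [rootsProd, List.prod_eq_zero_iff] at h
    obtain ⟨a, ha, hza⟩ := List.mem_map.1 h
    have := hld a ha
    rw [hza, norm_zero] at this
    linarith
  · set G : ℂ → ℂ := fun w => blaschkeDenom R l w * g w with hG
    have hGd : Differentiable ℂ G := (differentiable_blaschkeDenom R l).mul hg
    have hGne : ∀ w, ‖w‖ < s → G w ≠ 0 := fun w hw =>
      mul_ne_zero (blaschkeDenom_ne_zero hR fun a ha => by
        have := hl a ha
        nlinarith [norm_nonneg a, norm_nonneg w]) (hgs w hw.le)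
    have hGM : ∀ w, ‖w‖ < s → ‖G w‖ ≤ M := fun w hw => by
      refine Complex.norm_le_of_forall_mem_frontier_norm_le (U := ball 0 R) isBounded_ball
        hGd.diffContOnCl ?_ (subset_closure (mem_ball_zero_iff.2 (hw.trans hsR)))
      intro x hx
      rw [frontier_ball _ hR.ne', mem_sphere_zero_iff_norm] at hx
      have := hM x hx
      rwa [hug x, norm_mul, norm_rootsProd_eq hR l hx, ← norm_mul] at this
    have hu0G : ‖u 0‖ ≤ ‖G 0‖ := by
      rw [hug 0, norm_mul, hG, norm_mul]
      gcongr
      exact norm_rootsProd_le hR (fun a ha => (hl a ha).trans hsR.le) (by simpa using hR.le)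
    have hMpos : 0 < M := (norm_pos_iff.2 (hGne 0 (by simpa using hs))).trans_le
      (hGM 0 (by simpa using hs))
    have hLG : log (M / ‖G 0‖) ≤ L := by
      refine le_trans (log_le_log (div_pos hMpos (norm_pos_iff.2 (hGne 0 (by simpa using hs)))) ?_)
        hL
      gcongr
    have h1 := norm_deriv_le_of_ne_zero hGd hr.le hrs hGne hGM hL0 hLG hz
    have h2 := norm_deriv_le_of_mul_blaschkeDenom hg (hrs.trans hsR) hz l
      (fun a ha => (hl a ha).trans hsR.le) h1
    have h3 := norm_deriv_rootsProd_mul_le hg hd h2 l hld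
    rw [← huf, ← hug z] at h3
    rw [add_assoc]
    exact h3

/-- The characteristic of an entire function. -/
noncomputable def charT (u : ℂ → ℂ) (r : ℝ) : ℝ := circleAverage (fun z => log⁺ ‖u z‖) 0 r

lemma charT_nonneg (u : ℂ → ℂ) (r : ℝ) : 0 ≤ charT u r :=
  circleAverage_nonneg_of_nonneg fun _ _ => posLog_nonneg

lemma charT_mono {u : ℂ → ℂ} (hu : Differentiable ℂ u) {r R : ℝ} (hr : 0 < r) (hrR : r ≤ R) :
    charT u r ≤ charT u R := by
  have hm : Meromorphic u := fun z => (hu.analyticAt z).meromorphicAt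
  have h := ValueDistribution.characteristic_monotoneOn hm (mem_Ioi.2 hr)
    (mem_Ioi.2 (hr.trans_le hrR)) hrR
  have hz : ValueDistribution.logCounting u ⊤ = 0 := by
    rw [ValueDistribution.logCounting_top]
    have : 0 ≤ MeromorphicOn.divisor u univ :=
      MeromorphicOn.AnalyticOnNhd.divisor_nonneg fun z _ => hu.analyticAt z
    rw [negPart_eq_zero.2 this, map_zero]
  simpa [charT, ValueDistribution.characteristic, hz, ValueDistribution.proximity_top] using h

/-- The maximum modulus is controlled by the characteristic. -/
lemma log_norm_le_charT {u : ℂ → ℂ} (hu : Differentiable ℂ u) (h0 : u 0 ≠ 0) {r R : ℝ}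
    (hr : 0 < r) (hrR : r < R) {w : ℂ} (hw : ‖w‖ ≤ r) :
    log ‖u w‖ ≤ 4 * R / (R - r) * charT u R := by
  have hR : 0 < R := hr.trans hrR
  have hRr : 0 < R - r := by linarith
  have hT := charT_nonneg u R
  rcases eq_or_ne (u w) 0 with h | huw
  · rw [h, norm_zero, log_zero]; positivity
  obtain ⟨M, hM⟩ : ∃ M, ∀ z ∈ closedBall (0 : ℂ) R, ‖u z‖ ≤ M :=
    (isCompact_closedBall _ _).exists_bound_of_continuousOn hu.continuous.continuousOn
  have hM' : ∀ z, ‖z‖ = R → ‖u z‖ ≤ M := fun z hz => hM z (by simp [hz])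
  set s := (r + 3 * R) / 4 with hs
  obtain ⟨l, g, -, hug, -, hgs, -⟩ :=
    exists_rootsProd_mul hu h0 (s := s) (by linarith) (by linarith) hM'
  obtain ⟨t, ht, htl⟩ : ∃ t ∈ Ioo ((r + R) / 2) s, t ∉ (l.map norm).toFinset :=
    (Ioo_infinite (by linarith)).exists_notMem_finset _
  have ht0 : 0 < t := by have := ht.1; linarith
  have htR : t < R := by have := ht.2; linarith
  have htn : ∀ z, ‖z‖ = t → u z ≠ 0 := by
    intro z hz h
    rw [hug z] at h
    rcases mul_eq_zero.1 h with h | h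
    · rw [rootsProd, List.prod_eq_zero_iff] at h
      obtain ⟨a, ha, hza⟩ := List.mem_map.1 h
      rw [sub_eq_zero] at hza
      exact htl (by simpa using ⟨a, ha, by rw [← hza, hz]⟩)
    · exact hgs z (by rw [hz]; exact ht.2.le) h
  obtain ⟨l', g', hg', hug', hl', hgs', -⟩ := exists_rootsProd_mul hu h0 ht0 htR hM'
  have hl'' : ∀ a ∈ l', ‖a‖ < t := by
    intro a ha
    refine lt_of_le_of_ne (hl' a ha) fun h => htn a h ?_
    rw [hug' a, rootsProd, List.prod_eq_zero_iff.2, zero_mul]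
    exact List.mem_map.2 ⟨a, ha, sub_self a⟩
  set G : ℂ → ℂ := fun z => blaschkeDenom t l' z * g' z with hG
  have hGd : Differentiable ℂ G := (differentiable_blaschkeDenom t l').mul hg'
  have hGne : ∀ z, ‖z‖ ≤ t → G z ≠ 0 := fun z hz =>
    mul_ne_zero (blaschkeDenom_ne_zero ht0 fun a ha => by
      have := hl'' a ha
      nlinarith [norm_nonneg a, norm_nonneg z]) (hgs' z hz)
  have hGu : ∀ z, ‖z‖ = t → ‖G z‖ = ‖u z‖ := fun z hz => by
    rw [hug' z, hG, norm_mul, norm_mul, norm_rootsProd_eq ht0 l' hz]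
  have hwt : ‖w‖ < t := by have := ht.1; linarith
  have hwb : w ∈ ball (0 : ℂ) t := by simpa using hwt
  have hharm : InnerProductSpace.HarmonicOnNhd (fun z => log ‖G z‖) (closedBall 0 t) := fun z hz =>
    (hGd.analyticAt z).harmonicAt_log_norm (hGne z (by simpa using hz))
  have hP := hharm.circleAverage_re_herglotzRieszKernel_smul hwb
  have huG : ‖u w‖ ≤ ‖G w‖ := by
    rw [hug' w, hG, norm_mul, norm_mul]
    gcongr
    exact norm_rootsProd_le ht0 hl' hwt.le
  have hlog : log ‖u w‖ ≤ log ‖G w‖ := log_le_log (norm_pos_iff.2 huw) huG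
  refine hlog.trans ?_
  rw [← hP]
  have hci : CircleIntegrable (fun z => log⁺ ‖u z‖) 0 t :=
    MeromorphicOn.circleIntegrable_posLog_norm fun z _ => (hu.analyticAt z).meromorphicAt
  have hker : ContinuousOn (Complex.re ∘ herglotzRieszKernel 0 w) (sphere 0 |t|) :=
    Complex.continuous_re.comp_continuousOn (continuousOn_herglotzRieszKernel_sphere hwb)
  have hlogc : ContinuousOn (fun z => log ‖G z‖) (sphere 0 |t|) := by
    refine ContinuousOn.log hGd.continuous.norm.continuousOn fun z hz => ?_
    rw [abs_of_pos ht0, mem_sphere_zero_iff_norm] at hz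
    exact norm_ne_zero_iff.2 (hGne z hz.le)
  have hb : circleAverage ((Complex.re ∘ herglotzRieszKernel 0 w) • fun z => log ‖G z‖) 0 t ≤
      circleAverage (fun z => (4 * R / (R - r)) • log⁺ ‖u z‖) 0 t := by
    refine circleAverage_mono (hker.smul hlogc).circleIntegrable' (hci.const_fun_smul) ?_
    intro z hz
    rw [abs_of_pos ht0] at hz
    have hz' := mem_sphere_zero_iff_norm.1 hz
    have h1 := re_herglotzRieszKernel_le hz hwb
    have h2 := le_re_herglotzRieszKernel hz hwb
    simp only [sub_zero] at h1 h2
    simp only [Pi.smul_apply', Function.comp_apply, smul_eq_mul, herglotzRieszKernel_def, sub_zero]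
    rw [hGu z hz']
    have h3 : 0 ≤ ((z + w) / (z - w)).re := by
      refine le_trans ?_ h2
      have := norm_nonneg w
      apply div_nonneg <;> linarith
    have h4 : (t + ‖w‖) / (t - ‖w‖) ≤ 4 * R / (R - r) := by
      have := norm_nonneg w
      have := ht.1
      rw [div_le_div_iff₀ (by linarith) hRr]
      nlinarith
    calc _ ≤ ((z + w) / (z - w)).re * log⁺ ‖u z‖ := by
          gcongr
          exact le_max_right _ _
      _ ≤ _ := by
          gcongr
          · exact posLog_nonneg
          · linarith
  refine hb.trans ?_
  rw [circleAverage_fun_smul, smul_eq_mul]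
  gcongr
  exact charT_mono hu ht0 htR.le

lemma exists_radius_avoiding (l : List ℂ) (a : ℝ) {η : ℝ} (hη : 0 < η) :
    ∃ ρ ∈ Icc a (a + η), ∀ z : ℂ, ‖z‖ = ρ → ∀ b ∈ l, η / (2 * (l.length + 1)) ≤ ‖z - b‖ := by
  set d := η / (2 * (l.length + 1)) with hd
  have hm : (0 : ℝ) < l.length + 1 := by positivity
  have hd0 : 0 < d := by positivity
  have hdm : 2 * (l.length + 1) * d = η := by rw [hd]; field_simp
  set x : Fin (l.length + 1) → ℝ := fun j => a + (2 * (j : ℕ) + 1) * d with hx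
  suffices h : ∃ j, ∀ b ∈ l, d ≤ |x j - ‖b‖| by
    obtain ⟨j, hj⟩ := h
    have hjm : ((j : ℕ) : ℝ) ≤ l.length := by exact_mod_cast Nat.lt_succ_iff.1 j.2
    refine ⟨x j, ⟨?_, ?_⟩, fun z hz b hb => (hj b hb).trans ?_⟩
    · rw [hx]; simp only; nlinarith [Nat.cast_nonneg (α := ℝ) (j : ℕ)]
    · rw [hx]; simp only; nlinarith [Nat.cast_nonneg (α := ℝ) (j : ℕ)]
    · rw [← hz]; exact abs_norm_sub_norm_le z b
  by_contra! hcon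
  have hcon' : ∀ j, ∃ i : Fin l.length, |x j - ‖l.get i‖| < d := fun j => by
    obtain ⟨b, hb, hlt⟩ := hcon j
    obtain ⟨i, hi⟩ := List.mem_iff_get.1 hb
    exact ⟨i, by rw [hi]; exact hlt⟩
  choose i hi using hcon'
  obtain ⟨j, k, hjk, hijk⟩ := Fintype.exists_ne_map_eq_of_card_lt i (by simp)
  have h1 := hi j
  have h2 := hi k
  rw [hijk] at h1
  have h3 : |x j - x k| < 2 * d := by
    rw [abs_lt] at h1 h2 ⊢; constructor <;> linarith
  have h4 : x j - x k = 2 * d * (((j : ℕ) : ℝ) - (k : ℕ)) := by rw [hx]; ring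
  rw [h4, abs_mul, abs_of_pos (by positivity : 0 < 2 * d)] at h3
  have h5 : |((j : ℕ) : ℝ) - (k : ℕ)| < 1 := by
    by_contra! h
    nlinarith
  have h6 : |((j : ℕ) : ℤ) - (k : ℕ)| < 1 := by exact_mod_cast h5
  rw [Int.abs_lt_one_iff] at h6
  exact hjk (Fin.ext (by omega))

/-- A circle on which the logarithmic derivatives of three entire functions are bounded. -/
lemma exists_circle_norm_deriv_le {u : Fin 3 → ℂ → ℂ} (hu : ∀ i, Differentiable ℂ (u i))
    (h0 : ∀ i, u i 0 ≠ 0) {r η M L : ℝ} (hr : 1 ≤ r) (hη : 0 < η)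
    (hM : ∀ i z, ‖z‖ = r + 3 * η → ‖u i z‖ ≤ M) (hL1 : 1 ≤ L)
    (hL : ∀ i, log (M / ‖u i 0‖) ≤ L) :
    ∃ ρ ∈ Icc r (r + η), ∀ i z, ‖z‖ = ρ → u i z ≠ 0 ∧
      ‖deriv (u i) z‖ ≤ 17 * L ^ 2 * (r + 3 * η) ^ 2 / η ^ 3 * ‖u i z‖ := by
  have key := fun i => exists_norm_deriv_le (hu i) (h0 i) (r := r + η) (s := r + 2 * η)
    (R := r + 3 * η) (by linarith) (by linarith) (by linarith) (hM i) (by linarith) (hL i)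
  choose l hl hl' using key
  obtain ⟨ρ, hρ, hd⟩ := exists_radius_avoiding (l 0 ++ l 1 ++ l 2) r hη
  set R := r + 3 * η with hR
  have hR0 : 0 < R := by linarith
  have hlen : ∀ i, ((l i).length : ℝ) ≤ L * R / η := by
    intro i
    have h1 : η / R ≤ log (R / (r + 2 * η)) := by
      have h2 := one_sub_inv_le_log_of_pos (x := R / (r + 2 * η)) (by positivity)
      refine le_trans (le_of_eq ?_) h2
      rw [inv_div, eq_sub_iff_add_eq, ← add_div, div_eq_one_iff_eq hR0.ne']
      rw [hR]; ring
    have h3 := (mul_le_mul_of_nonneg_left h1 (Nat.cast_nonneg (l i).length)).trans (hl i)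
    rw [le_div_iff₀ hη]
    rw [← mul_div_assoc, div_le_iff₀ hR0] at h3
    exact h3
  set X := L * R / η with hX
  have hX1 : 1 ≤ X := by
    rw [hX, le_div_iff₀ hη]; nlinarith
  set m : ℝ := ((l 0 ++ l 1 ++ l 2).length : ℝ) with hm
  have hm3 : m ≤ 3 * X := by
    have := hlen 0; have := hlen 1; have := hlen 2
    rw [hm]; push_cast [List.length_append]; linarith
  have hm0 : 0 ≤ m := Nat.cast_nonneg _
  refine ⟨ρ, hρ, fun i z hz => ?_⟩
  have hmem : ∀ a ∈ l i, a ∈ l 0 ++ l 1 ++ l 2 := by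
    fin_cases i <;> simp +contextual
  obtain ⟨h1, h2⟩ := hl' i z (hz.le.trans hρ.2) (η / (2 * (m + 1))) (by positivity)
    fun a ha => hd z hz a (hmem a ha)
  refine ⟨h1, h2.trans ?_⟩
  gcongr
  have e1 : ((l i).length : ℝ) / (η / (2 * (m + 1))) ≤ X * (8 * X) / η := by
    rw [div_div_eq_mul_div]
    have h5 : 2 * (m + 1) ≤ 8 * X := by linarith
    exact div_le_div_of_nonneg_right (mul_le_mul (hlen i) h5 (by positivity) (by linarith)) hη.le
  have e2 : ((l i).length : ℝ) / (R - (r + η)) ≤ X * X / η := by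
    have : R - (r + η) = 2 * η := by rw [hR]; ring
    rw [this]
    have hli := hlen i
    gcongr
    · nlinarith
    · linarith
  have e3 : 8 * L * (r + 2 * η) / (r + 2 * η - (r + η)) ^ 2 ≤ 8 * X * X / η := by
    have : r + 2 * η - (r + η) = η := by ring
    rw [this]
    have : 8 * L * (r + 2 * η) / η ^ 2 = 8 * (L * (r + 2 * η) / η) / η := by field_simp
    rw [this]
    have h5 : L * (r + 2 * η) / η ≤ X := by
      rw [hX]; gcongr; linarith
    gcongr
    nlinarith
  have e4 : 17 * L ^ 2 * R ^ 2 / η ^ 3 = X * (8 * X) / η + X * X / η + 8 * X * X / η := by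
    rw [hX]; field_simp; ring
  rw [e4]
  linarith

/-- Borel's growth lemma. -/
lemma exists_le_two_mul {T : ℝ → ℝ} (hT1 : ∀ r, 1 ≤ T r)
    (hT : ∀ r R, 0 < r → r ≤ R → T r ≤ T R) (a : ℝ) (ha : 0 < a) :
    ∃ r ≥ a, T (r + 1 / T r) ≤ 2 * T r := by
  by_contra! hcon
  have key : ∀ k : ℕ, ∃ r, a ≤ r ∧ r ≤ a + 2 - 2 * (1 / 2) ^ k ∧ 2 ^ k ≤ T r := by
    intro k
    induction k with
    | zero => exact ⟨a, le_rfl, by simp, by simpa using hT1 a⟩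
    | succ k ih =>
      obtain ⟨r, h1, h2, h3⟩ := ih
      have hr := hT1 r
      have h4 : 1 / T r ≤ (1 / 2) ^ k := by
        rw [one_div_pow]
        exact one_div_le_one_div_of_le (by positivity) h3
      have h5 : 0 < 1 / T r := by positivity
      refine ⟨r + 1 / T r, by linarith, ?_, ?_⟩
      · rw [pow_succ]; linarith
      · rw [pow_succ]; linarith [hcon r h1]
  obtain ⟨k, hk⟩ := pow_unbounded_of_one_lt (T (a + 2)) (one_lt_two (α := ℝ))
  obtain ⟨r, h1, h2, h3⟩ := key k
  have : (0 : ℝ) < (1 / 2) ^ k := by positivity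
  have := hT r (a + 2) (by linarith) (by linarith)
  linarith

/-- There are arbitrarily large circles on which the logarithmic derivatives of `F`, `F - 1` and
`F' - 1` are bounded by a polynomial in the radius and the characteristic. -/
lemma exists_large_circle {F : ℂ → ℂ} (hF : Differentiable ℂ F) (h0 : F 0 ≠ 0) (h1 : F 0 ≠ 1)
    (h2 : deriv F 0 ≠ 1) :
    ∃ C : ℝ, ∀ a : ℝ, ∃ r ρ B : ℝ, a ≤ r ∧ 1 ≤ r ∧ r ≤ ρ ∧ 2 ≤ B ∧
      log B ≤ C + 4 * log r + 7 * log (charT F r + 1) ∧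
      ∀ z, ‖z‖ = ρ → (F z ≠ 0 ∧ ‖deriv F z‖ ≤ B * ‖F z‖) ∧
        (F z - 1 ≠ 0 ∧ ‖deriv F z‖ ≤ B * ‖F z - 1‖) ∧
        (deriv F z - 1 ≠ 0 ∧ ‖deriv (deriv F) z‖ ≤ B * ‖deriv F z - 1‖) := by
  have hdF : Differentiable ℂ (deriv F) :=
    differentiableOn_univ.1 (hF.differentiableOn.deriv isOpen_univ)
  set u : Fin 3 → ℂ → ℂ := ![F, fun z => F z - 1, fun z => deriv F z - 1] with hu_def
  have hu : ∀ i, Differentiable ℂ (u i) := by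
    intro i; fin_cases i
    · exact hF
    · exact hF.sub_const 1
    · exact hdF.sub_const 1
  have hu0 : ∀ i, u i 0 ≠ 0 := by
    intro i; fin_cases i
    · exact h0
    · exact sub_ne_zero.2 h1
    · exact sub_ne_zero.2 h2
  obtain ⟨C₀, hC₀1, hC₀⟩ : ∃ C₀ : ℝ, 1 ≤ C₀ ∧ ∀ i, -log ‖u i 0‖ ≤ C₀ := by
    refine ⟨1 + ∑ i, |log ‖u i 0‖|, ?_, fun i => ?_⟩
    · have : 0 ≤ ∑ i, |log ‖u i 0‖| := Finset.sum_nonneg fun i _ => abs_nonneg _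
      linarith
    · have := Finset.single_le_sum (f := fun i => |log ‖u i 0‖|) (fun i _ => abs_nonneg _)
        (Finset.mem_univ i)
      have := neg_le_abs (log ‖u i 0‖)
      linarith
  set T : ℝ → ℝ := fun r => charT F r + 1 with hTdef
  have hT1 : ∀ r, 1 ≤ T r := fun r => by have := charT_nonneg F r; simp only [hTdef]; linarith
  have hTm : ∀ r R, 0 < r → r ≤ R → T r ≤ T R := fun r R hr hrR =>
    add_le_add_left (charT_mono hF hr hrR) 1
  refine ⟨log (17 * (91 + C₀) ^ 2 * 4 * 125), fun a => ?_⟩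
  obtain ⟨r, hra, hgr⟩ := exists_le_two_mul hT1 hTm (max a 1) (by positivity)
  have hr1 : 1 ≤ r := (le_max_right _ _).trans hra
  have htr := hT1 r
  set t := T r with ht
  set η := 1 / (5 * t) with hη_def
  have hη : 0 < η := by positivity
  have hη5 : r + 5 * η = r + 1 / t := by rw [hη_def]; field_simp
  have hη1 : η ≤ 1 / 5 := by
    rw [hη_def]; exact one_div_le_one_div_of_le (by norm_num) (by linarith)
  set X := 80 * r * t ^ 2 with hX
  have hX0 : 0 ≤ X := by positivity
  have hFX : ∀ w, ‖w‖ ≤ r + 4 * η → ‖F w‖ ≤ exp X := by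
    intro w hw
    rcases eq_or_ne (F w) 0 with hw0 | hw0
    · rw [hw0, norm_zero]; positivity
    rw [← log_le_iff_le_exp (norm_pos_iff.2 hw0)]
    have := log_norm_le_charT hF h0 (r := r + 4 * η) (R := r + 5 * η) (by linarith) (by linarith) hw
    refine this.trans ?_
    have h3 : charT F (r + 5 * η) ≤ 2 * t := by
      rw [← hη5] at hgr
      have : charT F (r + 5 * η) + 1 ≤ 2 * t := hgr
      linarith
    have h4 : r + 5 * η - (r + 4 * η) = η := by ring
    rw [h4]
    have h5 := charT_nonneg F (r + 5 * η)
    calc 4 * (r + 5 * η) / η * charT F (r + 5 * η) ≤ 4 * (r + r) / η * (2 * t) := by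
          gcongr; linarith
      _ = X := by rw [hη_def, hX]; field_simp; ring
  have hF'X : ∀ w, ‖w‖ ≤ r + 3 * η → ‖deriv F w‖ ≤ exp X / η := by
    intro w hw
    refine Complex.norm_deriv_le_of_forall_mem_sphere_norm_le hη hF.diffContOnCl fun z hz => ?_
    apply hFX
    have := norm_add_le (z - w) w
    rw [sub_add_cancel, mem_sphere_iff_norm.1 hz] at this
    linarith
  have hX1 : 1 ≤ exp X := one_le_exp hX0
  have hη1' : exp X ≤ exp X / η := by
    rw [le_div_iff₀ hη]; nlinarith
  have hM : ∀ i z, ‖z‖ = r + 3 * η → ‖u i z‖ ≤ 2 * exp X / η := by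
    intro i z hz
    have e1 := hFX z (by linarith)
    have e2 := hF'X z hz.le
    have e3 : 2 * exp X / η = exp X / η + exp X / η := by ring
    rw [e3]
    fin_cases i
    · change ‖F z‖ ≤ _
      linarith
    · change ‖F z - 1‖ ≤ _
      have := norm_sub_le (F z) 1
      rw [norm_one] at this
      linarith
    · change ‖deriv F z - 1‖ ≤ _
      have := norm_sub_le (deriv F z) 1
      rw [norm_one] at this
      linarith
  set L := (91 + C₀) * r * t ^ 2 with hL_def
  have hrt : 1 ≤ r * t ^ 2 := by nlinarith
  have hL1 : 1 ≤ L := by rw [hL_def, mul_assoc]; nlinarith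
  have hL : ∀ i, log (2 * exp X / η / ‖u i 0‖) ≤ L := by
    intro i
    have hui := norm_ne_zero_iff.2 (hu0 i)
    rw [log_div (by positivity) hui, log_div (by positivity) hη.ne',
      log_mul (by norm_num) (by positivity), log_exp]
    have e1 := hC₀ i
    have e2 : log 2 ≤ 1 := by have := log_two_lt_d9; linarith
    have e3 : -log η ≤ 5 * t := by
      rw [← log_inv, hη_def, one_div, inv_inv]
      have := log_le_sub_one_of_pos (x := 5 * t) (by positivity)
      linarith
    have e4 : t ≤ r * t ^ 2 := by nlinarith
    rw [hL_def]
    nlinarith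
  obtain ⟨ρ, hρ, hρu⟩ := exists_circle_norm_deriv_le hu hu0 hr1 hη hM hL1 hL
  set B := 17 * L ^ 2 * (r + 3 * η) ^ 2 / η ^ 3 with hB
  have hB2 : 2 ≤ B := by
    rw [hB, le_div_iff₀ (by positivity)]
    have e1 : η ^ 3 ≤ 1 := pow_le_one₀ hη.le (by linarith)
    have e2 : 1 ≤ L ^ 2 := one_le_pow₀ hL1
    have e3 : 1 ≤ (r + 3 * η) ^ 2 := one_le_pow₀ (by linarith)
    nlinarith
  have hBle : B ≤ 17 * (91 + C₀) ^ 2 * 4 * 125 * r ^ 4 * t ^ 7 := by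
    calc B ≤ 17 * L ^ 2 * (r + r) ^ 2 / η ^ 3 := by
          rw [hB]; gcongr; linarith
      _ = _ := by rw [hL_def, hη_def]; field_simp; ring
  refine ⟨r, ρ, B, (le_max_left _ _).trans hra, hr1, hρ.1, hB2, ?_, fun z hz => ?_⟩
  · refine (log_le_log (by positivity) hBle).trans (le_of_eq ?_)
    rw [log_mul (by positivity) (by positivity), log_mul (by positivity) (by positivity),
      log_pow, log_pow]
    push_cast
    rfl
  · have e0 := hρu 0 z hz
    have e1 := hρu 1 z hz
    have e2 := hρu 2 z hz
    refine ⟨e0, ?_, ?_⟩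
    · simpa [hu_def] using e1
    · simpa [hu_def] using e2

lemma differentiable_deriv {u : ℂ → ℂ} (hu : Differentiable ℂ u) : Differentiable ℂ (deriv u) :=
  differentiableOn_univ.1 (hu.differentiableOn.deriv isOpen_univ)

lemma exp_neg_posLog_inv {x : ℝ} (hx : 0 < x) : exp (-log⁺ x⁻¹) = min 1 x := by
  rcases le_total 1 x with h | h
  · rw [posLog_eq_zero_iff _ |>.2 (by
      rw [abs_of_pos (inv_pos.2 hx)]; exact inv_le_one_of_one_le₀ h)]
    simp [h]
  · rw [posLog_eq_log (by rw [abs_of_pos (inv_pos.2 hx)]; exact (one_le_inv₀ hx).2 h), log_inv,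
      neg_neg, exp_log hx, min_eq_right h]

lemma exp_posLog (x : ℝ) (hx : 0 ≤ x) : exp (log⁺ x) = max 1 x := by
  rcases le_total 1 x with h | h
  · rw [posLog_eq_log (by rwa [abs_of_nonneg hx]), exp_log (by linarith), max_eq_right h]
  · rw [posLog_eq_zero_iff _ |>.2 (by rwa [abs_of_nonneg hx]), exp_zero, max_eq_left h]

/-- The characteristic of `f ^ n` is bounded by the logarithm of the bound for logarithmic
derivatives. -/
lemma exists_charT_le {f φ : ℂ → ℂ} (hf : Differentiable ℂ f) (hφ : Differentiable ℂ φ) {n : ℕ}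
    (hn : 3 ≤ n) (hφ0 : ∀ z, φ z ≠ 0)
    (hshare : ∀ z, deriv (fun w => f w ^ n) z - 1 = φ z * (f z ^ n - 1))
    (hF'0 : deriv (fun w => f w ^ n) 0 ≠ 0) (hφ'0 : deriv φ 0 ≠ 0) (hφ1 : φ 0 ≠ 1) :
    ∃ C : ℝ, ∀ ρ > 0, ∀ B ≥ 2,
      (∀ z, ‖z‖ = ρ →
        (f z ^ n ≠ 0 ∧ ‖deriv (fun w => f w ^ n) z‖ ≤ B * ‖f z ^ n‖) ∧
        (f z ^ n - 1 ≠ 0 ∧ ‖deriv (fun w => f w ^ n) z‖ ≤ B * ‖f z ^ n - 1‖) ∧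
        (deriv (fun w => f w ^ n) z - 1 ≠ 0 ∧ ‖deriv (deriv (fun w => f w ^ n)) z‖ ≤
          B * ‖deriv (fun w => f w ^ n) z - 1‖)) →
      charT (fun w => f w ^ n) ρ ≤ 9 * log (2 * B) + C := by
  set F : ℂ → ℂ := fun w => f w ^ n with hF_def
  have hF : Differentiable ℂ F := hf.pow n
  have hdF : Differentiable ℂ (deriv F) := differentiable_deriv hF
  have hdf : Differentiable ℂ (deriv f) := differentiable_deriv hf
  have hsh : ∀ z, deriv F z - 1 = φ z * (F z - 1) := hshare
  obtain ⟨k, rfl⟩ : ∃ k, n = k + 2 := ⟨n - 2, by omega⟩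
  have hk : (1 : ℝ) ≤ k := by exact_mod_cast (by omega : 1 ≤ k)
  have hF' : ∀ z, deriv F z = (k + 2) * f z ^ (k + 1) * deriv f z := fun z => by
    have := ((hf z).hasDerivAt.pow (k + 2)).deriv
    rw [show F = f ^ (k + 2) from rfl, this]
    push_cast
    simp
  -- second derivative
  have hF'' : ∀ z, deriv (deriv F) z = deriv φ z * (F z - 1) + φ z * deriv F z := fun z => by
    have h1 : deriv F = fun z => φ z * (F z - 1) + 1 := funext fun z => by rw [← hsh z]; ring
    have h2 := ((((hφ z).hasDerivAt.mul ((hF z).hasDerivAt.sub_const 1))).add_const 1).deriv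
    rw [← h2]
    conv_lhs => rw [h1]
    rfl
  set P : ℂ → ℂ := fun z => (k + 2) * deriv f z - φ z * f z with hP_def
  have hP : Differentiable ℂ P := (hdf.const_mul _).sub (hφ.mul hf)
  have hdP := differentiable_deriv hP
  have hφP : ∀ z, 1 - φ z = f z ^ (k + 1) * P z := fun z => by
    have h1 := hsh z
    rw [hF' z] at h1
    have h2 : F z = f z ^ (k + 1) * f z := pow_succ _ _
    rw [h2] at h1
    simp only [hP_def]
    linear_combination -h1
  set Q : ℂ → ℂ := fun z => ((k + 1) * deriv f z * P z + f z * deriv P z) / φ z with hQ_def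
  have hQ : Differentiable ℂ Q :=
    (((hdf.const_mul _).mul hP).add (hf.mul hdP)).div hφ hφ0
  have hφ'Q : ∀ z, deriv φ z = -(f z ^ k * Q z * φ z) := fun z => by
    have h1 : φ = fun z => 1 - f z ^ (k + 1) * P z := funext fun z => by rw [← hφP z]; ring
    have h2 := (((((hf z).hasDerivAt.pow (k + 1)).mul (hP z).hasDerivAt)).const_sub 1).deriv
    have h3 : deriv φ z = -(((k + 1 : ℕ) : ℂ) * f z ^ k * deriv f z * P z +
        f z ^ (k + 1) * deriv P z) := by
      conv_lhs => rw [h1]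
      exact h2
    rw [h3]
    simp only [hQ_def]
    field_simp [hφ0 z]
    push_cast
    ring
  have hQ0 : Q 0 ≠ 0 := fun h => hφ'0 (by rw [hφ'Q 0, h]; ring)
  set q := |log ‖Q 0‖| with hq
  set c₁ := |log ‖deriv F 0‖| with hc₁
  set c₂ := |log ‖1 - φ 0‖| with hc₂
  refine ⟨6 * q + c₁ + c₂, fun ρ hρ B hB hcirc => ?_⟩
  have hB0 : 0 < B := by linarith
  have hlB : 0 ≤ log (2 * B) := log_nonneg (by linarith)
  have he2B : exp (log (2 * B)) = 2 * B := exp_log (by linarith)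
  have hci : ∀ {u : ℂ → ℂ}, Differentiable ℂ u → CircleIntegrable (fun z => log ‖u z‖) 0 ρ :=
    fun hu => MeromorphicOn.circleIntegrable_log_norm fun z _ =>
      (hu.analyticAt z).meromorphicAt
  have hcp : ∀ {u : ℂ → ℂ}, Differentiable ℂ u → CircleIntegrable (fun z => log⁺ ‖u z‖) 0 ρ :=
    fun hu => MeromorphicOn.circleIntegrable_posLog_norm fun z _ =>
      (hu.analyticAt z).meromorphicAt
  have hcinv : ∀ {u : ℂ → ℂ}, Differentiable ℂ u →
      CircleIntegrable (fun z => log⁺ ‖u z‖⁻¹) 0 ρ := fun {u} hu => by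
    have : CircleIntegrable (fun z => log⁺ ‖u⁻¹ z‖) 0 ρ :=
      MeromorphicOn.circleIntegrable_posLog_norm fun z _ =>
        (hu.analyticAt z).meromorphicAt.inv
    simpa using this
  have hconst : CircleIntegrable (fun _ : ℂ => log (2 * B)) 0 ρ := circleIntegrable_const _ _ _
  have hfz : ∀ z, ‖z‖ = ρ → f z ≠ 0 := fun z hz h =>
    (hcirc z hz).1.1 (by rw [h, zero_pow (by omega)])
  have hφ'B : ∀ z, ‖z‖ = ρ → ‖deriv φ z‖ ≤ 2 * B * ‖φ z‖ := by
    intro z hz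
    obtain ⟨-, ⟨h1, h2⟩, -, h3⟩ := hcirc z hz
    have hpos := norm_pos_iff.2 h1
    refine le_of_mul_le_mul_right ?_ hpos
    have h4 : deriv φ z * (f z ^ (k + 2) - 1) = deriv (deriv F) z - φ z * deriv F z := by
      rw [hF'' z]; ring
    rw [← norm_mul, h4]
    refine (norm_sub_le _ _).trans ?_
    rw [hsh z, norm_mul] at h3
    rw [norm_mul]
    have h5 : ‖φ z‖ * ‖deriv F z‖ ≤ ‖φ z‖ * (B * ‖f z ^ (k + 2) - 1‖) := by gcongr
    calc _ ≤ B * (‖φ z‖ * ‖f z ^ (k + 2) - 1‖) + ‖φ z‖ * (B * ‖f z ^ (k + 2) - 1‖) :=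
          add_le_add h3 h5
      _ = _ := by ring
  -- the mean of `log ‖f‖`
  set A := circleAverage (fun z => log ‖f z‖) 0 ρ with hA
  have hkA : k * A ≤ log (2 * B) + q := by
    have h1 : log ‖Q 0‖ ≤
        circleAverage (fun z => log (2 * B) - (k : ℝ) • log ‖f z‖) 0 ρ := by
      refine log_norm_le_circleAverage hQ hQ0 hρ (hconst.sub (hci hf).const_fun_smul) ?_
      intro z hz
      have hfp := norm_pos_iff.2 (hfz z hz)
      have hφp := norm_pos_iff.2 (hφ0 z)
      rw [exp_sub, he2B, smul_eq_mul, ← log_pow, exp_log (by positivity),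
        le_div_iff₀ (by positivity)]
      have h2 := hφ'B z hz
      rw [hφ'Q z, norm_neg, norm_mul, norm_mul, norm_pow] at h2
      have := le_of_mul_le_mul_right h2 hφp
      linarith
    rw [circleAverage_fun_sub hconst (hci hf).const_fun_smul, circleAverage_const,
      circleAverage_fun_smul, smul_eq_mul] at h1
    have := neg_abs_le (log ‖Q 0‖)
    linarith
  set Y := log (2 * B) + q with hY
  have hY0 : 0 ≤ Y := add_nonneg hlB (abs_nonneg _)
  set AF := circleAverage (fun z => log ‖F z‖) 0 ρ with hAF_def
  have hAF : AF ≤ 3 * Y := by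
    have h1 : AF = ((k + 2 : ℕ) : ℝ) * A := by
      rw [hAF_def, hA, ← smul_eq_mul, ← circleAverage_fun_smul]
      congr 1
      funext z
      rw [hF_def]
      simp only [norm_pow, log_pow, smul_eq_mul]
    rw [h1]
    push_cast
    rcases le_total A 0 with h | h
    · nlinarith
    · nlinarith
  -- proximity to `1`
  set G := circleAverage (fun z => log⁺ ‖F z - 1‖⁻¹) 0 ρ with hG_def
  have hFs : Differentiable ℂ fun z => F z - 1 := hF.sub_const 1
  have hG : G ≤ log (2 * B) + AF + c₁ := by
    have hadd : CircleIntegrable (fun z => log (2 * B) + log ‖F z‖) 0 ρ := hconst.add (hci hF)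
    have h1 : log ‖deriv F 0‖ ≤
        circleAverage (fun z => (log (2 * B) + log ‖F z‖) - log⁺ ‖F z - 1‖⁻¹) 0 ρ := by
      refine log_norm_le_circleAverage hdF hF'0 hρ (hadd.sub (hcinv hFs)) ?_
      intro z hz
      obtain ⟨⟨h1, h2⟩, ⟨h3, h4⟩, -⟩ := hcirc z hz
      change F z ≠ 0 at h1
      change _ ≤ B * ‖F z‖ at h2
      change F z - 1 ≠ 0 at h3
      change _ ≤ B * ‖F z - 1‖ at h4
      have hp := norm_pos_iff.2 h1
      have hp' := norm_pos_iff.2 h3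
      rw [sub_eq_add_neg (log (2 * B) + _), exp_add, exp_add, he2B, exp_log hp,
        exp_neg_posLog_inv hp']
      have h5 : 1 ≤ ‖F z‖ + ‖F z - 1‖ := by
        have := norm_sub_le (F z) (F z - 1)
        simpa using this
      rcases le_total 1 ‖F z - 1‖ with h | h
      · rw [min_eq_left h]; nlinarith
      · rw [min_eq_right h]
        rcases le_total (1 / 2) ‖F z - 1‖ with h' | h'
        · have : 0 ≤ B * ‖F z‖ := by positivity
          nlinarith
        · have : 0 ≤ B * ‖F z - 1‖ := by positivity
          nlinarith
    rw [circleAverage_fun_sub hadd (hcinv hFs),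
      circleAverage_fun_add hconst (hci hF), circleAverage_const] at h1
    have := neg_abs_le (log ‖deriv F 0‖)
    linarith
  -- the characteristic of `φ`
  set Φ := circleAverage (fun z => log⁺ ‖φ z‖) 0 ρ with hΦ_def
  have hΦ : Φ ≤ log (2 * B) + G := by
    rw [hG_def, ← circleAverage_const (log (2 * B)) 0 ρ,
      ← circleAverage_fun_add hconst (hcinv hFs)]
    refine circleAverage_mono (hcp hφ) (hconst.add (hcinv hFs)) fun z hz => ?_
    rw [abs_of_pos hρ, mem_sphere_zero_iff_norm] at hz
    obtain ⟨-, ⟨h3, h4⟩, -⟩ := hcirc z hz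
    change F z - 1 ≠ 0 at h3
    change _ ≤ B * ‖F z - 1‖ at h4
    have hp := norm_pos_iff.2 h3
    rw [← exp_le_exp, exp_add, he2B, exp_posLog _ (norm_nonneg _),
      exp_posLog _ (inv_nonneg.2 hp.le)]
    have h5 : ‖φ z‖ ≤ B + ‖F z - 1‖⁻¹ := by
      have h6 : ‖φ z‖ * ‖F z - 1‖ ≤ B * ‖F z - 1‖ + 1 := by
        rw [← norm_mul, ← hsh z]
        refine (norm_sub_le _ _).trans ?_
        rw [norm_one]; linarith
      refine le_of_mul_le_mul_right ?_ hp
      rwa [add_mul, inv_mul_cancel₀ hp.ne']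
    have h7 := le_max_left 1 ‖F z - 1‖⁻¹
    have h8 := le_max_right 1 ‖F z - 1‖⁻¹
    refine max_le ?_ ?_ <;> nlinarith
  -- proximity to `0`
  set H := circleAverage (fun z => log⁺ ‖F z‖⁻¹) 0 ρ with hH_def
  have hφs : Differentiable ℂ fun z => 1 - φ z := hφ.const_sub 1
  have hH : H ≤ log (2 * B) + Φ + c₂ := by
    have hadd : CircleIntegrable (fun z => log (2 * B) + log⁺ ‖φ z‖) 0 ρ := hconst.add (hcp hφ)
    have h1 : log ‖1 - φ 0‖ ≤
        circleAverage (fun z => (log (2 * B) + log⁺ ‖φ z‖) - log⁺ ‖F z‖⁻¹) 0 ρ := by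
      refine log_norm_le_circleAverage hφs (sub_ne_zero.2 hφ1.symm) hρ
        (hadd.sub (hcinv hF)) ?_
      intro z hz
      obtain ⟨⟨h1, h2⟩, -⟩ := hcirc z hz
      change F z ≠ 0 at h1
      change _ ≤ B * ‖F z‖ at h2
      have hp := norm_pos_iff.2 h1
      rw [sub_eq_add_neg (log (2 * B) + _), exp_add, exp_add, he2B, exp_neg_posLog_inv hp,
        exp_posLog _ (norm_nonneg _)]
      have h3 : ‖1 - φ z‖ ≤ 1 + ‖φ z‖ := by
        have := norm_sub_le 1 (φ z)
        rwa [norm_one] at this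
      have h4 : ‖1 - φ z‖ ≤ (B + ‖φ z‖) * ‖F z‖ := by
        have h5 : 1 - φ z = deriv F z - φ z * F z := by linear_combination -hsh z
        rw [h5, add_mul, ← norm_mul]
        exact (norm_sub_le _ _).trans (by linarith)
      have h7 := le_max_left 1 ‖φ z‖
      have h8 := le_max_right 1 ‖φ z‖
      have h9 : B + ‖φ z‖ ≤ 2 * B * max 1 ‖φ z‖ := by nlinarith
      rcases le_total 1 ‖F z‖ with h | h
      · rw [min_eq_left h]; linarith
      · rw [min_eq_right h]
        exact h4.trans (mul_le_mul_of_nonneg_right h9 hp.le)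
    rw [circleAverage_fun_sub hadd (hcinv hF),
      circleAverage_fun_add hconst (hcp hφ), circleAverage_const] at h1
    have := neg_abs_le (log ‖1 - φ 0‖)
    linarith
  have hT : charT F ρ = AF + H := by
    rw [charT, hAF_def, hH_def, ← circleAverage_fun_add (hci hF) (hcinv hF)]
    congr 1
    funext z
    have := posLog_sub_posLog_inv (x := ‖F z‖)
    linarith
  rw [hT]
  linarith

lemma differentiable_dslope {u : ℂ → ℂ} (hu : Differentiable ℂ u) (a : ℂ) :
    Differentiable ℂ (dslope u a) :=
  differentiableOn_univ.1 ((Complex.differentiableOn_dslope univ_mem).2 hu.differentiableOn)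

/-- An entire function of polynomial growth along a sequence of circles is a polynomial. -/
lemma exists_polynomial_of_growth {u : ℂ → ℂ} (hu : Differentiable ℂ u) {K : ℝ} {N : ℕ}
    (h : ∀ a : ℝ, ∃ r ≥ a, ∀ z, ‖z‖ = r → ‖u z‖ ≤ K * r ^ N) :
    ∃ p : Polynomial ℂ, ∀ z, u z = p.eval z := by
  induction N generalizing u K with
  | zero =>
    have hb : ∀ z, ‖u z‖ ≤ K := fun z => by
      obtain ⟨r, hr, hru⟩ := h (‖z‖ + 1)
      have hr0 : r ≠ 0 := by have := norm_nonneg z; linarith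
      refine Complex.norm_le_of_forall_mem_frontier_norm_le (U := ball 0 r) isBounded_ball
        hu.diffContOnCl ?_ (subset_closure (mem_ball_zero_iff.2 (by linarith)))
      intro x hx
      rw [frontier_ball _ hr0, mem_sphere_zero_iff_norm] at hx
      simpa using hru x hx
    refine ⟨Polynomial.C (u 0), fun z => ?_⟩
    rw [Polynomial.eval_C]
    refine hu.apply_eq_apply_of_bounded ?_ z 0
    exact (isBounded_iff_forall_norm_le.2 ⟨K, by rintro _ ⟨z, rfl⟩; exact hb z⟩)
  | succ N ih =>
    have hv : ∀ z, z * dslope u 0 z = u z - u 0 := fun z => by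
      simpa using sub_smul_dslope u 0 z
    obtain ⟨p, hp⟩ := ih (u := dslope u 0) (K := K + ‖u 0‖) (differentiable_dslope hu 0) (by
      intro a
      obtain ⟨r, hr, hru⟩ := h (max a 1)
      have hr1 : 1 ≤ r := (le_max_right _ _).trans hr
      refine ⟨r, (le_max_left _ _).trans hr, fun z hz => ?_⟩
      refine le_of_mul_le_mul_left ?_ (by linarith : 0 < r)
      have h1 := congrArg norm (hv z)
      rw [norm_mul, hz] at h1
      rw [h1]
      have h2 : ‖u 0‖ ≤ ‖u 0‖ * r ^ (N + 1) := le_mul_of_one_le_right (norm_nonneg _)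
        (one_le_pow₀ hr1)
      calc _ ≤ K * r ^ (N + 1) + ‖u 0‖ * r ^ (N + 1) :=
            (norm_sub_le _ _).trans (add_le_add (hru z hz) h2)
        _ = _ := by ring)
    refine ⟨Polynomial.C (u 0) + Polynomial.X * p, fun z => ?_⟩
    simp only [Polynomial.eval_add, Polynomial.eval_C, Polynomial.eval_mul, Polynomial.eval_X]
    rw [← hp z, hv z]; ring

lemma exists_norm_eval_le (q : Polynomial ℂ) :
    ∃ K : ℝ, ∀ z : ℂ, 1 ≤ ‖z‖ → ‖q.eval z‖ ≤ K * ‖z‖ ^ q.natDegree := by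
  refine ⟨∑ i ∈ Finset.range (q.natDegree + 1), ‖q.coeff i‖, fun z hz => ?_⟩
  rw [Polynomial.eval_eq_sum_range, Finset.sum_mul]
  refine (norm_sum_le _ _).trans (Finset.sum_le_sum fun i hi => ?_)
  rw [norm_mul, norm_pow]
  gcongr
  exact Nat.lt_succ_iff.1 (Finset.mem_range.1 hi)

/-- A nonconstant polynomial does not share the value `1` CM with its derivative. -/
lemma not_polynomial_of_share {p : Polynomial ℂ} {φ : ℂ → ℂ} (hφ : Differentiable ℂ φ)
    (hp : p.natDegree ≠ 0) (hq : p.derivative - 1 ≠ 0)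
    (hshare : ∀ z, p.derivative.eval z - 1 = φ z * (p.eval z - 1)) : False := by
  have hs : (p - 1).natDegree = p.natDegree := by
    rw [← Polynomial.C_1, Polynomial.natDegree_sub_C]
  have hlim : Tendsto (fun z : ℂ => ‖(p - 1).eval z‖) (cocompact ℂ) atTop :=
    Polynomial.tendsto_norm_atTop _ (Polynomial.natDegree_pos_iff_degree_pos.1 (by omega))
      tendsto_norm_cocompact_atTop
  obtain ⟨K, hK⟩ := exists_norm_eval_le (p.derivative - 1)
  obtain ⟨r₀, hr₀⟩ : ∃ r₀ : ℝ, ∀ z : ℂ, r₀ ≤ ‖z‖ → 1 ≤ ‖(p - 1).eval z‖ := by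
    have h1 := hlim.eventually_ge_atTop 1
    rw [← Metric.cobounded_eq_cocompact, ← comap_norm_atTop, eventually_comap] at h1
    obtain ⟨r₀, h⟩ := eventually_atTop.1 h1
    exact ⟨r₀, fun z hz => h _ hz z rfl⟩
  have hsh : ∀ z, (p.derivative - 1).eval z = φ z * (p - 1).eval z := fun z => by
    simpa using hshare z
  obtain ⟨P, hP⟩ := exists_polynomial_of_growth hφ (K := K) (N := (p.derivative - 1).natDegree) (by
    intro a
    refine ⟨max a (max r₀ 1), le_max_left _ _, fun z hz => ?_⟩
    have h1 := hr₀ z (by rw [hz]; exact (le_max_left _ _).trans (le_max_right _ _))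
    have h2 := hK z (by rw [hz]; exact (le_max_right _ _).trans (le_max_right _ _))
    rw [← hz]
    refine le_trans ?_ h2
    rw [hsh z, norm_mul]
    exact le_mul_of_one_le_right (norm_nonneg _) h1)
  have hmul : p.derivative - 1 = P * (p - 1) := Polynomial.funext fun z => by
    rw [Polynomial.eval_mul, ← hP z, hsh z]
  have hP0 : P ≠ 0 := by rintro rfl; exact hq (by rw [hmul, zero_mul])
  have hs0 : p - 1 ≠ 0 := fun h => hq (by rw [hmul, h, mul_zero])
  have hdeg := congrArg Polynomial.natDegree hmul
  rw [Polynomial.natDegree_mul hP0 hs0, hs, ← Polynomial.C_1, Polynomial.natDegree_sub_C] at hdeg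
  have := Polynomial.natDegree_derivative_lt hp
  omega

/-- If the multiplier has nonzero derivative at a generic origin, the sharing is impossible. -/
lemma not_share_of_generic {f φ : ℂ → ℂ} (hf : Differentiable ℂ f) (hφ : Differentiable ℂ φ) {n : ℕ}
    (hn : 3 ≤ n) (hφ0 : ∀ z, φ z ≠ 0)
    (hshare : ∀ z, deriv (fun w => f w ^ n) z - 1 = φ z * (f z ^ n - 1))
    (hf0 : f 0 ≠ 0) (hf1 : f 0 ^ n ≠ 1) (hf'0 : deriv f 0 ≠ 0) (hφ'0 : deriv φ 0 ≠ 0)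
    (hφ1 : φ 0 ≠ 1) : False := by
  have hF : Differentiable ℂ fun w => f w ^ n := hf.pow n
  have hF0 : (fun w => f w ^ n) 0 ≠ 0 := pow_ne_zero n hf0
  have hF'0 : deriv (fun w => f w ^ n) 0 ≠ 0 := by
    have := ((hf 0).hasDerivAt.pow n).deriv
    rw [show (fun w => f w ^ n) = f ^ n from rfl, this]
    have hn0 : (n : ℂ) ≠ 0 := Nat.cast_ne_zero.2 (by omega)
    exact mul_ne_zero (mul_ne_zero hn0 (pow_ne_zero _ hf0)) hf'0
  have hF'1 : deriv (fun w => f w ^ n) 0 ≠ 1 := fun h => by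
    have h1 := hshare 0
    rw [h, sub_self] at h1
    exact mul_ne_zero (hφ0 0) (sub_ne_zero.2 hf1) h1.symm
  obtain ⟨C₁, hC₁⟩ := exists_large_circle hF hF0 hf1 hF'1
  obtain ⟨C₂, hC₂⟩ := exists_charT_le hf hφ hn hφ0 hshare hF'0 hφ'0 hφ1
  set F : ℂ → ℂ := fun w => f w ^ n with hF_def
  set C := 8 * (2 * (9 * log 2 + 9 * C₁ + C₂ + 1 + 63 * log 126)) with hC
  have hgrow : ∀ a : ℝ, ∃ r ≥ a, ∀ z, ‖z‖ = r → ‖F z‖ ≤ exp C * 2 ^ 576 * r ^ 576 := by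
    intro a
    obtain ⟨r, ρ, B, har, hr1, hrρ, hB, hlB, hcirc⟩ := hC₁ (2 * a)
    have hr0 : 0 < r := by linarith
    have h1 := hC₂ ρ (by linarith) B hB hcirc
    have h2 := charT_mono hF hr0 hrρ
    have h3 := charT_nonneg F r
    rw [log_mul (by norm_num) (by linarith)] at h1
    have h4 : log (charT F r + 1) ≤ (charT F r + 1) / 126 - 1 + log 126 := by
      have h5 := log_le_sub_one_of_pos (x := (charT F r + 1) / 126) (by positivity)
      rw [log_div (by positivity) (by norm_num)] at h5
      linarith
    have h5 : 8 * charT F r ≤ C + 576 * log r := by rw [hC]; linarith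
    refine ⟨r / 2, by linarith, fun z hz => ?_⟩
    have h6 := log_norm_le_charT hF hF0 (r := r / 2) (R := r) (by linarith) (by linarith) hz.le
    have h7 : 4 * r / (r - r / 2) = 8 := by field_simp; norm_num
    rw [h7] at h6
    rcases eq_or_ne (F z) 0 with h0 | h0
    · rw [h0, norm_zero]; positivity
    have h8 := (log_le_iff_le_exp (norm_pos_iff.2 h0)).1 (h6.trans h5)
    refine h8.trans (le_of_eq ?_)
    have h9 : (576 : ℝ) * log r = log (r ^ 576) := by rw [log_pow]; norm_num
    rw [exp_add, h9, exp_log (by positivity), mul_assoc, ← mul_pow]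
    congr 2
    ring
  obtain ⟨p, hp⟩ := exists_polynomial_of_growth hF hgrow
  have hFp : F = fun z => p.eval z := funext hp
  have hF'p : ∀ z, deriv F z = p.derivative.eval z := fun z => by
    rw [hFp, Polynomial.deriv]
  refine not_polynomial_of_share (p := p) hφ ?_ ?_ fun z => ?_
  · intro h
    apply hF'0
    rw [hF'p 0, Polynomial.derivative_of_natDegree_zero h, Polynomial.eval_zero]
  · intro h
    apply hF'1
    rw [hF'p 0, sub_eq_zero.1 h, Polynomial.eval_one]
  · rw [← hF'p z, ← hp z]
    exact hshare z

lemma eventually_ne_zero {u : ℂ → ℂ} (hu : Differentiable ℂ u) (h : ∃ z, u z ≠ 0) :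
    ∀ᶠ z in 𝓝[≠] (0 : ℂ), u z ≠ 0 := by
  have ha : AnalyticOnNhd ℂ u univ := fun z _ => hu.analyticAt z
  rcases ha.eqOn_zero_or_eventually_ne_zero_of_preconnected isPreconnected_univ with h1 | h1
  · obtain ⟨z, hz⟩ := h
    exact absurd (h1 (mem_univ z)) hz
  · have := (mem_codiscrete.1 h1) 0
    rwa [disjoint_principal_right, compl_compl] at this

lemma deriv_multiplier_eq_zero {f φ : ℂ → ℂ} (hf : Differentiable ℂ f)
    (hnc : ¬∃ c : ℂ, ∀ z, f z = c) (hφ : Differentiable ℂ φ) {n : ℕ} (hn : 3 ≤ n)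
    (hφ0 : ∀ z, φ z ≠ 0) (hshare : ∀ z, deriv (fun w => f w ^ n) z - 1 = φ z * (f z ^ n - 1))
    (z : ℂ) :
    deriv φ z = 0 := by
  by_contra hz
  have e1 := eventually_ne_zero hf (by
    by_contra! h
    exact hnc ⟨0, h⟩)
  have e2 := eventually_ne_zero ((hf.pow n).sub_const 1) (by
    by_contra! h
    have h1 : (fun w => f w ^ n) = fun _ => 1 := funext fun w => sub_eq_zero.1 (h w)
    have h2 := hshare 0
    have h3 : f 0 ^ n - 1 = 0 := h 0
    rw [h1, deriv_const, h3] at h2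
    norm_num at h2)
  have e3 := eventually_ne_zero (differentiable_deriv hf) (by
    by_contra! h
    exact hnc ⟨f 0, fun w => is_const_of_deriv_eq_zero hf h w 0⟩)
  have e4 := eventually_ne_zero (differentiable_deriv hφ) ⟨z, hz⟩
  have e5 := eventually_ne_zero (hφ.sub_const 1) (by
    by_contra! h
    have h1 : φ = fun _ => 1 := funext fun w => sub_eq_zero.1 (h w)
    rw [h1, deriv_const] at hz
    exact hz rfl)
  obtain ⟨a, h1, h2, h3, h4, h5⟩ := (e1.and (e2.and (e3.and (e4.and e5)))).exists
  have hid : Differentiable ℂ fun w : ℂ => w + a := differentiable_id.add_const a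
  refine not_share_of_generic (f := fun w => f (w + a)) (φ := fun w => φ (w + a))
    (hf.comp hid) (hφ.comp hid) hn (fun w => hφ0 _) (fun w => ?_) ?_ ?_ ?_ ?_ ?_
  · have := deriv_comp_add_const (fun w => f w ^ n) a w
    rw [this]
    exact hshare (w + a)
  · simpa using h1
  · simpa using sub_ne_zero.1 h2
  · rw [deriv_comp_add_const]; simpa using h3
  · rw [deriv_comp_add_const]; simpa using h4
  · simpa using sub_ne_zero.1 h5

lemma eq_mul_exp_of_deriv_eq {u : ℂ → ℂ} (hu : Differentiable ℂ u) {c : ℂ}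
    (h : ∀ z, deriv u z = c * u z) (z : ℂ) : u z = u 0 * Complex.exp (c * z) := by
  have hd : ∀ x, HasDerivAt (fun x => u x * Complex.exp (-(c * x))) 0 x := fun x => by
    have h1 : HasDerivAt (fun x : ℂ => -(c * x)) (-c) x := by
      exact ((hasDerivAt_id' x).const_mul c).neg.congr_deriv (by rw [mul_one])
    refine ((hu x).hasDerivAt.mul h1.cexp).congr_deriv ?_
    rw [h x]; ring
  have := is_const_of_deriv_eq_zero (fun x => (hd x).differentiableAt) (fun x => (hd x).deriv) z 0
  simp only [mul_zero, neg_zero, Complex.exp_zero, mul_one] at this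
  rw [← this, mul_assoc, ← Complex.exp_add]
  simp

end YangZhang

/-- Yang–Zhang (paper's Theorem 2.D): if `n ≥ 7` and `f^n`, `(f^n)'` share `1`
CM, then `f^n ≡ (f^n)'`, i.e. `f(z) = c e^{z/n}` for some `c ≠ 0`. -/
theorem yang_zhang_first_derivative
    (f : ℂ → ℂ) (hf : Differentiable ℂ f) (hnc : ¬∃ c : ℂ, ∀ z, f z = c)
    (n : ℕ) (hn : 7 ≤ n)
    (hshare : ∃ φ : ℂ → ℂ, Differentiable ℂ φ ∧ (∀ z, φ z ≠ 0) ∧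
      ∀ z, deriv (fun w => f w ^ n) z - 1 = φ z * (f z ^ n - 1)) :
    (∀ z, deriv (fun w => f w ^ n) z = f z ^ n) ∧
    ∃ c : ℂ, c ≠ 0 ∧ ∀ z, f z = c * Complex.exp (z / (n : ℂ)) := by
  obtain ⟨φ, hφ, hφ0, hsh⟩ := hshare
  have hφc : ∀ z, φ z = φ 0 := fun z => is_const_of_deriv_eq_zero hφ
    (YangZhang.deriv_multiplier_eq_zero hf hnc hφ (by omega) hφ0 hsh) z 0
  set c := φ 0 with hc
  have hc0 : c ≠ 0 := hφ0 0
  have hn0 : (n : ℂ) ≠ 0 := Nat.cast_ne_zero.2 (by omega)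
  obtain ⟨m, rfl⟩ : ∃ m, n = m + 1 := ⟨n - 1, by omega⟩
  have hm : m ≠ 0 := by omega
  have hF : Differentiable ℂ fun w => f w ^ (m + 1) := hf.pow _
  have hF' : ∀ z, deriv (fun w => f w ^ (m + 1)) z = ((m + 1 : ℕ) : ℂ) * f z ^ m * deriv f z :=
    fun z => ((hf z).hasDerivAt.pow (m + 1)).deriv
  have hode : ∀ z, deriv (fun w => f w ^ (m + 1)) z = c * f z ^ (m + 1) + (1 - c) := fun z => by
    have := hsh z
    rw [hφc z] at this
    linear_combination this
  have hfac : ∀ z, f z ^ m * (((m + 1 : ℕ) : ℂ) * deriv f z - c * f z) = 1 - c := fun z => by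
    have := hode z
    rw [hF' z, pow_succ] at this
    linear_combination this
  have hc1 : c = 1 := by
    by_contra hc1
    have hfne : ∀ z, f z ≠ 0 := fun z h => by
      have := hfac z
      rw [h, zero_pow hm, zero_mul] at this
      exact sub_ne_zero.2 (Ne.symm hc1) this.symm
    have hsol := YangZhang.eq_mul_exp_of_deriv_eq (hF.sub_const ((c - 1) / c)) (c := c)
      (fun z => by
        rw [deriv_sub_const, hode z]
        field_simp
        ring)
    set k := f 0 ^ (m + 1) - (c - 1) / c with hk
    have hk0 : k ≠ 0 := fun h => by
      refine hnc ⟨f 0, fun w => is_const_of_deriv_eq_zero hf (fun z => ?_) w 0⟩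
      have h1 := hode z
      have h2 := hsol z
      simp only [h, zero_mul] at h2
      rw [sub_eq_zero.1 h2, hF' z, mul_div_cancel₀ _ hc0] at h1
      have h3 : ((m + 1 : ℕ) : ℂ) * f z ^ m * deriv f z = 0 := by rw [h1]; ring
      exact (mul_eq_zero.1 h3).resolve_left (mul_ne_zero hn0 (pow_ne_zero m (hfne z)))
    have ha : -((c - 1) / c) / k ≠ 0 :=
      div_ne_zero (neg_ne_zero.2 (div_ne_zero (sub_ne_zero.2 hc1) hc0)) hk0
    have h1 := hsol (Complex.log (-((c - 1) / c) / k) / c)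
    rw [mul_div_cancel₀ _ hc0, Complex.exp_log ha, mul_div_cancel₀ _ hk0, sub_eq_neg_self] at h1
    exact pow_ne_zero _ (hfne _) h1
  rw [hc1] at hode hfac
  have hFF : ∀ z, deriv (fun w => f w ^ (m + 1)) z = f z ^ (m + 1) := fun z => by
    rw [hode z]; ring
  refine ⟨hFF, f 0, ?_⟩
  have hsol := YangZhang.eq_mul_exp_of_deriv_eq hF (c := 1) (fun z => by rw [hFF z, one_mul])
  have hf0 : f 0 ≠ 0 := fun h => hnc ⟨0, fun z => by
    have := hsol z
    simp only [h, zero_pow (Nat.succ_ne_zero m), zero_mul] at this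
    exact pow_eq_zero_iff (Nat.succ_ne_zero m) |>.1 this⟩
  refine ⟨hf0, fun z => ?_⟩
  have hfne : ∀ w, f w ≠ 0 := fun w h => by
    have := hsol w
    simp only [h, zero_pow (Nat.succ_ne_zero m)] at this
    exact mul_ne_zero (pow_ne_zero _ hf0) (Complex.exp_ne_zero _) this.symm
  have := YangZhang.eq_mul_exp_of_deriv_eq hf (c := 1 / ((m + 1 : ℕ) : ℂ)) (fun w => by
    have h1 := hfac w
    rw [sub_self] at h1
    have h2 := (mul_eq_zero.1 h1).resolve_left (pow_ne_zero m (hfne w))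
    field_simp
    linear_combination h2) z
  rw [this, one_div, div_eq_inv_mul]
end

section
/- Let f : ℂ → ℂ be a nonconstant entire function and let k, n be positive integers with n ≥ k + 1. If f^n and (f^n)^{(k)} share the value 1 CM, then f^n = (f^n)^{(k)} identically; that is, f(z) = c·e^{(λ/n)z} for some c, λ ∈ ℂ \ {0} with λ^k = 1. (Zhang–Yang; the paper's Theorem 2.E.) -/
section

open Filter Topology Metric Set

theorem Differentiable.eventually_codiscrete_ne_zero {G : ℂ → ℂ} (hG : Differentiable ℂ G)
    (h0 : ∃ z, G z ≠ 0) : ∀ᶠ z in codiscrete ℂ, G z ≠ 0 := by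
  obtain ⟨x, hx⟩ := h0
  have := AnalyticOnNhd.preimage_zero_mem_codiscrete (f := G) (x := x)
    (fun z _ => hG.analyticAt z) hx
  filter_upwards [this] with z hz using hz

theorem Differentiable.exists_eq_pow_mul {G : ℂ → ℂ} (hG : Differentiable ℂ G)
    (h0 : ∃ z, G z ≠ 0) (a : ℂ) :
    ∃ (m : ℕ) (g : ℂ → ℂ), Differentiable ℂ g ∧ g a ≠ 0 ∧ ∀ z, G z = (z - a) ^ m * g z := by
  have hna : ¬ ∀ᶠ z in 𝓝 a, G z = 0 := by
    intro h
    obtain ⟨x, hx⟩ := h0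
    have hA : AnalyticOnNhd ℂ G univ := fun z _ => hG.analyticAt z
    exact hx (hA.eqOn_zero_of_preconnected_of_eventuallyEq_zero isPreconnected_univ
      (mem_univ a) h (mem_univ x))
  obtain ⟨m, g, hg, hga, hev⟩ :=
    (hG.analyticAt a).exists_eventuallyEq_pow_smul_nonzero_iff.mpr hna
  refine ⟨m, Function.update (fun z => G z / (z - a) ^ m) a (g a), ?_, by simpa using hga, ?_⟩
  · intro z
    by_cases hz : z = a
    · subst hz
      refine hg.differentiableAt.congr_of_eventuallyEq ?_
      filter_upwards [hev] with w hw
      by_cases hwz : w = z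
      · subst hwz; simp
      · have : (w - z) ^ m ≠ 0 := pow_ne_zero _ (sub_ne_zero.mpr hwz)
        simp [Function.update_of_ne hwz, hw, this]
    · have h1 : DifferentiableAt ℂ (fun z => G z / (z - a) ^ m) z :=
        (hG z).div (by fun_prop) (pow_ne_zero _ (sub_ne_zero.mpr hz))
      refine h1.congr_of_eventuallyEq ?_
      filter_upwards [isOpen_ne.mem_nhds hz] with w hw
      simp [Function.update_of_ne hw]
  · intro z
    by_cases hz : z = a
    · subst hz
      simpa using hev.self_of_nhds
    · have : (z - a) ^ m ≠ 0 := pow_ne_zero _ (sub_ne_zero.mpr hz)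
      rw [Function.update_of_ne hz]
      field_simp

theorem Differentiable.exists_eq_multiset_prod_mul {G : ℂ → ℂ} (hG : Differentiable ℂ G)
    (h0 : ∃ z, G z ≠ 0) (R : ℝ) :
    ∃ (s : Multiset ℂ) (g : ℂ → ℂ), Differentiable ℂ g ∧ (∀ a ∈ s, ‖a‖ ≤ R) ∧
      (∀ z ∈ closedBall 0 R, g z ≠ 0) ∧ ∀ z, G z = (s.map (fun a => z - a)).prod * g z := by
  have key : ∀ t : Finset ℂ, ∀ G : ℂ → ℂ, Differentiable ℂ G → (∃ z, G z ≠ 0) →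
      (∀ z ∈ closedBall 0 R, G z = 0 → z ∈ t) →
      ∃ (s : Multiset ℂ) (g : ℂ → ℂ), Differentiable ℂ g ∧ (∀ a ∈ s, ‖a‖ ≤ R) ∧
      (∀ z ∈ closedBall 0 R, g z ≠ 0) ∧ ∀ z, G z = (s.map (fun a => z - a)).prod * g z := by
    intro t
    induction t using Finset.induction_on with
    | empty =>
      intro G hG h0 hz
      exact ⟨0, G, hG, by simp, fun z hz' h => by simpa using hz z hz' h, by simp⟩
    | insert a t ha ih =>
      intro G hG h0 hz
      by_cases haR : ‖a‖ ≤ R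
      · obtain ⟨m, g, hg, hga, hGg⟩ := hG.exists_eq_pow_mul h0 a
        obtain ⟨s, h, hh, hs, hhz, heq⟩ := ih g hg ⟨a, hga⟩ (by
          intro z hzR hgz
          have := hz z hzR (by rw [hGg, hgz, mul_zero])
          rcases Finset.mem_insert.mp this with rfl | h
          · exact absurd hgz hga
          · exact h)
        refine ⟨Multiset.replicate m a + s, h, hh, ?_, hhz, ?_⟩
        · intro b hb
          rcases Multiset.mem_add.mp hb with hb | hb
          · rw [Multiset.eq_of_mem_replicate hb]; exact haR
          · exact hs b hb
        · intro z
          rw [hGg, heq]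
          simp [mul_assoc]
      · refine ih G hG h0 fun z hzR hGz => ?_
        rcases Finset.mem_insert.mp (hz z hzR hGz) with rfl | h
        · exact absurd (by simpa using hzR) haR
        · exact h
  have hfin : (closedBall (0 : ℂ) R \ {z | G z ≠ 0}).Finite := by
    refine (isCompact_closedBall 0 R).finite_sdiff_of_mem_codiscreteWithin ?_
    exact Filter.codiscreteWithin_mono (subset_univ _) (hG.eventually_codiscrete_ne_zero h0)
  exact key hfin.toFinset G hG h0 fun z hz hGz => by simp_all

theorem Differentiable.circleIntegrable_log_norm {G : ℂ → ℂ} (hG : Differentiable ℂ G) (R : ℝ) :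
    CircleIntegrable (fun z => Real.log ‖G z‖) 0 R :=
  MeromorphicOn.circleIntegrable_log_norm fun z _ => (hG.analyticAt z).meromorphicAt

theorem Differentiable.circleIntegrable_posLog_norm {G : ℂ → ℂ} (hG : Differentiable ℂ G)
    (R : ℝ) : CircleIntegrable (fun z => Real.posLog ‖G z‖) 0 R :=
  MeromorphicOn.circleIntegrable_posLog_norm fun z _ => (hG.analyticAt z).meromorphicAt

theorem norm_mul_sub_le {a w : ℂ} {R : ℝ} (ha : ‖a‖ ≤ R) (hw : ‖w‖ ≤ R) :
    R * ‖w - a‖ ≤ ‖(R : ℂ) ^ 2 - starRingEnd ℂ a * w‖ := by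
  have hR : 0 ≤ R := (norm_nonneg a).trans ha
  refine le_of_sq_le_sq ?_ (norm_nonneg _)
  have h1 : ‖a‖ ^ 2 = a.re * a.re + a.im * a.im := by
    rw [← Complex.normSq_eq_norm_sq, Complex.normSq_apply]
  have h2 : ‖w‖ ^ 2 = w.re * w.re + w.im * w.im := by
    rw [← Complex.normSq_eq_norm_sq, Complex.normSq_apply]
  rw [mul_pow, ← Complex.normSq_eq_norm_sq, ← Complex.normSq_eq_norm_sq, Complex.normSq_apply,
    Complex.normSq_apply]
  have h3 : 0 ≤ (R ^ 2 - ‖a‖ ^ 2) * (R ^ 2 - ‖w‖ ^ 2) :=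
    mul_nonneg (by nlinarith [norm_nonneg a]) (by nlinarith [norm_nonneg w])
  rw [h1, h2] at h3
  simp [pow_two]
  nlinarith [h3]

theorem norm_mul_sub_eq {a w : ℂ} {R : ℝ} (hR : 0 < R) (hw : ‖w‖ = R) :
    R * ‖w - a‖ = ‖(R : ℂ) ^ 2 - starRingEnd ℂ a * w‖ := by
  have h2 : ‖w‖ ^ 2 = w.re * w.re + w.im * w.im := by
    rw [← Complex.normSq_eq_norm_sq, Complex.normSq_apply]
  rw [hw] at h2
  rw [← abs_of_nonneg (mul_nonneg hR.le (norm_nonneg (w - a))), ← abs_of_nonneg (norm_nonneg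
    ((R : ℂ) ^ 2 - starRingEnd ℂ a * w)), ← sq_eq_sq_iff_abs_eq_abs]
  rw [mul_pow, ← Complex.normSq_eq_norm_sq, ← Complex.normSq_eq_norm_sq, Complex.normSq_apply,
    Complex.normSq_apply]
  simp [pow_two]
  linear_combination (R ^ 2 - a.re ^ 2 - a.im ^ 2) * (-h2)

theorem sq_sub_conj_mul_ne_zero {a w : ℂ} {R : ℝ} (ha : ‖a‖ < R) (hw : ‖w‖ ≤ R) :
    (R : ℂ) ^ 2 - starRingEnd ℂ a * w ≠ 0 := by
  have hR : 0 < R := (norm_nonneg a).trans_lt ha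
  intro h
  have h1 : ‖(R : ℂ) ^ 2‖ = ‖starRingEnd ℂ a * w‖ := by rw [sub_eq_zero.mp h]
  rw [norm_pow, norm_mul, Complex.norm_conj, Complex.norm_real, Real.norm_of_nonneg hR.le] at h1
  nlinarith [norm_nonneg a, norm_nonneg w]

/-- The real part of the Herglotz-Riesz kernel is continuous on the sphere. -/
theorem continuousOn_re_herglotzRieszKernel {w : ℂ} {R : ℝ} (hw : ‖w‖ < R) :
    ContinuousOn (fun z => (herglotzRieszKernel 0 w z).re) (sphere 0 |R|) := by
  have hR : 0 < R := (norm_nonneg w).trans_lt hw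
  intro z hz
  have hzw : z - w ≠ 0 := by
    rintro h
    rw [sub_eq_zero] at h
    subst h
    rw [mem_sphere_zero_iff_norm, abs_of_pos hR] at hz
    linarith
  refine ContinuousAt.continuousWithinAt ?_
  simp only [herglotzRieszKernel, sub_zero]
  refine Complex.continuous_re.continuousAt.comp ?_
  exact ContinuousAt.div (by fun_prop) (by fun_prop) hzw

theorem Differentiable.circleAverage_kernel_mul_log {g : ℂ → ℂ} (hg : Differentiable ℂ g)
    {w : ℂ} {R : ℝ} (hw : ‖w‖ < R) (h0 : ∀ z ∈ closedBall 0 R, g z ≠ 0) :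
    Real.circleAverage
      (fun z => (herglotzRieszKernel 0 w z).re * Real.log ‖g z‖) 0 R = Real.log ‖g w‖ := by
  have := InnerProductSpace.HarmonicOnNhd.circleAverage_re_herglotzRieszKernel_smul
    (f := fun z => Real.log ‖g z‖) (c := 0) (R := R) (w := w)
    (fun z hz => (hg.analyticAt z).harmonicAt_log_norm (h0 z hz)) (by simpa using hw)
  exact this

theorem log_norm_sub_le_circleAverage {a w : ℂ} {R : ℝ} (ha : ‖a‖ ≤ R) (hw : ‖w‖ < R)
    (hwa : w ≠ a) :
    Real.log ‖w - a‖ ≤ Real.circleAverage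
      (fun z => (herglotzRieszKernel 0 w z).re * Real.log ‖z - a‖) 0 R := by
  have hR : 0 < R := (norm_nonneg w).trans_lt hw
  rcases ha.eq_or_lt with ha | ha
  · exact (circleAverage_re_herglotzRieszKernel_mul_log₀ (by simpa using ha)
      (by simpa using hw)).ge
  · have h1 := Differentiable.circleAverage_kernel_mul_log
      (g := fun z => ((R : ℂ) ^ 2 - starRingEnd ℂ a * z) / R) (by fun_prop) hw
      (fun z hz => div_ne_zero (sq_sub_conj_mul_ne_zero ha (by simpa using hz))
        (by exact_mod_cast hR.ne'))
    have h2 : Real.circleAverage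
        (fun z => (herglotzRieszKernel 0 w z).re * Real.log ‖z - a‖) 0 R =
        Real.circleAverage (fun z => (herglotzRieszKernel 0 w z).re *
          Real.log ‖((R : ℂ) ^ 2 - starRingEnd ℂ a * z) / R‖) 0 R := by
      refine Real.circleAverage_congr_sphere fun z hz => ?_
      have hz' : ‖z‖ = R := by simpa [abs_of_pos hR] using hz
      simp only [norm_div, ← norm_mul_sub_eq (a := a) hR hz', Complex.norm_real,
        Real.norm_of_nonneg hR.le]
      rw [mul_div_cancel_left₀ _ hR.ne']
    rw [h2, h1]
    refine Real.log_le_log (norm_pos_iff.mpr (sub_ne_zero.mpr hwa)) ?_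
    rw [norm_div, Complex.norm_real, Real.norm_of_nonneg hR.le, le_div_iff₀ hR, mul_comm]
    exact norm_mul_sub_le ha.le hw.le

theorem Differentiable.log_norm_le_circleAverage_kernel {G : ℂ → ℂ} (hG : Differentiable ℂ G)
    {w : ℂ} {R : ℝ} (hw : ‖w‖ < R) (h0 : G w ≠ 0) :
    Real.log ‖G w‖ ≤ Real.circleAverage
      (fun z => (herglotzRieszKernel 0 w z).re * Real.log ‖G z‖) 0 R := by
  have hR : 0 < R := (norm_nonneg w).trans_lt hw
  obtain ⟨s, g, hg, hs, hgz, heq⟩ := hG.exists_eq_multiset_prod_mul ⟨w, h0⟩ R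
  have hcirc : ∀ H : ℂ → ℂ, Differentiable ℂ H → CircleIntegrable
      (fun z => (herglotzRieszKernel 0 w z).re * Real.log ‖H z‖) 0 R := fun H hH =>
    (hH.circleIntegrable_log_norm R).continuousOn_mul (continuousOn_re_herglotzRieszKernel hw)
  have key : ∀ s : Multiset ℂ, (∀ a ∈ s, ‖a‖ ≤ R) → (s.map (fun a => w - a)).prod ≠ 0 →
      Differentiable ℂ (fun z => (s.map (fun a => z - a)).prod * g z) ∧
      Real.log ‖(s.map (fun a => w - a)).prod * g w‖ ≤ Real.circleAverage
      (fun z => (herglotzRieszKernel 0 w z).re *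
        Real.log ‖(s.map (fun a => z - a)).prod * g z‖) 0 R := by
    intro s
    induction s using Multiset.induction_on with
    | empty =>
      intro _ _
      simp only [Multiset.map_zero, Multiset.prod_zero, one_mul]
      exact ⟨hg, (hg.circleAverage_kernel_mul_log hw hgz).ge⟩
    | cons a s ih =>
      intro hs hne
      simp only [Multiset.map_cons, Multiset.prod_cons, ne_eq, mul_eq_zero, not_or] at hne
      obtain ⟨hd, hle⟩ := ih (fun b hb => hs b (Multiset.mem_cons_of_mem hb)) hne.2
      have hgw : g w ≠ 0 := hgz w (by simpa using hw.le)
      refine ⟨?_, ?_⟩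
      · simp only [Multiset.map_cons, Multiset.prod_cons, mul_assoc]
        exact Differentiable.mul (by fun_prop) hd
      · simp only [Multiset.map_cons, Multiset.prod_cons, mul_assoc]
        have h1 := log_norm_sub_le_circleAverage (hs a (Multiset.mem_cons_self a s)) hw
          (sub_ne_zero.mp hne.1)
        rw [norm_mul, Real.log_mul (norm_ne_zero_iff.mpr hne.1)
          (norm_ne_zero_iff.mpr (mul_ne_zero hne.2 hgw))]
        refine (add_le_add h1 hle).trans_eq ?_
        rw [← Real.circleAverage_fun_add (hcirc (fun z => z - a) (by fun_prop)) (hcirc _ hd)]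
        refine Real.circleAverage_congr_codiscreteWithin ?_ hR.ne'
        have hc : ∀ᶠ z in codiscrete ℂ,
            (z - a) * ((s.map (fun a => z - a)).prod * g z) ≠ 0 := by
          refine Differentiable.eventually_codiscrete_ne_zero
            (Differentiable.mul (by fun_prop) hd) ⟨w, mul_ne_zero hne.1 (mul_ne_zero hne.2 hgw)⟩
        filter_upwards [Filter.codiscreteWithin_mono (subset_univ _) hc] with z hz
        rw [norm_mul (z - a), Real.log_mul (norm_ne_zero_iff.mpr (left_ne_zero_of_mul hz))
          (norm_ne_zero_iff.mpr (right_ne_zero_of_mul hz)), mul_add]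
  simp only [heq] at h0 ⊢
  exact (key s hs (left_ne_zero_of_mul h0)).2

/-- The logarithm of the modulus of an entire function is controlled by its proximity function
on a larger circle. -/
theorem Differentiable.norm_le_exp_proximity {G : ℂ → ℂ} (hG : Differentiable ℂ G)
    {w : ℂ} {r R : ℝ} (hw : ‖w‖ ≤ r) (hrR : r < R) :
    ‖G w‖ ≤ Real.exp ((R + r) / (R - r) * ValueDistribution.proximity G ⊤ R) := by
  have hr : 0 ≤ r := (norm_nonneg w).trans hw
  have hR : 0 < R := hr.trans_lt hrR
  by_cases h0 : G w = 0
  · rw [h0, norm_zero]; positivity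
  rw [← Real.log_le_iff_le_exp (norm_pos_iff.mpr h0)]
  refine (hG.log_norm_le_circleAverage_kernel (hw.trans_lt hrR) h0).trans ?_
  rw [ValueDistribution.proximity_top, ← smul_eq_mul, ← Real.circleAverage_fun_smul]
  refine Real.circleAverage_mono ((hG.circleIntegrable_log_norm R).continuousOn_mul
    (continuousOn_re_herglotzRieszKernel (hw.trans_lt hrR)))
    ((hG.circleIntegrable_posLog_norm R).const_smul) fun z hz => ?_
  rw [abs_of_pos hR] at hz
  have hwb : w ∈ ball (0 : ℂ) R := by simpa using hw.trans_lt hrR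
  have h1 := re_herglotzRieszKernel_le hz hwb
  have h2 := le_re_herglotzRieszKernel hz hwb
  simp only [sub_zero] at h1 h2
  have h3 : 0 ≤ (R - ‖w‖) / (R + ‖w‖) := div_nonneg (by linarith) (by positivity)
  have h4 : (R + ‖w‖) / (R - ‖w‖) ≤ (R + r) / (R - r) := by
    gcongr
  have h5 : (herglotzRieszKernel 0 w z).re = ((z + w) / (z - w)).re := by
    simp [herglotzRieszKernel]
  simp only [smul_eq_mul]
  rw [h5]
  calc ((z + w) / (z - w)).re * Real.log ‖G z‖ ≤ ((z + w) / (z - w)).re * Real.posLog ‖G z‖ :=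
        mul_le_mul_of_nonneg_left (by simp [Real.posLog]) (h3.trans h2)
    _ ≤ _ := mul_le_mul_of_nonneg_right (h1.trans h4) Real.posLog_nonneg

/-- A function without zeros on a disc has a holomorphic logarithm there. -/
theorem Differentiable.exists_eq_mul_exp {g : ℂ → ℂ} (hg : Differentiable ℂ g) {ρ : ℝ}
    (hρ : 0 < ρ) (h0 : ∀ z ∈ ball 0 ρ, g z ≠ 0) :
    ∃ h : ℂ → ℂ, h 0 = 0 ∧ (∀ z ∈ ball 0 ρ, HasDerivAt h (_root_.deriv g z / g z) z) ∧
      ∀ z ∈ ball 0 ρ, g z = g 0 * Complex.exp (h z) := by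
  have hg' : Differentiable ℂ (_root_.deriv g) := by
    simpa using hg.contDiff.differentiable_deriv_two
  have hd : DifferentiableOn ℂ (fun z => _root_.deriv g z / g z) (ball 0 ρ) :=
    hg'.differentiableOn.div hg.differentiableOn h0
  obtain ⟨h, h00, hh⟩ := hd.isExactOn_ball.with_val_at 0 0
  refine ⟨h, h00, hh, fun z hz => ?_⟩
  have hder : ∀ w ∈ ball (0 : ℂ) ρ, HasDerivAt (fun w => g w * Complex.exp (-h w)) 0 w := by
    intro w hw
    have hgw := h0 w hw
    refine ((hg w).hasDerivAt.mul ((hh w hw).neg.cexp)).congr_deriv ?_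
    simp only [Pi.neg_apply]
    field_simp
    ring
  have := (isOpen_ball).is_const_of_deriv_eq_zero isPreconnected_ball
    (fun w hw => (hder w hw).differentiableAt.differentiableWithinAt)
    (fun w hw => (hder w hw).deriv) hz (mem_ball_self hρ)
  simp only [h00, neg_zero, Complex.exp_zero, mul_one] at this
  rw [← this, mul_assoc, ← Complex.exp_add]
  simp

/-- Bound for the logarithmic derivative of a function without zeros. -/
theorem Differentiable.norm_deriv_div_le {g : ℂ → ℂ} (hg : Differentiable ℂ g) {r ρ M : ℝ}
    (hr : 0 ≤ r) (hrρ : r < ρ) (h0 : ∀ z ∈ ball 0 ρ, g z ≠ 0)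
    (hM : ∀ z ∈ ball 0 ρ, ‖g z‖ ≤ M) {z : ℂ} (hz : ‖z‖ ≤ r) :
    ‖_root_.deriv g z / g z‖ ≤ 8 * (Real.log (M / ‖g 0‖) + 1) * ρ / (ρ - r) ^ 2 := by
  have hρ : 0 < ρ := hr.trans_lt hrρ
  obtain ⟨h, h00, hh, heq⟩ := hg.exists_eq_mul_exp hρ h0
  have hg0 : 0 < ‖g 0‖ := norm_pos_iff.mpr (h0 0 (mem_ball_self hρ))
  have hMg : 1 ≤ M / ‖g 0‖ := (one_le_div hg0).mpr (hM 0 (mem_ball_self hρ))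
  have hlog : 0 ≤ Real.log (M / ‖g 0‖) := Real.log_nonneg hMg
  set A := Real.log (M / ‖g 0‖) + 1 with hA
  have hA0 : 0 < A := by linarith
  have hre : MapsTo h (ball 0 ρ) {z | z.re ≤ A} := by
    intro w hw
    have h1 : Real.exp (h w).re ≤ M / ‖g 0‖ := by
      rw [le_div_iff₀ hg0, ← Complex.norm_exp, mul_comm, ← norm_mul, ← heq w hw]
      exact hM w hw
    have h2 := (Real.le_log_iff_exp_le (by linarith)).mpr h1
    change (h w).re ≤ A
    linarith
  have hdiff : DifferentiableOn ℂ h (ball 0 ρ) := fun w hw =>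
    (hh w hw).differentiableAt.differentiableWithinAt
  have hbc : ∀ w, ‖w‖ ≤ (r + ρ) / 2 → ‖h w‖ ≤ 4 * A * ρ / (ρ - r) := by
    intro w hw
    have hw' : w ∈ ball (0 : ℂ) ρ := by simpa using (by linarith : ‖w‖ < ρ)
    refine (Complex.borelCaratheodory_zero hA0 hdiff hre hρ hw' h00).trans ?_
    have : 2 * A * ‖w‖ ≤ 2 * A * ρ := by
      have : ‖w‖ ≤ ρ := by linarith
      gcongr
    rw [div_le_div_iff₀ (by linarith) (by linarith)]
    nlinarith [mul_pos hA0 hρ]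
  have hsub : closedBall z ((ρ - r) / 2) ⊆ ball 0 ρ := by
    intro w hw
    rw [mem_closedBall, dist_eq_norm] at hw
    have : ‖w‖ ≤ ‖w - z‖ + ‖z‖ := by simpa using norm_add_le (w - z) z
    simpa using (by linarith : ‖w‖ < ρ)
  have hc := Complex.norm_deriv_le_of_forall_mem_sphere_norm_le (f := h) (c := z)
    (R := (ρ - r) / 2) (C := 4 * A * ρ / (ρ - r)) (by linarith)
    ((hdiff.mono hsub).diffContOnCl_ball subset_rfl) (by
      intro w hw
      refine hbc w ?_
      rw [mem_sphere, dist_eq_norm] at hw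
      have : ‖w‖ ≤ ‖w - z‖ + ‖z‖ := by simpa using norm_add_le (w - z) z
      linarith)
  rw [(hh z (by simpa using hz.trans_lt hrρ)).deriv] at hc
  refine hc.trans_eq ?_
  have : ρ - r ≠ 0 := by linarith
  field_simp
  ring

theorem le_norm_circleMap_sub {r : ℝ} (hr : 1 ≤ r) (a : ℂ) (t : ℝ) :
    |Real.sin (t / 2)| ≤ ‖circleMap 0 r (a.arg + t) - a‖ := by
  have hr0 : 0 ≤ r := by linarith
  have h1 : ‖circleMap 0 r (a.arg + t) - circleMap 0 r a.arg‖ = r * (2 * |Real.sin (t / 2)|) := by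
    have : circleMap 0 r (a.arg + t) - circleMap 0 r a.arg =
        r * (Complex.exp (a.arg * Complex.I) * (Complex.exp (Complex.I * t) - 1)) := by
      simp only [circleMap, zero_add, Complex.ofReal_add]
      rw [add_mul, Complex.exp_add, mul_comm (t : ℂ)]
      ring
    rw [this, norm_mul, norm_mul, Complex.norm_exp_I_mul_ofReal_sub_one,
      Complex.norm_exp_ofReal_mul_I, one_mul, Complex.norm_real, Real.norm_of_nonneg hr0, norm_mul]
    simp
  have h2 : ‖a - circleMap 0 r a.arg‖ = |‖a‖ - r| := by
    have : a - circleMap 0 r a.arg = (‖a‖ - r : ℝ) * Complex.exp (a.arg * Complex.I) := by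
      simp only [circleMap, zero_add, Complex.ofReal_sub]
      rw [sub_mul, Complex.norm_mul_exp_arg_mul_I]
    rw [this, norm_mul, Complex.norm_exp_ofReal_mul_I, mul_one, Complex.norm_real, Real.norm_eq_abs]
  have h3 : |‖a‖ - r| ≤ ‖circleMap 0 r (a.arg + t) - a‖ := by
    have h := abs_norm_sub_norm_le a (circleMap 0 r (a.arg + t))
    rwa [norm_circleMap_zero, abs_of_nonneg hr0, norm_sub_rev] at h
  have h4 := norm_sub_le_norm_sub_add_norm_sub (circleMap 0 r (a.arg + t)) a (circleMap 0 r a.arg)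
  rw [h1, h2] at h4
  nlinarith [abs_nonneg (Real.sin (t / 2))]

theorem norm_circleMap_sub_rpow_le {r : ℝ} (hr : 1 ≤ r) (a : ℂ) {t : ℝ}
    (ht : t ∈ Ioo 0 (2 * Real.pi)) :
    ‖circleMap 0 r (a.arg + t) - a‖ ^ (-(1 / 2) : ℝ) ≤
      (t / Real.pi) ^ (-(1 / 2) : ℝ) + ((2 * Real.pi - t) / Real.pi) ^ (-(1 / 2) : ℝ) := by
  have hpi := Real.pi_pos
  have h := le_norm_circleMap_sub hr a t
  have h1 : 0 < t / Real.pi := div_pos ht.1 hpi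
  have h2 : 0 < (2 * Real.pi - t) / Real.pi := div_pos (by linarith [ht.2]) hpi
  rcases le_total t Real.pi with h3 | h3
  · have h4 : |t / 2| ≤ Real.pi / 2 := by
      rw [abs_of_pos (by linarith [ht.1])]; linarith
    have h5 := Real.mul_abs_le_abs_sin h4
    rw [abs_of_pos (by linarith [ht.1])] at h5
    have h6 : t / Real.pi ≤ ‖circleMap 0 r (a.arg + t) - a‖ := by
      refine le_trans (le_of_eq ?_) (h5.trans h)
      field_simp
    refine (Real.rpow_le_rpow_of_nonpos h1 h6 (by norm_num)).trans ?_
    exact le_add_of_nonneg_right (Real.rpow_nonneg h2.le _)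
  · have h4 : |Real.pi - t / 2| ≤ Real.pi / 2 := by
      rw [abs_of_pos (by linarith [ht.2])]; linarith
    have h5 := Real.mul_abs_le_abs_sin h4
    rw [abs_of_pos (by linarith [ht.2]), Real.sin_pi_sub] at h5
    have h6 : (2 * Real.pi - t) / Real.pi ≤ ‖circleMap 0 r (a.arg + t) - a‖ := by
      refine le_trans (le_of_eq ?_) (h5.trans h)
      field_simp
    refine (Real.rpow_le_rpow_of_nonpos h2 h6 (by norm_num)).trans ?_
    exact le_add_of_nonneg_left (Real.rpow_nonneg h1.le _)

theorem exists_circleAverage_norm_sub_rpow_le :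
    ∃ K : ℝ, 0 ≤ K ∧ ∀ r : ℝ, 1 ≤ r → ∀ a : ℂ,
      CircleIntegrable (fun z => ‖z - a‖ ^ (-(1 / 2) : ℝ)) 0 r ∧
      Real.circleAverage (fun z => ‖z - a‖ ^ (-(1 / 2) : ℝ)) 0 r ≤ K := by
  have hpi := Real.pi_pos
  set g : ℝ → ℝ := fun t =>
    (t / Real.pi) ^ (-(1 / 2) : ℝ) + ((2 * Real.pi - t) / Real.pi) ^ (-(1 / 2) : ℝ) with hg
  have hgi : IntervalIntegrable g MeasureTheory.volume 0 (2 * Real.pi) := by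
    have h1 : IntervalIntegrable (fun t : ℝ => t ^ (-(1 / 2) : ℝ)) MeasureTheory.volume 0 2 :=
      intervalIntegral.intervalIntegrable_rpow' (by norm_num)
    have h2 := h1.comp_mul_right (c := Real.pi⁻¹) (by finiteness)
    have e1 : 0 / Real.pi⁻¹ = 0 := by simp
    have e2 : 2 / Real.pi⁻¹ = 2 * Real.pi := by simp
    rw [e1, e2] at h2
    have h3 := (h2.comp_sub_left (2 * Real.pi) (by finiteness)).symm
    simp only [sub_self, sub_zero] at h3
    have h4 := h2.add h3
    simp only [← div_eq_mul_inv] at h4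
    exact h4
  have hg0 : ∀ t ∈ Ioo 0 (2 * Real.pi), 0 ≤ g t := fun t ht =>
    add_nonneg (Real.rpow_nonneg (div_nonneg ht.1.le hpi.le) _)
      (Real.rpow_nonneg (div_nonneg (by linarith [ht.2]) hpi.le) _)
  refine ⟨(2 * Real.pi)⁻¹ * ∫ t in 0..(2 * Real.pi), g t, ?_, fun r hr a => ?_⟩
  · refine mul_nonneg (by positivity) ?_
    have := intervalIntegral.integral_mono_on_of_le_Ioo (f := fun _ => (0 : ℝ)) (g := g)
      (μ := MeasureTheory.volume) (a := 0) (b := 2 * Real.pi) (by positivity) (by simp) hgi hg0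
    simpa using this
  set h : ℝ → ℝ := fun t => ‖circleMap 0 r t - a‖ ^ (-(1 / 2) : ℝ) with hh
  have hper : Function.Periodic h (2 * Real.pi) := fun t => by
    simp only [hh, periodic_circleMap 0 r t]
  have hmeas : Measurable h := by
    have : Continuous (circleMap 0 r) := continuous_circleMap 0 r
    fun_prop
  have hsi : IntervalIntegrable (fun t => h (a.arg + t)) MeasureTheory.volume 0 (2 * Real.pi) := by
    refine hgi.mono_fun ?_ ?_
    · exact (hmeas.comp (measurable_const_add _)).aestronglyMeasurable
    · rw [uIoc_of_le (by positivity), ← MeasureTheory.restrict_Ioo_eq_restrict_Ioc]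
      filter_upwards [MeasureTheory.self_mem_ae_restrict measurableSet_Ioo] with t ht
      rw [Real.norm_of_nonneg (hg0 t ht), Real.norm_of_nonneg (Real.rpow_nonneg (norm_nonneg _) _)]
      exact norm_circleMap_sub_rpow_le hr a ht
  have hcirc : ∀ b c, IntervalIntegrable h MeasureTheory.volume b c := by
    have h1 := hsi.comp_add_left (-a.arg) (by finiteness)
    refine hper.intervalIntegrable (t := a.arg) (by positivity) ?_
    simpa [add_comm] using h1
  refine ⟨hcirc _ _, ?_⟩
  rw [Real.circleAverage_def, smul_eq_mul]
  refine mul_le_mul_of_nonneg_left ?_ (by positivity)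
  calc (∫ t in 0..(2 * Real.pi), h t) = ∫ t in a.arg..a.arg + 2 * Real.pi, h t := by
        simpa using hper.intervalIntegral_add_eq 0 a.arg
    _ = ∫ t in 0..(2 * Real.pi), h (a.arg + t) := by
        rw [intervalIntegral.integral_comp_add_left h]; simp
    _ ≤ _ := intervalIntegral.integral_mono_on_of_le_Ioo (by positivity) hsi hgi
        fun t ht => norm_circleMap_sub_rpow_le hr a ht

theorem circleAverage_multiset_sum_le {K r : ℝ}
    (hK : ∀ a : ℂ, CircleIntegrable (fun z => ‖z - a‖ ^ (-(1 / 2) : ℝ)) 0 r ∧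
      Real.circleAverage (fun z => ‖z - a‖ ^ (-(1 / 2) : ℝ)) 0 r ≤ K) (s : Multiset ℂ) :
    CircleIntegrable (fun z => (s.map fun a => ‖z - a‖ ^ (-(1 / 2) : ℝ)).sum) 0 r ∧
      Real.circleAverage (fun z => (s.map fun a => ‖z - a‖ ^ (-(1 / 2) : ℝ)).sum) 0 r ≤
        s.card * K := by
  induction s using Multiset.induction_on with
  | empty => simp [Real.circleAverage_const]
  | cons a s ih =>
    simp only [Multiset.map_cons, Multiset.sum_cons, Multiset.card_cons]
    refine ⟨(hK a).1.add ih.1, ?_⟩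
    rw [Real.circleAverage_fun_add (hK a).1 ih.1]
    push_cast
    linarith [(hK a).2, ih.2]

theorem differentiable_multiset_prod {F : ℂ → ℂ → ℂ} (hF : ∀ a, Differentiable ℂ (F a))
    (s : Multiset ℂ) : Differentiable ℂ fun z => (s.map fun a => F a z).prod := by
  induction s using Multiset.induction_on with
  | empty => simp
  | cons a s ih =>
    simp only [Multiset.map_cons, Multiset.prod_cons]
    exact (hF a).mul ih

theorem logDeriv_multiset_prod {F : ℂ → ℂ → ℂ} (hF : ∀ a, Differentiable ℂ (F a))
    {s : Multiset ℂ} {z : ℂ} (h : ∀ a ∈ s, F a z ≠ 0) :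
    logDeriv (fun z => (s.map fun a => F a z).prod) z =
      (s.map fun a => logDeriv (F a) z).sum := by
  induction s using Multiset.induction_on with
  | empty => simp
  | cons a s ih =>
    simp only [Multiset.map_cons, Multiset.prod_cons, Multiset.sum_cons]
    have hs : ∀ b ∈ s, F b z ≠ 0 := fun b hb => h b (Multiset.mem_cons_of_mem hb)
    rw [logDeriv_mul z (h a (Multiset.mem_cons_self a s)) ?_ (hF a z)
      (differentiable_multiset_prod hF s z), ih hs]
    exact Multiset.prod_ne_zero (by simpa using hs)

theorem norm_logDeriv_sub_le {a z : ℂ} {R : ℝ} (ha : ‖a‖ < R) (hz : ‖z‖ ≤ R) (hza : z ≠ a) :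
    ‖logDeriv (fun z => z - a) z - logDeriv (fun z => ((R : ℂ) ^ 2 - starRingEnd ℂ a * z) / R) z‖
      ≤ 2 / ‖z - a‖ := by
  have hR : 0 < R := (norm_nonneg a).trans_lt ha
  have hR' : (R : ℂ) ≠ 0 := by exact_mod_cast hR.ne'
  have hza' : 0 < ‖z - a‖ := norm_pos_iff.mpr (sub_ne_zero.mpr hza)
  have hne := sq_sub_conj_mul_ne_zero ha hz
  have h1 : logDeriv (fun z => z - a) z = 1 / (z - a) := by
    rw [logDeriv_apply]; simp
  have h2 : logDeriv (fun z => ((R : ℂ) ^ 2 - starRingEnd ℂ a * z) / R) z =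
      -(starRingEnd ℂ a / ((R : ℂ) ^ 2 - starRingEnd ℂ a * z)) := by
    have hd : HasDerivAt (fun z => ((R : ℂ) ^ 2 - starRingEnd ℂ a * z) / R)
        ((0 - starRingEnd ℂ a * 1) / R) z :=
      ((hasDerivAt_const z _).sub ((hasDerivAt_id z).const_mul _)).div_const _
    rw [logDeriv_apply, hd.deriv]
    field_simp
    ring
  rw [h1, h2, sub_neg_eq_add]
  refine (norm_add_le _ _).trans ?_
  have h3 : ‖starRingEnd ℂ a / ((R : ℂ) ^ 2 - starRingEnd ℂ a * z)‖ ≤ 1 / ‖z - a‖ := by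
    rw [norm_div, Complex.norm_conj, div_le_div_iff₀ (norm_pos_iff.mpr hne) hza', one_mul]
    refine le_trans ?_ (norm_mul_sub_le ha.le hz)
    gcongr
  rw [norm_div, norm_one]
  calc _ ≤ 1 / ‖z - a‖ + 1 / ‖z - a‖ := by gcongr
    _ = _ := by ring

theorem norm_multiset_sum_sub_le {u v : ℂ → ℂ} {c : ℂ → ℝ} {s : Multiset ℂ}
    (h : ∀ a ∈ s, ‖u a - v a‖ ≤ c a) :
    ‖(s.map u).sum - (s.map v).sum‖ ≤ (s.map c).sum := by
  induction s using Multiset.induction_on with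
  | empty => simp
  | cons a s ih =>
    simp only [Multiset.map_cons, Multiset.sum_cons]
    rw [add_sub_add_comm]
    exact (norm_add_le _ _).trans (add_le_add (h a (Multiset.mem_cons_self a s))
      (ih fun b hb => h b (Multiset.mem_cons_of_mem hb)))

theorem sqrt_add_le_sqrt_add_sqrt {x y : ℝ} (hx : 0 ≤ x) (hy : 0 ≤ y) : √(x + y) ≤ √x + √y := by
  rw [Real.sqrt_le_iff]
  refine ⟨by positivity, ?_⟩
  nlinarith [Real.sq_sqrt hx, Real.sq_sqrt hy, Real.sqrt_nonneg x, Real.sqrt_nonneg y,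
    mul_nonneg (Real.sqrt_nonneg x) (Real.sqrt_nonneg y)]

theorem sqrt_add_multiset_sum_le {x : ℝ} (hx : 0 ≤ x) (s : Multiset ℂ) (z : ℂ) :
    √(x + (s.map fun a => 2 / ‖z - a‖).sum) ≤
      √x + √2 * (s.map fun a => ‖z - a‖ ^ (-(1 / 2) : ℝ)).sum := by
  induction s using Multiset.induction_on with
  | empty => simp
  | cons a s ih =>
    simp only [Multiset.map_cons, Multiset.sum_cons]
    have h1 : √(2 / ‖z - a‖) = √2 * ‖z - a‖ ^ (-(1 / 2) : ℝ) := by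
      rw [Real.sqrt_div (by norm_num), Real.rpow_neg (norm_nonneg _), ← Real.sqrt_eq_rpow]
      rfl
    have h0 : 0 ≤ (s.map fun a => 2 / ‖z - a‖).sum :=
      Multiset.sum_nonneg (by simp only [Multiset.mem_map]; rintro _ ⟨b, _, rfl⟩; positivity)
    have h2 := sqrt_add_le_sqrt_add_sqrt (x := 2 / ‖z - a‖)
      (y := x + (s.map fun a => 2 / ‖z - a‖).sum) (by positivity) (by positivity)
    rw [show x + (2 / ‖z - a‖ + (s.map fun a => 2 / ‖z - a‖).sum) =
      2 / ‖z - a‖ + (x + (s.map fun a => 2 / ‖z - a‖).sum) by ring]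
    calc _ ≤ _ := h2
      _ ≤ _ := by rw [h1, mul_add]; linarith

theorem posLog_le_two_mul_log {x X A : ℝ} (hx : 0 ≤ x) (hxX : √x ≤ X) (hA : 0 ≤ A) :
    Real.posLog x ≤ 2 * (Real.log (1 + A) + (X - A) / (1 + A)) := by
  have hs := Real.sqrt_nonneg x
  have h1 : Real.posLog x ≤ 2 * Real.log (1 + √x) := by
    rw [Real.posLog, max_le_iff]
    refine ⟨mul_nonneg (by norm_num) (Real.log_nonneg (by linarith)), ?_⟩
    rcases hx.eq_or_lt with h | h
    · simp [← h]
    · rw [← Real.log_rpow (by positivity)]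
      refine Real.log_le_log h ?_
      have := Real.sq_sqrt hx
      norm_num
      nlinarith
  have h2 : Real.log (1 + √x) ≤ Real.log (1 + X) := Real.log_le_log (by positivity) (by linarith)
  have h3 : Real.log (1 + X) - Real.log (1 + A) ≤ (X - A) / (1 + A) := by
    rw [← Real.log_div (by linarith) (by linarith)]
    refine (Real.log_le_sub_one_of_pos (div_pos (by linarith) (by linarith))).trans_eq ?_
    have : 1 + A ≠ 0 := by linarith
    field_simp
    ring
  linarith

theorem norm_le_of_norm_le_sphere {G : ℂ → ℂ} (hG : Differentiable ℂ G) {R M : ℝ} (hR : 0 < R)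
    (h : ∀ z ∈ sphere 0 R, ‖G z‖ ≤ M) {z : ℂ} (hz : ‖z‖ ≤ R) : ‖G z‖ ≤ M := by
  refine Complex.norm_le_of_forall_mem_frontier_norm_le (U := ball 0 R) isBounded_ball
    hG.diffContOnCl (fun w hw => h w ?_) ?_
  · rwa [frontier_ball _ hR.ne'] at hw
  · rw [closure_ball _ hR.ne']; simpa using hz

/-- Lower bound for the value at the origin after moving zeros by Blaschke factors. -/
theorem norm_multiset_prod_mul_le {ρ R : ℝ} (hρ : 0 < ρ) {s : Multiset ℂ}
    (hs : ∀ a ∈ s, ‖a‖ ≤ ρ) (hR : ρ ≤ R) :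
    ‖(s.map fun a => 0 - a).prod‖ * (R / ρ) ^ s.card ≤ R ^ s.card := by
  have hR0 : 0 < R := hρ.trans_le hR
  induction s using Multiset.induction_on with
  | empty => simp
  | cons a s ih =>
    have h1 := ih fun b hb => hs b (Multiset.mem_cons_of_mem hb)
    have h2 := hs a (Multiset.mem_cons_self a s)
    simp only [Multiset.map_cons, Multiset.prod_cons, Multiset.card_cons, norm_mul, pow_succ]
    simp only [zero_sub, norm_neg] at h1 ⊢
    have h3 : ‖a‖ * (R / ρ) ≤ R := by
      rw [← mul_div_assoc, div_le_iff₀ hρ]; nlinarith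
    calc _ = (‖(s.map fun a => -a).prod‖ * (R / ρ) ^ s.card) * (‖a‖ * (R / ρ)) := by ring
      _ ≤ R ^ s.card * R := by gcongr

theorem norm_multiset_prod_eq {R : ℝ} (hR : 0 < R) (s : Multiset ℂ) {z : ℂ} (hz : ‖z‖ = R) :
    ‖(s.map fun a => ((R : ℂ) ^ 2 - starRingEnd ℂ a * z) / R).prod‖ =
      ‖(s.map fun a => z - a).prod‖ := by
  induction s using Multiset.induction_on with
  | empty => simp
  | cons a s ih =>
    simp only [Multiset.map_cons, Multiset.prod_cons, norm_mul, ih]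
    rw [norm_div, ← norm_mul_sub_eq hR hz, Complex.norm_real, Real.norm_of_nonneg hR.le,
      mul_div_cancel_left₀ _ hR.ne']

/-- Pointwise bound for a logarithmic derivative in terms of the nearby zeros. -/
theorem exists_norm_logDeriv_le {G : ℂ → ℂ} (hG : Differentiable ℂ G) (h0 : G 0 ≠ 0)
    {r δ M : ℝ} (hr : 1 ≤ r) (hδ : 0 < δ)
    (hM : ∀ z ∈ sphere 0 (r + 2 * δ), ‖G z‖ ≤ M) :
    ∃ s : Multiset ℂ, s.card ≤ Real.log (M / ‖G 0‖) * ((r + 2 * δ) / δ) ∧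
      ∀ z, ‖z‖ ≤ r → G z ≠ 0 → ‖logDeriv G z‖ ≤
        8 * (Real.log (M / ‖G 0‖) + 1) * (r + δ) / δ ^ 2 + (s.map fun a => 2 / ‖z - a‖).sum := by
  set ρ := r + δ with hρ
  set R := r + 2 * δ with hR
  have hρ0 : 0 < ρ := by linarith
  have hR0 : 0 < R := by linarith
  have hρR : ρ < R := by linarith
  have hG0 : 0 < ‖G 0‖ := norm_pos_iff.mpr h0
  obtain ⟨s, g, hg, hs, hgz, heq⟩ := hG.exists_eq_multiset_prod_mul ⟨0, h0⟩ ρ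
  set B : ℂ → ℂ := fun z => (s.map fun a => ((R : ℂ) ^ 2 - starRingEnd ℂ a * z) / R).prod with hB
  have hBd : Differentiable ℂ B := differentiable_multiset_prod (by intro a; fun_prop) s
  have hBne : ∀ z, ‖z‖ ≤ R → ∀ a ∈ s, ((R : ℂ) ^ 2 - starRingEnd ℂ a * z) / R ≠ 0 :=
    fun z hz a ha => div_ne_zero (sq_sub_conj_mul_ne_zero ((hs a ha).trans_lt hρR) hz)
      (by exact_mod_cast hR0.ne')
  have hBne' : ∀ z, ‖z‖ ≤ R → B z ≠ 0 := fun z hz =>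
    Multiset.prod_ne_zero (by simpa only [Multiset.mem_map, not_exists, not_and] using hBne z hz)
  set H : ℂ → ℂ := fun z => B z * g z with hH
  have hHd : Differentiable ℂ H := hBd.mul hg
  have hHM : ∀ z, ‖z‖ ≤ R → ‖H z‖ ≤ M := by
    intro z hz
    refine norm_le_of_norm_le_sphere hHd hR0 (fun w hw => ?_) hz
    refine le_trans (le_of_eq ?_) (hM w hw)
    simp only [hH, hB]
    rw [heq, norm_mul, norm_mul, norm_multiset_prod_eq hR0 s (by simpa using hw)]
  have hHne : ∀ z, ‖z‖ ≤ ρ → H z ≠ 0 := fun z hz =>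
    mul_ne_zero (hBne' z (hz.trans hρR.le)) (hgz z (by simpa using hz))
  have hB0 : ‖B 0‖ = R ^ s.card := by
    simp only [hB, mul_zero, sub_zero, Multiset.map_const', Multiset.prod_replicate, norm_pow]
    congr 1
    rw [norm_div, norm_pow, Complex.norm_real, Real.norm_of_nonneg hR0.le]
    field_simp
  have hH0 : ‖G 0‖ * (R / ρ) ^ s.card ≤ ‖H 0‖ := by
    simp only [hH]
    rw [heq, norm_mul, norm_mul, hB0]
    calc _ = (‖(s.map fun a => 0 - a).prod‖ * (R / ρ) ^ s.card) * ‖g 0‖ := by ring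
      _ ≤ _ := by gcongr; exact norm_multiset_prod_mul_le hρ0 hs hρR.le
  have h1Rρ : 1 ≤ R / ρ := (one_le_div hρ0).mpr hρR.le
  have hMpos : ‖G 0‖ * (R / ρ) ^ s.card ≤ M := hH0.trans (hHM 0 (by simpa using hR0.le))
  have hGH : ‖G 0‖ ≤ ‖H 0‖ := le_trans (le_mul_of_one_le_right hG0.le (one_le_pow₀ h1Rρ)) hH0
  have hM0 : 0 < M := hG0.trans_le (hGH.trans (hHM 0 (by simpa using hR0.le)))
  refine ⟨s, ?_, fun z hz hGz => ?_⟩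
  · have h1 : (R / ρ) ^ s.card ≤ M / ‖G 0‖ := by
      rw [le_div_iff₀ hG0]; linarith
    have h2 : s.card * Real.log (R / ρ) ≤ Real.log (M / ‖G 0‖) := by
      rw [← Real.log_pow]
      exact Real.log_le_log (by positivity) h1
    have h3 : δ / R ≤ Real.log (R / ρ) := by
      have := Real.one_sub_inv_le_log_of_pos (x := R / ρ) (by positivity)
      refine le_trans (le_of_eq ?_) this
      rw [inv_div, hR, hρ]
      have : r + 2 * δ ≠ 0 := by linarith
      field_simp
      ring
    have h4 : (s.card : ℝ) * (δ / R) ≤ Real.log (M / ‖G 0‖) :=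
      le_trans (mul_le_mul_of_nonneg_left h3 (by positivity)) h2
    calc (s.card : ℝ) = s.card * (δ / R) * (R / δ) := by field_simp
      _ ≤ _ := by gcongr
  · have hzR : ‖z‖ ≤ R := by linarith
    have hgz' : g z ≠ 0 := hgz z (by simp; linarith)
    have hza : ∀ a ∈ s, z - a ≠ 0 := by
      intro a ha h
      apply hGz
      rw [heq, Multiset.prod_eq_zero (Multiset.mem_map.mpr ⟨a, ha, h⟩), zero_mul]
    have e1 : logDeriv G z = (s.map fun a => logDeriv (fun z => z - a) z).sum + logDeriv g z := by
      rw [funext heq, logDeriv_mul z ?_ hgz'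
        (differentiable_multiset_prod (F := fun a z => z - a) (by intro a; fun_prop) s z) (hg z),
        logDeriv_multiset_prod (F := fun a z => z - a) (by intro a; fun_prop) hza]
      rw [heq] at hGz
      exact left_ne_zero_of_mul hGz
    have e2 : logDeriv H z = (s.map fun a =>
        logDeriv (fun z => ((R : ℂ) ^ 2 - starRingEnd ℂ a * z) / R) z).sum + logDeriv g z := by
      rw [logDeriv_mul z (hBne' z hzR) hgz' (hBd z) (hg z), hB,
        logDeriv_multiset_prod (F := fun a z => ((R : ℂ) ^ 2 - starRingEnd ℂ a * z) / R)
          (by intro a; fun_prop) (hBne z hzR)]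
    have e3 := norm_multiset_sum_sub_le (s := s) (c := fun a => 2 / ‖z - a‖)
      (u := fun a => logDeriv (fun z => z - a) z)
      (v := fun a => logDeriv (fun z => ((R : ℂ) ^ 2 - starRingEnd ℂ a * z) / R) z)
      fun a ha => norm_logDeriv_sub_le ((hs a ha).trans_lt hρR) hzR (sub_ne_zero.mp (hza a ha))
    have e4 := hHd.norm_deriv_div_le (r := r) (ρ := ρ) (M := M) (by linarith) (by linarith)
      (fun w hw => hHne w (by simpa using (mem_ball.mp hw).le))
      (fun w hw => hHM w (by have := mem_ball_zero_iff.mp hw; linarith)) hz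
    rw [← logDeriv_apply] at e4
    have e5 : Real.log (M / ‖H 0‖) ≤ Real.log (M / ‖G 0‖) :=
      Real.log_le_log (div_pos hM0 (hG0.trans_le hGH)) (by gcongr)
    have e6 : 8 * (Real.log (M / ‖H 0‖) + 1) * ρ / (ρ - r) ^ 2 ≤
        8 * (Real.log (M / ‖G 0‖) + 1) * ρ / δ ^ 2 := by
      rw [hρ, add_sub_cancel_left]
      gcongr
    calc ‖logDeriv G z‖ = ‖logDeriv H z + ((s.map fun a => logDeriv (fun z => z - a) z).sum -
          (s.map fun a => logDeriv (fun z => ((R : ℂ) ^ 2 - starRingEnd ℂ a * z) / R) z).sum)‖ := by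
          rw [e1, e2]; congr 1; ring
      _ ≤ _ := (norm_add_le _ _).trans (add_le_add (e4.trans e6) e3)

open ValueDistribution

theorem Differentiable.differentiable_deriv {G : ℂ → ℂ} (hG : Differentiable ℂ G) :
    Differentiable ℂ (_root_.deriv G) := by
  simpa using hG.contDiff.differentiable_deriv_two

theorem Differentiable.meromorphic {G : ℂ → ℂ} (hG : Differentiable ℂ G) : Meromorphic G :=
  fun z => (hG.analyticAt z).meromorphicAt

theorem Differentiable.meromorphic_logDeriv {G : ℂ → ℂ} (hG : Differentiable ℂ G) :
    Meromorphic (logDeriv G) := fun z =>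
  (hG.differentiable_deriv.meromorphic z).div (hG.meromorphic z)

/-- Lemma on the logarithmic derivative for an entire function not vanishing at the origin. -/
theorem exists_proximity_logDeriv_le_of_ne_zero :
    ∃ K : ℝ, 1 ≤ K ∧ ∀ G : ℂ → ℂ, Differentiable ℂ G → G 0 ≠ 0 → ∀ r δ M : ℝ, 1 ≤ r → 0 < δ →
      δ ≤ 1 → (∀ z ∈ sphere 0 (r + 2 * δ), ‖G z‖ ≤ M) →
      ValueDistribution.proximity (logDeriv G) ⊤ r ≤
        2 * Real.log (K * (Real.log (M / ‖G 0‖) + 1) * (r / δ)) := by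
  obtain ⟨K₀, hK₀, hK⟩ := exists_circleAverage_norm_sub_rpow_le
  refine ⟨5 + 6 * K₀, by linarith, fun G hG h0 r δ M hr hδ hδ1 hM => ?_⟩
  have hG0 : 0 < ‖G 0‖ := norm_pos_iff.mpr h0
  have hGM : ‖G 0‖ ≤ M := norm_le_of_norm_le_sphere hG (by linarith) hM (by simp; linarith)
  have hlog : 0 ≤ Real.log (M / ‖G 0‖) := Real.log_nonneg ((one_le_div hG0).mpr hGM)
  obtain ⟨s, hs, hle⟩ := exists_norm_logDeriv_le hG h0 hr hδ hM
  set L := Real.log (M / ‖G 0‖) with hL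
  set x := 8 * (L + 1) * (r + δ) / δ ^ 2 with hx
  have hx0 : 0 ≤ x := by positivity
  obtain ⟨hi, havg⟩ := circleAverage_multiset_sum_le (K := K₀) (hK r hr) s
  set S : ℂ → ℝ := fun z => (s.map fun a => ‖z - a‖ ^ (-(1 / 2) : ℝ)).sum with hS
  have hS0 : ∀ z, 0 ≤ S z := fun z => Multiset.sum_nonneg (by
    simp only [Multiset.mem_map]; rintro _ ⟨b, _, rfl⟩; positivity)
  set A := √x + √2 * (s.card * K₀) with hA
  have hA0 : 0 ≤ A := by positivity
  have hi1 : CircleIntegrable (fun z => √2 * S z) 0 r := hi.const_smul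
  have hi2 : CircleIntegrable (fun z => √x + √2 * S z) 0 r :=
    (circleIntegrable_const (√x) 0 r).add hi1
  have hpt : ∀ z ∈ sphere (0 : ℂ) |r|, Real.posLog ‖logDeriv G z‖ ≤
      2 * (Real.log (1 + A) + ((√x + √2 * S z) - A) / (1 + A)) := by
    intro z hz
    rw [abs_of_pos (by linarith), mem_sphere_zero_iff_norm] at hz
    refine posLog_le_two_mul_log (norm_nonneg _) ?_ hA0
    by_cases hGz : G z = 0
    · simp only [logDeriv_apply, hGz, div_zero, norm_zero, Real.sqrt_zero]
      have := hS0 z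
      positivity
    · exact (Real.sqrt_le_sqrt (hle z hz.le hGz)).trans (sqrt_add_multiset_sum_le hx0 s z)
  have hi3 : CircleIntegrable (fun z => ((√x + √2 * S z) - A)) 0 r :=
    hi2.sub (circleIntegrable_const A 0 r)
  have hi4 : CircleIntegrable (fun z => ((√x + √2 * S z) - A) / (1 + A)) 0 r := by
    simp only [div_eq_inv_mul]; exact hi3.const_smul
  have hi5 : CircleIntegrable
      (fun z => Real.log (1 + A) + ((√x + √2 * S z) - A) / (1 + A)) 0 r :=
    (circleIntegrable_const _ 0 r).add hi4
  have hi6 : CircleIntegrable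
      (fun z => 2 * (Real.log (1 + A) + ((√x + √2 * S z) - A) / (1 + A))) 0 r := hi5.const_smul
  have h1 : ValueDistribution.proximity (logDeriv G) ⊤ r ≤ 2 * Real.log (1 + A) := by
    rw [ValueDistribution.proximity_top]
    refine (Real.circleAverage_mono
      (MeromorphicOn.circleIntegrable_posLog_norm fun z _ => hG.meromorphic_logDeriv z)
      hi6 hpt).trans ?_
    have e1 : Real.circleAverage (fun z => √x + √2 * S z) 0 r ≤ A := by
      rw [Real.circleAverage_fun_add (circleIntegrable_const _ 0 r) hi1,
        Real.circleAverage_const, hA]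
      have := Real.circleAverage_fun_smul (a := √2) (f := S) (c := 0) (R := r)
      simp only [smul_eq_mul] at this
      rw [this]
      gcongr
    have e2 : Real.circleAverage (fun z => (√x + √2 * S z) - A) 0 r ≤ 0 := by
      rw [Real.circleAverage_fun_sub hi2 (circleIntegrable_const _ 0 r), Real.circleAverage_const]
      linarith
    have e3 : Real.circleAverage (fun z => ((√x + √2 * S z) - A) / (1 + A)) 0 r ≤ 0 := by
      simp only [div_eq_inv_mul]
      have := Real.circleAverage_fun_smul (a := (1 + A)⁻¹) (f := fun z => (√x + √2 * S z) - A)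
        (c := 0) (R := r)
      simp only [smul_eq_mul] at this
      rw [this]
      exact mul_nonpos_of_nonneg_of_nonpos (by positivity) e2
    have := Real.circleAverage_fun_smul (a := (2 : ℝ))
      (f := fun z => Real.log (1 + A) + ((√x + √2 * S z) - A) / (1 + A)) (c := 0) (R := r)
    simp only [smul_eq_mul] at this ⊢
    rw [this, Real.circleAverage_fun_add (circleIntegrable_const _ 0 r) hi4,
      Real.circleAverage_const]
    linarith
  refine h1.trans ?_
  have hrd : 1 ≤ r / δ := (one_le_div hδ).mpr (by linarith)
  have hQ : 1 ≤ (L + 1) * (r / δ) := by nlinarith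
  refine mul_le_mul_of_nonneg_left (Real.log_le_log (by positivity) ?_) (by norm_num)
  have b1 : √x ≤ 4 * ((L + 1) * (r / δ)) := by
    rw [Real.sqrt_le_iff]
    refine ⟨by positivity, ?_⟩
    rw [hx, show (4 * ((L + 1) * (r / δ))) ^ 2 = 16 * (L + 1) ^ 2 * r ^ 2 / δ ^ 2 by
      field_simp; ring]
    refine div_le_div_of_nonneg_right ?_ (by positivity)
    have c1 : L + 1 ≤ (L + 1) ^ 2 := by nlinarith
    have c2 : r ≤ r ^ 2 := by nlinarith
    calc 8 * (L + 1) * (r + δ) ≤ 8 * (L + 1) * (2 * r) := by gcongr; linarith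
      _ = 16 * (L + 1) * r := by ring
      _ ≤ _ := by gcongr
  have b2 : (s.card : ℝ) ≤ 3 * ((L + 1) * (r / δ)) := by
    refine hs.trans ?_
    rw [show 3 * ((L + 1) * (r / δ)) = (L + 1) * ((3 * r) / δ) by ring]
    gcongr <;> linarith
  have b3 : √2 ≤ 2 := by
    rw [Real.sqrt_le_iff]; norm_num
  calc 1 + A ≤ (L + 1) * (r / δ) + (4 * ((L + 1) * (r / δ)) +
        2 * ((3 * ((L + 1) * (r / δ))) * K₀)) := by rw [hA]; gcongr
    _ = _ := by ring

theorem Differentiable.exists_proximity_logDeriv_le {G : ℂ → ℂ} (hG : Differentiable ℂ G)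
    (h0 : ∃ z, G z ≠ 0) :
    ∃ C : ℝ, 1 ≤ C ∧ ∀ r δ M : ℝ, 1 ≤ r → 0 < δ → δ ≤ 1 → 1 ≤ M →
      (∀ z ∈ sphere 0 (r + 2 * δ), ‖G z‖ ≤ M) →
      proximity (logDeriv G) ⊤ r ≤ 2 * Real.log (Real.log M + C) + 2 * Real.log (r / δ) + C := by
  obtain ⟨m, g, hg, hg0, heq⟩ := hG.exists_eq_pow_mul h0 0
  obtain ⟨K, hK1, hK⟩ := exists_proximity_logDeriv_le_of_ne_zero
  simp only [sub_zero] at heq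
  have hK' : 0 ≤ Real.log K := Real.log_nonneg hK1
  have hm : (0 : ℝ) ≤ Real.posLog m := Real.posLog_nonneg
  have hl2 : 0 ≤ Real.log 2 := Real.log_nonneg (by norm_num)
  set C₁ := |Real.log ‖g 0‖| + 1 with hC₁
  set C := C₁ + 2 * Real.log K + Real.posLog m + Real.log 2 with hC
  have hC1 : 1 ≤ C₁ := by have := abs_nonneg (Real.log ‖g 0‖); linarith
  refine ⟨C, by linarith, fun r δ M hr hδ hδ1 hM hsph => ?_⟩
  have hgM : ∀ z ∈ sphere (0 : ℂ) (r + 2 * δ), ‖g z‖ ≤ M := by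
    intro z hz
    refine le_trans ?_ (hsph z hz)
    rw [heq, norm_mul, norm_pow, mem_sphere_zero_iff_norm.mp hz]
    exact le_mul_of_one_le_left (norm_nonneg _) (one_le_pow₀ (by linarith))
  have hg0' : 0 < ‖g 0‖ := norm_pos_iff.mpr hg0
  have hgM0 : ‖g 0‖ ≤ M := norm_le_of_norm_le_sphere hg (by linarith) hgM (by simp; linarith)
  have h1 := hK g hg hg0 r δ M hr hδ hδ1 hgM
  have hlogM : 0 ≤ Real.log M := Real.log_nonneg hM
  have hrd : 1 ≤ r / δ := (one_le_div hδ).mpr (by linarith)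
  have hL : 0 ≤ Real.log (M / ‖g 0‖) := Real.log_nonneg ((one_le_div hg0').mpr hgM0)
  have h2 : Real.log (K * (Real.log (M / ‖g 0‖) + 1) * (r / δ)) ≤
      Real.log K + Real.log (Real.log M + C) + Real.log (r / δ) := by
    rw [Real.log_mul (by positivity) (by positivity), Real.log_mul (by positivity) (by positivity)]
    have : Real.log (Real.log (M / ‖g 0‖) + 1) ≤ Real.log (Real.log M + C) := by
      refine Real.log_le_log (by positivity) ?_
      rw [Real.log_div (by positivity) (by positivity)]
      have := neg_le_abs (Real.log ‖g 0‖)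
      linarith
    linarith
  have h3 : proximity (logDeriv G) ⊤ r =
      proximity ((fun z : ℂ => (m : ℂ) / z) + logDeriv g) ⊤ r := by
    refine proximity_congr_codiscrete ?_ (by positivity)
    filter_upwards [hG.eventually_codiscrete_ne_zero h0,
      Differentiable.eventually_codiscrete_ne_zero (G := fun z => z) (by fun_prop)
        ⟨1, one_ne_zero⟩] with z hz hz0
    rw [heq] at hz
    rw [funext heq, logDeriv_mul (f := fun z : ℂ => z ^ m) z (left_ne_zero_of_mul hz) (right_ne_zero_of_mul hz) (by fun_prop)
      (hg z), Pi.add_apply]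
    congr 1
    have := logDeriv_fun_pow (f := fun z : ℂ => z) (x := z) (by fun_prop) m
    rw [this, logDeriv_apply]
    simp [div_eq_mul_inv]
  have hmer : Meromorphic (fun z : ℂ => (m : ℂ) / z) := fun z =>
    (MeromorphicAt.const _ z).div (MeromorphicAt.id z)
  have h4 : proximity (fun z : ℂ => (m : ℂ) / z) ⊤ r ≤ Real.posLog m := by
    rw [proximity_top]
    refine Real.circleAverage_mono_on_of_le_circle
      (MeromorphicOn.circleIntegrable_posLog_norm fun z _ => hmer z) fun z hz => ?_
    rw [mem_sphere_zero_iff_norm, abs_of_pos (by linarith)] at hz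
    refine Real.posLog_le_posLog (norm_nonneg _) ?_
    rw [norm_div, hz, Complex.norm_natCast]
    exact div_le_self (by positivity) hr
  have h5 := proximity_add_top_le hmer hg.meromorphic_logDeriv r
  simp only [Pi.add_apply] at h5
  rw [h3]
  linarith

theorem Differentiable.exists_le_circleAverage_log_norm {G : ℂ → ℂ} (hG : Differentiable ℂ G)
    (h0 : ∃ z, G z ≠ 0) :
    ∃ C : ℝ, ∀ r : ℝ, 1 ≤ r → C ≤ Real.circleAverage (fun z => Real.log ‖G z‖) 0 r := by
  obtain ⟨m, g, hg, hg0, heq⟩ := hG.exists_eq_pow_mul h0 0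
  simp only [sub_zero] at heq
  refine ⟨Real.log ‖g 0‖, fun r hr => ?_⟩
  have h1 := hg.log_norm_le_circleAverage_kernel (w := 0) (R := r) (by simp; linarith) hg0
  refine h1.trans ?_
  refine Real.circleAverage_mono ((hg.circleIntegrable_log_norm r).continuousOn_mul
    (continuousOn_re_herglotzRieszKernel (by simp; linarith)))
    (hG.circleIntegrable_log_norm r) fun z hz => ?_
  rw [mem_sphere_zero_iff_norm, abs_of_pos (by linarith)] at hz
  have hz0 : z ≠ 0 := by rintro rfl; simp at hz; linarith
  have : herglotzRieszKernel 0 0 z = 1 := by simp [herglotzRieszKernel, hz0]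
  rw [this, Complex.one_re, one_mul, heq, norm_mul, norm_pow, hz]
  rcases eq_or_ne (g z) 0 with h | h
  · simp [h]
  · exact Real.log_le_log (norm_pos_iff.mpr h)
      (le_mul_of_one_le_left (norm_nonneg _) (one_le_pow₀ hr))

theorem Differentiable.monotoneOn_proximity {F : ℂ → ℂ} (hF : Differentiable ℂ F) :
    MonotoneOn (proximity F ⊤) (Ioi 0) := by
  have h1 := characteristic_monotoneOn hF.meromorphic
  have h2 : logCounting F ⊤ = 0 := by
    have h4 : (MeromorphicOn.divisor F univ)⁻ = 0 :=
      negPart_eq_zero.mpr (MeromorphicOn.AnalyticOnNhd.divisor_nonneg fun z _ => hF.analyticAt z)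
    rw [logCounting_top, h4, map_zero]
  simpa only [characteristic, h2, add_zero] using h1

theorem Differentiable.iteratedDeriv {F : ℂ → ℂ} (hF : Differentiable ℂ F) (N : ℕ) :
    Differentiable ℂ (_root_.iteratedDeriv N F) := by
  induction N with
  | zero => simpa using hF
  | succ N ih => rw [iteratedDeriv_succ]; exact ih.differentiable_deriv

/-- An entire function whose proximity function is at most logarithmic along a sequence of radii
is a polynomial. -/
theorem Differentiable.exists_iteratedDeriv_eq_zero {F : ℂ → ℂ} (hF : Differentiable ℂ F) {K : ℝ}
    (hK : ∃ᶠ r in atTop, proximity F ⊤ r ≤ K * Real.log r) :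
    ∃ N, ∀ z, _root_.iteratedDeriv N F z = 0 := by
  obtain ⟨m, hm⟩ := exists_nat_ge (3 * K)
  refine ⟨m + 1, fun z => ?_⟩
  rw [← norm_eq_zero]
  refine le_antisymm (le_of_forall_pos_le_add fun ε hε => ?_) (norm_nonneg _)
  rw [zero_add]
  set B : ℝ := (m + 1).factorial * 4 ^ (m + 1) with hB
  have h1 : ∀ᶠ r : ℝ in atTop, 4 * ‖z‖ ≤ r ∧ 1 ≤ r ∧ B / ε ≤ r :=
    (eventually_ge_atTop _).and ((eventually_ge_atTop _).and (eventually_ge_atTop _))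
  obtain ⟨r, hr, hzr, h1r, hBr⟩ := (hK.and_eventually h1).exists
  have hr0 : 0 < r := by linarith
  have h2 : ∀ w, ‖w‖ ≤ r / 2 → ‖F w‖ ≤ r ^ m := by
    intro w hw
    refine (hF.norm_le_exp_proximity hw (by linarith : r / 2 < r)).trans ?_
    rw [show (r + r / 2) / (r - r / 2) = 3 by field_simp; norm_num]
    rw [← Real.le_log_iff_exp_le (by positivity), Real.log_pow]
    nlinarith [Real.log_nonneg h1r]
  have h3 := Complex.norm_iteratedDeriv_le_of_forall_mem_sphere_norm_le (c := z) (R := r / 4)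
    (C := r ^ m) (f := F) (m + 1) (by linarith) hF.diffContOnCl fun w hw => h2 w (by
      rw [mem_sphere, dist_eq_norm] at hw
      have : ‖w‖ ≤ ‖w - z‖ + ‖z‖ := by simpa using norm_add_le (w - z) z
      linarith)
  refine h3.trans ?_
  rw [show ((m + 1).factorial : ℝ) * r ^ m / (r / 4) ^ (m + 1) = B / r by
    rw [hB, div_pow, pow_succ r]; field_simp]
  rw [div_le_iff₀ hr0]
  rwa [div_le_iff₀ hε, mul_comm] at hBr

/-- A form of Borel's growth lemma. -/
theorem MonotoneOn.frequently_add_inv_le {T : ℝ → ℝ} (hT : MonotoneOn T (Ioi 0))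
    (hlim : Tendsto T atTop atTop) : ∃ᶠ r in atTop, T (r + 1 / T r) ≤ 2 * T r := by
  intro hcon
  obtain ⟨r₀, h₀⟩ := eventually_atTop.mp (hcon.and ((eventually_ge_atTop 1).and
    (hlim.eventually_ge_atTop 1)))
  have hr₀ := (h₀ r₀ le_rfl).2.1
  let u : ℕ → ℝ := fun j => (fun r => r + 1 / T r)^[j] r₀
  have hu : ∀ j, u (j + 1) = u j + 1 / T (u j) := fun j => by
    simp only [u, Function.iterate_succ_apply']
  have key : ∀ j, r₀ ≤ u j ∧ u j ≤ r₀ + 2 - 2 * (1 / 2) ^ j ∧ 2 ^ j ≤ T (u j) := by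
    intro j
    induction j with
    | zero => exact ⟨le_rfl, by simp [u], by simpa [u] using (h₀ r₀ le_rfl).2.2⟩
    | succ j ih =>
      obtain ⟨h1, h2, h3⟩ := ih
      have hTpos : 0 < T (u j) := by have := (h₀ _ h1).2.2; linarith
      have h4 : 1 / T (u j) ≤ (1 / 2) ^ j := by
        rw [div_pow, one_pow]
        exact one_div_le_one_div_of_le (by positivity) h3
      have h5 : ¬ T (u j + 1 / T (u j)) ≤ 2 * T (u j) := (h₀ _ h1).1
      rw [← hu, not_le] at h5
      refine ⟨?_, ?_, ?_⟩
      · rw [hu]; have := one_div_pos.mpr hTpos; linarith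
      · rw [hu, pow_succ]; linarith
      · rw [pow_succ]; linarith
  obtain ⟨j, hj⟩ := pow_unbounded_of_one_lt (T (r₀ + 2)) (one_lt_two : (1 : ℝ) < 2)
  obtain ⟨h1, h2, h3⟩ := key j
  have h4 : T (u j) ≤ T (r₀ + 2) := by
    refine hT (mem_Ioi.mpr (by linarith)) (mem_Ioi.mpr (by linarith)) ?_
    have : (0 : ℝ) ≤ 2 * (1 / 2) ^ j := by positivity
    linarith
  linarith

open Asymptotics

/-- Radii tending to infinity along which the proximity function of `F` grows moderately. -/
def goodRadii (F : ℂ → ℂ) : Filter ℝ :=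
  atTop ⊓ 𝓟 {r | proximity F ⊤ (r + 1 / proximity F ⊤ r) ≤ 2 * proximity F ⊤ r}

/-- `h` is a small function with respect to `F`. -/
structure IsSmall (F h : ℂ → ℂ) : Prop where
  meromorphic : Meromorphic h
  isLittleO : proximity h ⊤ =o[goodRadii F] proximity F ⊤

/-- `F` is an entire function that is not a polynomial. -/
structure IsTranscendentalEntire (F : ℂ → ℂ) : Prop where
  differentiable : Differentiable ℂ F
  exists_ne : ∀ N, ∃ z, iteratedDeriv N F z ≠ 0

namespace IsTranscendentalEntire

variable {F : ℂ → ℂ}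

theorem isLittleO_log (hF : IsTranscendentalEntire F) :
    Real.log =o[atTop] proximity F ⊤ := by
  refine isLittleO_iff.mpr fun c hc => ?_
  have h1 : ¬∃ᶠ r in atTop, proximity F ⊤ r ≤ c⁻¹ * Real.log r := fun h => by
    obtain ⟨N, hN⟩ := hF.differentiable.exists_iteratedDeriv_eq_zero h
    obtain ⟨z, hz⟩ := hF.exists_ne N
    exact hz (hN z)
  filter_upwards [not_frequently.mp h1, eventually_ge_atTop 1] with r hr h1r
  rw [not_le, inv_mul_lt_iff₀ hc] at hr
  rw [Real.norm_of_nonneg (Real.log_nonneg h1r), Real.norm_of_nonneg (proximity_nonneg r)]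
  exact hr.le

theorem tendsto_proximity (hF : IsTranscendentalEntire F) :
    Tendsto (proximity F ⊤) atTop atTop := by
  refine tendsto_atTop_mono' atTop ?_ Real.tendsto_log_atTop
  filter_upwards [isLittleO_iff.mp hF.isLittleO_log one_pos, eventually_ge_atTop 1] with r hr h1r
  rwa [one_mul, Real.norm_of_nonneg (Real.log_nonneg h1r),
    Real.norm_of_nonneg (proximity_nonneg r)] at hr

theorem neBot (hF : IsTranscendentalEntire F) : (goodRadii F).NeBot := by
  rw [goodRadii, ← frequently_mem_iff_neBot]
  exact hF.differentiable.monotoneOn_proximity.frequently_add_inv_le hF.tendsto_proximity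

theorem tendsto_goodRadii (hF : IsTranscendentalEntire F) :
    Tendsto (proximity F ⊤) (goodRadii F) atTop :=
  hF.tendsto_proximity.mono_left inf_le_left

theorem isLittleO_const (hF : IsTranscendentalEntire F) (c : ℝ) :
    (fun _ => c) =o[goodRadii F] proximity F ⊤ :=
  isLittleO_const_left.mpr (Or.inr (tendsto_norm_atTop_atTop.comp hF.tendsto_goodRadii))

theorem isSmall_of_le (_hF : IsTranscendentalEntire F) {h : ℂ → ℂ} (hm : Meromorphic h) {g : ℝ → ℝ}
    (hg : g =o[goodRadii F] proximity F ⊤)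
    (hle : ∀ᶠ r in goodRadii F, proximity h ⊤ r ≤ g r) : IsSmall F h := by
  refine ⟨hm, IsBigO.trans_isLittleO ?_ hg⟩
  refine IsBigO.of_bound 1 ?_
  filter_upwards [hle] with r hr
  rw [one_mul, Real.norm_of_nonneg (proximity_nonneg r)]
  exact hr.trans (le_abs_self _)

theorem isSmall_const (hF : IsTranscendentalEntire F) (c : ℂ) : IsSmall F fun _ => c :=
  hF.isSmall_of_le (fun z => MeromorphicAt.const c z) (hF.isLittleO_const (Real.posLog ‖c‖))
    (Eventually.of_forall fun _ => proximity_const.le)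

theorem isSmall_add (hF : IsTranscendentalEntire F) {g h : ℂ → ℂ} (hg : IsSmall F g)
    (hh : IsSmall F h) : IsSmall F fun z => g z + h z :=
  hF.isSmall_of_le (fun z => (hg.1 z).add (hh.1 z))
    ((hg.2.add hh.2).add (hF.isLittleO_const (Real.log 2)))
    (Eventually.of_forall (proximity_add_top_le hg.1 hh.1))

theorem isSmall_mul (hF : IsTranscendentalEntire F) {g h : ℂ → ℂ} (hg : IsSmall F g)
    (hh : IsSmall F h) : IsSmall F fun z => g z * h z :=
  hF.isSmall_of_le (fun z => (hg.1 z).mul (hh.1 z)) (hg.2.add hh.2)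
    (Eventually.of_forall (proximity_mul_top_le hg.1 hh.1))

theorem isSmall_sub (hF : IsTranscendentalEntire F) {g h : ℂ → ℂ} (hg : IsSmall F g)
    (hh : IsSmall F h) : IsSmall F fun z => g z - h z := by
  simpa [sub_eq_add_neg] using hF.isSmall_add hg (hF.isSmall_mul (hF.isSmall_const (-1)) hh)

theorem eventually_one_le (hF : IsTranscendentalEntire F) :
    ∀ᶠ r in goodRadii F, 1 ≤ r ∧ 1 ≤ proximity F ⊤ r ∧
      proximity F ⊤ (r + 1 / proximity F ⊤ r) ≤ 2 * proximity F ⊤ r := by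
  have h1 : ∀ᶠ r : ℝ in goodRadii F, 1 ≤ r :=
    (eventually_ge_atTop 1).filter_mono inf_le_left
  have h2 : ∀ᶠ r : ℝ in goodRadii F,
      proximity F ⊤ (r + 1 / proximity F ⊤ r) ≤ 2 * proximity F ⊤ r :=
    (eventually_principal.mpr fun _ h => h).filter_mono inf_le_right
  exact h1.and ((hF.tendsto_goodRadii.eventually_ge_atTop 1).and h2)

theorem isSmall_congr (hF : IsTranscendentalEntire F) {g h : ℂ → ℂ} (hg : IsSmall F g)
    (hh : Meromorphic h) (hgh : ∀ᶠ z in codiscrete ℂ, h z = g z) : IsSmall F h := by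
  refine hF.isSmall_of_le hh hg.2 ?_
  filter_upwards [hF.eventually_one_le] with r hr
  exact (proximity_congr_codiscrete hgh (by linarith [hr.1])).le

/-- The proximity function of `F` is not bounded by a small quantity. -/
theorem not_isLittleO (hF : IsTranscendentalEntire F) {g : ℝ → ℝ}
    (hg : g =o[goodRadii F] proximity F ⊤)
    (hle : ∀ᶠ r in goodRadii F, proximity F ⊤ r ≤ g r) : False := by
  have := hF.neBot
  obtain ⟨r, h1, h2, h3⟩ := ((isLittleO_iff.mp hg (c := 1 / 2) (by norm_num)).and
    (hle.and hF.eventually_one_le)).exists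
  rw [Real.norm_of_nonneg (proximity_nonneg r)] at h1
  have := le_abs_self (g r)
  rw [Real.norm_eq_abs] at h1
  linarith [h3.2.1]

/-- Bound for derivatives on a slightly larger circle. -/
theorem norm_iteratedDeriv_sub_le (hF : Differentiable ℂ F) {r : ℝ} (hr : 1 ≤ r)
    (hT : 1 ≤ proximity F ⊤ r)
    (hB : proximity F ⊤ (r + 1 / proximity F ⊤ r) ≤ 2 * proximity F ⊤ r) (j : ℕ) (c : ℂ) {z : ℂ}
    (hz : z ∈ sphere 0 (r + 2 * (1 / (8 * proximity F ⊤ r)))) :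
    ‖iteratedDeriv j F z - c‖ ≤
      Real.exp ((16 + j.factorial + 4 * j + ‖c‖) * (r * proximity F ⊤ r ^ 2)) := by
  set T := proximity F ⊤ r with hTdef
  have hT0 : 0 < T := by linarith
  have hi : 1 / T ≤ 1 := by rw [div_le_one hT0]; exact hT
  have hi0 : 0 < 1 / T := by positivity
  have h1 : ∀ w, ‖w‖ ≤ r + 1 / T / 2 → ‖F w‖ ≤ Real.exp (16 * (r * T ^ 2)) := by
    intro w hw
    refine (hF.norm_le_exp_proximity hw (by linarith : r + 1 / T / 2 < r + 1 / T)).trans ?_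
    refine Real.exp_le_exp.mpr ?_
    calc _ ≤ (4 * r) / (1 / T / 2) * (2 * T) := by
          have := proximity_nonneg (f := F) (a := ⊤) (r + 1 / T)
          simp only [Pi.zero_apply] at this
          rw [show r + 1 / T - (r + 1 / T / 2) = 1 / T / 2 by ring]
          gcongr
          linarith
      _ = _ := by field_simp; ring
  have h2 := Complex.norm_iteratedDeriv_le_of_forall_mem_sphere_norm_le (c := z) (R := 1 / T / 4)
    (C := Real.exp (16 * (r * T ^ 2))) (f := F) j (by positivity) hF.diffContOnCl
    fun w hw => h1 w (by
      rw [mem_sphere, dist_eq_norm] at hw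
      rw [mem_sphere_zero_iff_norm, show 2 * (1 / (8 * T)) = 1 / T / 4 by field_simp; norm_num] at hz
      have : ‖w‖ ≤ ‖w - z‖ + ‖z‖ := by simpa using norm_add_le (w - z) z
      linarith)
  have hQ : 1 ≤ r * T ^ 2 := by nlinarith [one_le_pow₀ hT (n := 2)]
  have hTQ : T ≤ r * T ^ 2 := by nlinarith
  have h3 : (j.factorial : ℝ) ≤ Real.exp (j.factorial * (r * T ^ 2)) := by
    have := Real.add_one_le_exp ((j.factorial : ℝ) * (r * T ^ 2))
    nlinarith [(Nat.cast_nonneg j.factorial : (0 : ℝ) ≤ _)]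
  have h4 : (4 * T) ^ j ≤ Real.exp (4 * j * (r * T ^ 2)) := by
    rw [show 4 * j * (r * T ^ 2) = j * (4 * (r * T ^ 2)) by ring, Real.exp_nat_mul]
    gcongr
    have := Real.add_one_le_exp (4 * (r * T ^ 2))
    linarith
  have h5 : 1 + ‖c‖ ≤ Real.exp (‖c‖ * (r * T ^ 2)) := by
    have := Real.add_one_le_exp (‖c‖ * (r * T ^ 2))
    nlinarith [norm_nonneg c]
  have h6 : ‖iteratedDeriv j F z‖ ≤
      Real.exp ((16 + j.factorial + 4 * j) * (r * T ^ 2)) := by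
    refine h2.trans ?_
    rw [add_mul, add_mul, Real.exp_add, Real.exp_add]
    calc _ = Real.exp (16 * (r * T ^ 2)) * j.factorial * (4 * T) ^ j := by
          rw [show 1 / T / 4 = (4 * T)⁻¹ by field_simp, inv_pow, div_inv_eq_mul]; ring
      _ ≤ _ := by gcongr
  have h7 : 1 ≤ Real.exp ((16 + j.factorial + 4 * j) * (r * T ^ 2)) :=
    Real.one_le_exp (by positivity)
  rw [add_mul _ ‖c‖, Real.exp_add]
  calc _ ≤ ‖iteratedDeriv j F z‖ + ‖c‖ := norm_sub_le _ _
    _ ≤ Real.exp ((16 + j.factorial + 4 * j) * (r * T ^ 2)) * (1 + ‖c‖) := by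
      nlinarith [norm_nonneg c]
    _ ≤ _ := by gcongr

theorem isSmall_logDeriv (hF : IsTranscendentalEntire F) (j : ℕ) (c : ℂ)
    (hne : ∃ z, iteratedDeriv j F z - c ≠ 0) :
    IsSmall F (logDeriv fun z => iteratedDeriv j F z - c) := by
  have hG : Differentiable ℂ fun z => iteratedDeriv j F z - c :=
    (hF.differentiable.iteratedDeriv j).sub_const c
  obtain ⟨C, hC1, hC⟩ := hG.exists_proximity_logDeriv_le hne
  set D : ℝ := 16 + j.factorial + 4 * j + ‖c‖ with hD
  have hD0 : 0 < D := by positivity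
  set T := proximity F ⊤ with hT
  have hlogT : (fun r => Real.log (T r)) =o[goodRadii F] T :=
    Real.isLittleO_log_id_atTop.comp_tendsto hF.tendsto_goodRadii
  have hlogr : Real.log =o[goodRadii F] T := hF.isLittleO_log.mono inf_le_left
  refine hF.isSmall_of_le hG.meromorphic_logDeriv (g := fun r => 4 * Real.log r +
      6 * Real.log (T r) + (2 * Real.log (D + C) + 2 * Real.log 8 + C))
    (((hlogr.const_mul_left 4).add (hlogT.const_mul_left 6)).add (hF.isLittleO_const _)) ?_
  filter_upwards [hF.eventually_one_le] with r ⟨hr, hTr, hB⟩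
  have hQ : 1 ≤ r * T r ^ 2 := by nlinarith [one_le_pow₀ hTr (n := 2)]
  refine (hC r (1 / (8 * T r)) (Real.exp (D * (r * T r ^ 2))) hr (by positivity) ?_
    (Real.one_le_exp (by positivity)) fun z hz =>
      norm_iteratedDeriv_sub_le hF.differentiable hr hTr hB j c hz).trans ?_
  · rw [div_le_one (by positivity)]; linarith
  · rw [Real.log_exp]
    have h1 : Real.log (D * (r * T r ^ 2) + C) ≤
        Real.log (D + C) + Real.log r + 2 * Real.log (T r) := by
      have e : Real.log (D + C) + Real.log r + 2 * Real.log (T r) =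
          Real.log ((D + C) * (r * T r ^ 2)) := by
        rw [Real.log_mul (by positivity) (by positivity),
          Real.log_mul (by positivity) (by positivity), Real.log_pow]
        push_cast; ring
      rw [e]
      refine Real.log_le_log (by positivity) ?_
      nlinarith
    have h2 : Real.log (r / (1 / (8 * T r))) = Real.log r + Real.log 8 + Real.log (T r) := by
      rw [div_div_eq_mul_div, div_one, Real.log_mul (by positivity) (by positivity),
        Real.log_mul (by norm_num) (by positivity)]
      ring
    rw [h2]
    linarith

end IsTranscendentalEntire

namespace IsTranscendentalEntire

variable {F : ℂ → ℂ}

theorem logDeriv_iteratedDeriv_sub (j : ℕ) (c z : ℂ) :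
    logDeriv (fun z => iteratedDeriv j F z - c) z =
      iteratedDeriv (j + 1) F z / (iteratedDeriv j F z - c) := by
  rw [logDeriv_apply, deriv_sub_const, iteratedDeriv_succ]

theorem exists_iteratedDeriv_sub_ne (hF : IsTranscendentalEntire F) (j : ℕ) (c : ℂ) :
    ∃ z, iteratedDeriv j F z - c ≠ 0 := by
  by_contra! h
  obtain ⟨z, hz⟩ := hF.exists_ne (j + 1)
  refine hz ?_
  rw [iteratedDeriv_succ, show iteratedDeriv j F = fun _ => c from
    funext fun z => sub_eq_zero.mp (h z), deriv_const]

theorem isSmall_iteratedDeriv_succ_div (hF : IsTranscendentalEntire F) (j : ℕ) (c : ℂ) :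
    IsSmall F fun z => iteratedDeriv (j + 1) F z / (iteratedDeriv j F z - c) := by
  have := hF.isSmall_logDeriv j c (hF.exists_iteratedDeriv_sub_ne j c)
  rwa [funext (logDeriv_iteratedDeriv_sub j c)] at this

theorem meromorphic_iteratedDeriv_sub (hF : IsTranscendentalEntire F) (j : ℕ) (c : ℂ) :
    Meromorphic fun z => iteratedDeriv j F z - c :=
  ((hF.differentiable.iteratedDeriv j).sub_const c).meromorphic

theorem eventually_iteratedDeriv_sub_ne (hF : IsTranscendentalEntire F) (j : ℕ) (c : ℂ) :
    ∀ᶠ z in codiscrete ℂ, iteratedDeriv j F z - c ≠ 0 :=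
  ((hF.differentiable.iteratedDeriv j).sub_const c).eventually_codiscrete_ne_zero
    (hF.exists_iteratedDeriv_sub_ne j c)

theorem isSmall_iteratedDeriv_div (hF : IsTranscendentalEntire F) (i m : ℕ) (c : ℂ) :
    IsSmall F fun z => iteratedDeriv (i + m + 1) F z / (iteratedDeriv i F z - c) := by
  induction m with
  | zero => exact hF.isSmall_iteratedDeriv_succ_div i c
  | succ m ih =>
    refine hF.isSmall_congr (hF.isSmall_mul ih (hF.isSmall_iteratedDeriv_succ_div (i + m + 1) 0))
      (fun z => (by simpa using hF.meromorphic_iteratedDeriv_sub (i + m + 2) 0 z :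
        MeromorphicAt (iteratedDeriv (i + m + 2) F) z).div
        (hF.meromorphic_iteratedDeriv_sub i c z)) ?_
    filter_upwards [hF.eventually_iteratedDeriv_sub_ne (i + m + 1) 0,
      hF.eventually_iteratedDeriv_sub_ne i c] with z h1 h2
    rw [sub_zero] at h1 ⊢
    rw [← add_assoc]
    field_simp

theorem isSmall_inv (hF : IsTranscendentalEntire F) {q : ℂ → ℂ} (hq : Differentiable ℂ q)
    (h0 : ∃ z, q z ≠ 0) (hs : IsSmall F q) : IsSmall F fun z => (q z)⁻¹ := by
  obtain ⟨C, hC⟩ := hq.exists_le_circleAverage_log_norm h0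
  refine hF.isSmall_of_le hq.meromorphic.inv (hs.2.add (hF.isLittleO_const (-C))) ?_
  filter_upwards [hF.eventually_one_le] with r hr
  have h1 := congrFun (proximity_sub_proximity_inv_eq_circleAverage hq.meromorphic) r
  rw [Pi.sub_apply] at h1
  have := hC r hr.1
  change proximity q⁻¹ ⊤ r ≤ _
  linarith

end IsTranscendentalEntire

theorem exists_iteratedDeriv_pow_eq {f : ℂ → ℂ} (hf : Differentiable ℂ f) {n j : ℕ} (hj : j ≤ n) :
    ∃ W : ℂ → ℂ, Differentiable ℂ W ∧
      ∀ z, iteratedDeriv j (fun w => f w ^ n) z = f z ^ (n - j) * W z := by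
  induction j with
  | zero => exact ⟨fun _ => 1, by fun_prop, by simp⟩
  | succ j ih =>
    obtain ⟨W, hW, h⟩ := ih (by omega)
    obtain ⟨m, hm⟩ : ∃ m, n - j = m + 1 := ⟨n - j - 1, by omega⟩
    have hm' : n - (j + 1) = m := by omega
    refine ⟨fun z => (m + 1) * deriv f z * W z + f z * deriv W z, ?_, fun z => ?_⟩
    · have := hf.differentiable_deriv
      have := hW.differentiable_deriv
      fun_prop
    · rw [iteratedDeriv_succ, funext h, hm, hm']
      rw [(((hf z).hasDerivAt.fun_pow (m + 1)).fun_mul (hW z).hasDerivAt).deriv]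
      push_cast
      ring

theorem iteratedDeriv_add_of_eq {F : ℂ → ℂ} {k : ℕ} (h : ∀ z, iteratedDeriv k F z = F z) (m : ℕ) :
    iteratedDeriv (m + k) F = iteratedDeriv m F := by
  induction m with
  | zero => simpa using funext h
  | succ m ih => rw [add_right_comm, iteratedDeriv_succ, ih, iteratedDeriv_succ]

theorem iteratedDeriv_mod_of_eq {F : ℂ → ℂ} {k : ℕ} (h : ∀ z, iteratedDeriv k F z = F z) (m : ℕ) :
    iteratedDeriv (m % k) F = iteratedDeriv m F := by
  have key : ∀ j, iteratedDeriv (m % k + k * j) F = iteratedDeriv (m % k) F := by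
    intro j
    induction j with
    | zero => simp
    | succ j ih => rw [mul_add, mul_one, ← add_assoc, iteratedDeriv_add_of_eq h, ih]
  rw [← key (m / k), Nat.mod_add_div]

theorem Differentiable.eq_zero_of_iteratedDeriv_eq_zero {F : ℂ → ℂ} (hF : Differentiable ℂ F)
    {a : ℂ} (h : ∀ m, _root_.iteratedDeriv m F a = 0) (z : ℂ) : F z = 0 := by
  have := Complex.hasSum_taylorSeries_of_entire hF a z
  simp only [h, smul_zero] at this
  exact this.unique hasSum_zero

/-- A solution of `F^(k) = F` has exponential type at most one. -/
theorem Differentiable.norm_le_exp_of_iteratedDeriv_eq {F : ℂ → ℂ} (hF : Differentiable ℂ F)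
    {k : ℕ} (hk : 1 ≤ k) (h : ∀ z, _root_.iteratedDeriv k F z = F z) :
    ∃ C : ℝ, 0 < C ∧ ∀ z, ‖F z‖ ≤ C * Real.exp ‖z‖ := by
  set S := ∑ j ∈ Finset.range k, ‖_root_.iteratedDeriv j F 0‖ with hS
  have hS0 : 0 ≤ S := Finset.sum_nonneg fun _ _ => norm_nonneg _
  have hb : ∀ m, ‖_root_.iteratedDeriv m F 0‖ ≤ S + 1 := by
    intro m
    rw [← iteratedDeriv_mod_of_eq h m]
    have := Finset.single_le_sum (f := fun j => ‖_root_.iteratedDeriv j F 0‖)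
      (fun _ _ => norm_nonneg _) (Finset.mem_range.mpr (Nat.mod_lt m (by omega : k > 0)))
    exact this.trans (by linarith)
  refine ⟨S + 1, by linarith, fun z => ?_⟩
  have h1 := Complex.hasSum_taylorSeries_of_entire hF 0 z
  have h2 : HasSum (fun m : ℕ => (S + 1) * (‖z‖ ^ m / m.factorial)) ((S + 1) * Real.exp ‖z‖) := by
    have := (NormedSpace.expSeries_div_hasSum_exp (𝔸 := ℝ) ‖z‖).mul_left (S + 1)
    rwa [← Real.exp_eq_exp_ℝ] at this
  rw [← h1.tsum_eq, ← h2.tsum_eq]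
  refine tsum_of_norm_bounded h2 (fun m => ?_) |>.trans (h2.tsum_eq.ge)
  rw [norm_smul, norm_smul, sub_zero, norm_inv, norm_pow, Complex.norm_natCast]
  calc _ = ‖_root_.iteratedDeriv m F 0‖ * (‖z‖ ^ m / m.factorial) := by
        rw [div_eq_mul_inv]; ring
    _ ≤ _ := by gcongr; exact hb m

theorem Differentiable.exists_deriv_eq_const_mul {F : ℂ → ℂ} (hF : Differentiable ℂ F)
    (h0 : ∀ z, F z ≠ 0) {C : ℝ} (hC : 0 < C) (hle : ∀ z, ‖F z‖ ≤ C * Real.exp ‖z‖) :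
    ∃ l : ℂ, ∀ z, _root_.deriv F z = l * F z := by
  have hd : Differentiable ℂ fun z => _root_.deriv F z / F z :=
    hF.differentiable_deriv.div hF h0
  set D := |Real.log (C / ‖F 0‖)| + 1 with hD
  have hb : ∀ z, ‖_root_.deriv F z / F z‖ ≤ 16 * (2 + D) := by
    intro z
    set r := ‖z‖ with hr
    have hr0 : 0 ≤ r := norm_nonneg z
    have hF0 : 0 < ‖F 0‖ := norm_pos_iff.mpr (h0 0)
    have h1 := hF.norm_deriv_div_le (r := r) (ρ := 2 * (r + 1)) (M := C * Real.exp (2 * (r + 1)))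
      (z := z) hr0 (by linarith) (fun w _ => h0 w) (fun w hw => (hle w).trans (by
        rw [mem_ball_zero_iff] at hw
        gcongr)) le_rfl
    refine h1.trans ?_
    rw [mul_div_right_comm C, Real.log_mul (by positivity) (Real.exp_pos _).ne', Real.log_exp,
      div_le_iff₀ (by nlinarith)]
    have h2 := le_abs_self (Real.log (C / ‖F 0‖))
    have hD1 : 1 ≤ D := by rw [hD]; linarith [abs_nonneg (Real.log (C / ‖F 0‖))]
    have h3 : 8 * (Real.log (C / ‖F 0‖) + 2 * (r + 1) + 1) * (2 * (r + 1)) ≤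
        8 * (D + 2 * (r + 1)) * (2 * (r + 1)) := by
      gcongr ?_ * _
      linarith
    refine h3.trans ?_
    nlinarith [mul_nonneg hr0 (by linarith : 0 ≤ D), mul_nonneg (mul_nonneg hr0 hr0) (by linarith : 0 ≤ D)]
  obtain ⟨l, hl⟩ := hd.exists_const_forall_eq_of_bounded (isBounded_iff_forall_norm_le.mpr
    ⟨_, by rintro _ ⟨z, rfl⟩; exact hb z⟩)
  refine ⟨l, fun z => ?_⟩
  rw [← hl z, div_mul_cancel₀ _ (h0 z)]

theorem exists_eq_mul_exp_of_iteratedDeriv_pow_eq {f : ℂ → ℂ} (hf : Differentiable ℂ f)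
    (hnc : ¬∃ c : ℂ, ∀ z, f z = c) {k n : ℕ} (hk : 1 ≤ k) (hn : k + 1 ≤ n)
    (h : ∀ z, iteratedDeriv k (fun w => f w ^ n) z = f z ^ n) :
    ∃ c l : ℂ, c ≠ 0 ∧ l ≠ 0 ∧ l ^ k = 1 ∧ ∀ z, f z = c * Complex.exp (l / (n : ℂ) * z) := by
  set F : ℂ → ℂ := fun w => f w ^ n with hFdef
  have hF : Differentiable ℂ F := hf.fun_pow n
  have hn0 : (n : ℂ) ≠ 0 := by exact_mod_cast (by omega : n ≠ 0)
  have hf0 : ∀ z, f z ≠ 0 := by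
    intro a ha
    refine hnc ⟨0, fun z => pow_eq_zero_iff (n := n) (by omega) |>.mp ?_⟩
    refine hF.eq_zero_of_iteratedDeriv_eq_zero (a := a) (fun m => ?_) z
    rw [← iteratedDeriv_mod_of_eq h m]
    have hlt := Nat.mod_lt m (by omega : k > 0)
    obtain ⟨W, -, hW⟩ := exists_iteratedDeriv_pow_eq hf (n := n) (j := m % k) (by omega)
    rw [hW, ha, zero_pow (by omega), zero_mul]
  have hF0 : ∀ z, F z ≠ 0 := fun z => pow_ne_zero n (hf0 z)
  obtain ⟨C, hC, hle⟩ := hF.norm_le_exp_of_iteratedDeriv_eq hk h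
  obtain ⟨l, hl⟩ := hF.exists_deriv_eq_const_mul hF0 hC hle
  have hpow : ∀ j, iteratedDeriv j F = fun z => l ^ j * F z := by
    intro j
    induction j with
    | zero => simp
    | succ j ih =>
      rw [iteratedDeriv_succ, ih]
      funext z
      rw [deriv_const_mul_field, hl, pow_succ, mul_assoc]
  have hf' : ∀ z, deriv f z = l / n * f z := by
    intro z
    have h1 := hl z
    rw [hFdef, ((hf z).hasDerivAt.fun_pow n).deriv] at h1
    obtain ⟨m, rfl⟩ : ∃ m, n = m + 1 := ⟨n - 1, by omega⟩
    simp only [Nat.add_sub_cancel, pow_succ (f z) m] at h1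
    have h2 := pow_ne_zero m (hf0 z)
    have h3 : f z ^ m * (((m + 1 : ℕ) : ℂ) * deriv f z - l * f z) = 0 := by linear_combination h1
    have h4 := (mul_eq_zero.mp h3).resolve_left h2
    field_simp
    linear_combination h4
  have hconst : ∀ z, f z * Complex.exp (-(l / n) * z) = f 0 := by
    intro z
    have hd : ∀ w, HasDerivAt (fun w => f w * Complex.exp (-(l / n) * w)) 0 w := by
      intro w
      have h1 : HasDerivAt (fun w : ℂ => -(l / n) * w) (-(l / n)) w := by
        simpa using (hasDerivAt_id w).const_mul (-(l / n))
      have := (hf w).hasDerivAt.fun_mul h1.cexp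
      rw [hf'] at this
      refine this.congr_deriv ?_
      ring
    have := is_const_of_deriv_eq_zero (fun w => (hd w).differentiableAt) (fun w => (hd w).deriv) z 0
    simpa using this
  have hform : ∀ z, f z = f 0 * Complex.exp (l / n * z) := by
    intro z
    rw [← hconst z, mul_assoc, ← Complex.exp_add]
    simp
  refine ⟨f 0, l, hf0 0, ?_, ?_, hform⟩
  · rintro rfl
    exact hnc ⟨f 0, fun z => by rw [hform z]; simp⟩
  · have h1 := h 0
    rw [hpow k] at h1
    exact mul_right_cancel₀ (hF0 0) (by rw [one_mul]; exact h1)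

theorem Polynomial.dvd_of_eval_eq_mul {g : ℂ → ℂ} (hg : Continuous g) {A B : Polynomial ℂ}
    (hA : A ≠ 0) (h : ∀ z, B.eval z = g z * A.eval z) : A ∣ B := by
  induction hd : A.natDegree generalizing A B with
  | zero =>
    rw [Polynomial.eq_C_of_natDegree_eq_zero hd] at hA ⊢
    exact (Polynomial.isUnit_C.mpr (isUnit_iff_ne_zero.mpr fun h0 => hA (by rw [h0, map_zero]))).dvd
  | succ d ih =>
    obtain ⟨r, hr⟩ := Complex.exists_root (f := A)
      (Polynomial.natDegree_pos_iff_degree_pos.mp (by omega))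
    obtain ⟨A', rfl⟩ := Polynomial.dvd_iff_isRoot.mpr hr
    obtain ⟨B', rfl⟩ := Polynomial.dvd_iff_isRoot.mpr (show B.IsRoot r by
      rw [Polynomial.IsRoot, h r, hr.eq_zero, mul_zero])
    have hA' : A' ≠ 0 := right_ne_zero_of_mul hA
    refine mul_dvd_mul_left _ (ih hA' (fun z => ?_) ?_)
    · refine congrFun (Continuous.ext_on (dense_compl_singleton r) (Polynomial.continuous _)
        (hg.mul (Polynomial.continuous _)) fun z hz => ?_) z
      have h1 := h z
      simp only [Polynomial.eval_mul, Polynomial.eval_sub, Polynomial.eval_X,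
        Polynomial.eval_C] at h1
      exact mul_left_cancel₀ (sub_ne_zero.mpr hz) (by rw [h1, Pi.mul_apply]; ring)
    · rw [Polynomial.natDegree_mul (Polynomial.X_sub_C_ne_zero r) hA',
        Polynomial.natDegree_X_sub_C] at hd
      omega

theorem Polynomial.iteratedDeriv_eval (P : Polynomial ℂ) (j : ℕ) :
    iteratedDeriv j (fun z => P.eval z) = fun z => (Polynomial.derivative^[j] P).eval z := by
  induction j with
  | zero => simp
  | succ j ih =>
    rw [iteratedDeriv_succ, ih, Function.iterate_succ_apply']
    funext z
    rw [Polynomial.deriv]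

theorem Differentiable.exists_polynomial_of_iteratedDeriv_eq_zero {F : ℂ → ℂ}
    (hF : Differentiable ℂ F) {N : ℕ} (h : ∀ z, _root_.iteratedDeriv N F z = 0) :
    ∃ P : Polynomial ℂ, F = fun z => P.eval z := by
  have hz : ∀ m, N ≤ m → _root_.iteratedDeriv m F = fun _ => 0 := by
    intro m hm
    induction m, hm using Nat.le_induction with
    | base => exact funext h
    | succ m _ ih => rw [iteratedDeriv_succ, ih]; simp
  refine ⟨∑ m ∈ Finset.range N,
    Polynomial.C ((m.factorial : ℂ)⁻¹ * _root_.iteratedDeriv m F 0) * Polynomial.X ^ m,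
    funext fun z => ?_⟩
  have h1 := (Complex.hasSum_taylorSeries_of_entire hF 0 z).tsum_eq
  rw [tsum_eq_sum (s := Finset.range N) fun m hm => by rw [hz m (by simpa using hm)]; simp] at h1
  rw [← h1, Polynomial.eval_finsetSum]
  refine Finset.sum_congr rfl fun m _ => ?_
  simp only [Polynomial.eval_mul, Polynomial.eval_C, Polynomial.eval_pow, Polynomial.eval_X,
    sub_zero, smul_eq_mul]
  ring

/-- A nonconstant entire function sharing `1` CM with a derivative is not a polynomial. -/
theorem isTranscendentalEntire_of_share {F g : ℂ → ℂ} (hF : Differentiable ℂ F)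
    (hnc : ¬∃ c : ℂ, ∀ z, F z = c) {k : ℕ} (hk : 1 ≤ k) (hg : Continuous g) (hg0 : ∀ z, g z ≠ 0)
    (h : ∀ z, iteratedDeriv k F z - 1 = g z * (F z - 1)) : IsTranscendentalEntire F := by
  refine ⟨hF, fun N => ?_⟩
  by_contra! hN
  obtain ⟨P, rfl⟩ := hF.exists_polynomial_of_iteratedDeriv_eq_zero hN
  have hd : P.natDegree ≠ 0 := fun h0 => hnc ⟨P.coeff 0, fun z => by
    rw [Polynomial.eq_C_of_natDegree_eq_zero h0]; simp⟩
  have hA : (P - 1).natDegree = P.natDegree := by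
    rw [← Polynomial.C_1, Polynomial.natDegree_sub_C]
  have hA0 : P - 1 ≠ 0 := fun h0 => hd (by rw [← hA, h0, Polynomial.natDegree_zero])
  have hB : Polynomial.derivative^[k] P - 1 = 0 := by
    refine Polynomial.eq_zero_of_dvd_of_natDegree_lt
      (Polynomial.dvd_of_eval_eq_mul hg hA0 fun z => ?_) ?_
    · have := h z
      rw [Polynomial.iteratedDeriv_eval] at this
      simpa using this
    · rw [hA, ← Polynomial.C_1, Polynomial.natDegree_sub_C]
      have := Polynomial.natDegree_iterate_derivative P k
      omega
  refine hA0 (Polynomial.funext fun z => ?_)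
  have h1 := h z
  rw [Polynomial.iteratedDeriv_eval] at h1
  have h2 : (Polynomial.derivative^[k] P).eval z - 1 = 0 := by
    simpa using congrArg (Polynomial.eval z) hB
  rw [h2] at h1
  simpa using (mul_eq_zero.mp h1.symm).resolve_left (hg0 z)

namespace IsTranscendentalEntire

variable {F : ℂ → ℂ}

theorem isSmall_of_norm_le (hF : IsTranscendentalEntire F) {g h : ℂ → ℂ} (hg : IsSmall F g)
    (hh : Meromorphic h) {K : ℝ} (hK : 0 ≤ K)
    (hle : ∀ᶠ z in codiscrete ℂ, ‖h z‖ ≤ K * (1 + ‖g z‖)) : IsSmall F h := by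
  classical
  refine hF.isSmall_of_le hh (hg.2.add (hF.isLittleO_const (Real.posLog K + Real.log 2))) ?_
  filter_upwards [hF.eventually_one_le] with r hr
  have hr0 : r ≠ 0 := by linarith [hr.1]
  set h' : ℂ → ℂ := fun z => if ‖h z‖ ≤ K * (1 + ‖g z‖) then h z else 0 with hh'
  have hcongr : h =ᶠ[codiscrete ℂ] h' := by
    filter_upwards [hle] with z hz
    simp [hh', hz]
  have hle' : ∀ z, ‖h' z‖ ≤ K * (1 + ‖g z‖) := by
    intro z
    simp only [hh']
    split_ifs with h1
    · exact h1
    · rw [norm_zero]; positivity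
  have hcirc : CircleIntegrable (fun z => Real.posLog ‖h' z‖) 0 r := by
    refine CircleIntegrable.congr_codiscreteWithin (f₁ := fun z => Real.posLog ‖h z‖) ?_
      (hh.meromorphicOn.circleIntegrable_posLog_norm)
    have := hcongr.filter_mono (codiscreteWithin_mono (subset_univ (sphere 0 |r|)))
    filter_upwards [this] with z hz
    rw [hz]
  have hgint : CircleIntegrable (fun z => Real.posLog ‖g z‖) 0 r :=
    hg.1.meromorphicOn.circleIntegrable_posLog_norm
  rw [proximity_congr_codiscrete hcongr hr0, proximity_top, proximity_top]
  rw [← Real.circleAverage_const (Real.posLog K + Real.log 2) 0 r,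
    ← Real.circleAverage_fun_add hgint (circleIntegrable_const _ _ _)]
  refine Real.circleAverage_mono hcirc (hgint.add (circleIntegrable_const _ _ _)) fun z _ => ?_
  have h1 : Real.posLog ‖h' z‖ ≤ Real.posLog (K * (1 + ‖g z‖)) :=
    Real.posLog_le_posLog (norm_nonneg _) (hle' z)
  have h2 : Real.posLog (K * (1 + ‖g z‖)) ≤ Real.posLog K + Real.posLog (1 + ‖g z‖) :=
    Real.posLog_mul
  have h3 : Real.posLog (1 + ‖g z‖) ≤ Real.log 2 + Real.posLog 1 + Real.posLog ‖g z‖ := by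
    exact Real.posLog_add
  have h4 : Real.posLog 1 = 0 := by simp [Real.posLog]
  linarith

theorem isSmall_pow (hF : IsTranscendentalEntire F) {g : ℂ → ℂ} (hg : IsSmall F g) (n : ℕ) :
    IsSmall F fun z => g z ^ n := by
  induction n with
  | zero => simpa using hF.isSmall_const 1
  | succ n ih => simpa only [pow_succ] using hF.isSmall_mul ih hg

theorem isSmall_of_pow (hF : IsTranscendentalEntire F) {g : ℂ → ℂ} (hg : Meromorphic g) {n : ℕ}
    (hn : n ≠ 0) (h : IsSmall F fun z => g z ^ n) : IsSmall F g := by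
  refine hF.isSmall_of_le hg h.2 (Eventually.of_forall fun r => ?_)
  change _ ≤ proximity (g ^ n) ⊤ r
  rw [proximity_pow_top]
  exact le_self_nsmul (proximity_nonneg r) hn

theorem not_isSmall_self (hF : IsTranscendentalEntire F) : ¬IsSmall F F := fun h =>
  hF.not_isLittleO h.2 (Eventually.of_forall fun _ => le_rfl)

end IsTranscendentalEntire

theorem exists_sub_pow_eq (c : ℂ) (m : ℕ) : ∃ R : ℂ → ℂ, Continuous R ∧
    ∀ v, (c - v) ^ (m + 1) = c ^ (m + 1) + v * (-(m + 1) * c ^ m + v * R v) := by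
  induction m with
  | zero => exact ⟨fun _ => 0, continuous_const, fun v => by simp [sub_eq_add_neg]⟩
  | succ m ih =>
    obtain ⟨R, hR, h⟩ := ih
    refine ⟨fun v => c * R v + (m + 1) * c ^ m - v * R v, by fun_prop, fun v => ?_⟩
    rw [pow_succ, h]
    push_cast
    ring

theorem exists_one_le_norm_mul {c : ℂ} (hc : c ≠ 0) {m : ℕ} (hm : 1 ≤ m) :
    ∃ K : ℝ, 1 ≤ K ∧ ∀ v D L : ℂ, v ≠ 0 → D = L * ((c - v) ^ (m + 1) - c ^ (m + 1)) →
      v * (D - 1) = c * ((c - v) ^ (m + 1) - 1) → 1 ≤ ‖v‖ * (K * (1 + ‖L‖)) := by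
  obtain ⟨R, hR, hRv⟩ := exists_sub_pow_eq c m
  obtain ⟨K₀, hK₀⟩ := (isCompact_closedBall (0 : ℂ) 1).exists_bound_of_continuousOn hR.continuousOn
  set K₁ : ℝ := (m + 1) * ‖c‖ ^ m + |K₀| with hK₁
  have hK₁0 : 0 ≤ K₁ := by positivity
  have hG : ∀ v : ℂ, ‖v‖ ≤ 1 → ‖-(m + 1) * c ^ m + v * R v‖ ≤ K₁ := by
    intro v hv
    refine (norm_add_le _ _).trans ?_
    rw [norm_mul, norm_neg, norm_pow, norm_mul]
    have h1 : ‖R v‖ ≤ |K₀| := (hK₀ v (by simpa using hv)).trans (le_abs_self _)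
    have h2 : ‖(m + 1 : ℂ)‖ = m + 1 := by
      rw [← Nat.cast_succ, Complex.norm_natCast, Nat.cast_succ]
    rw [h2]
    have h3 : ‖v‖ * ‖R v‖ ≤ 1 * |K₀| := by gcongr
    linarith
  suffices H : ∃ K : ℝ, 1 ≤ K ∧ ∀ v D L : ℂ, v ≠ 0 → ‖v‖ ≤ 1 →
      D = L * ((c - v) ^ (m + 1) - c ^ (m + 1)) →
      v * (D - 1) = c * ((c - v) ^ (m + 1) - 1) → 1 ≤ ‖v‖ * (K * (1 + ‖L‖)) by
    obtain ⟨K, hK, h⟩ := H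
    refine ⟨K, hK, fun v D L hv0 hD hv => ?_⟩
    rcases le_total ‖v‖ 1 with h1 | h1
    · exact h v D L hv0 h1 hD hv
    · have : 1 ≤ K * (1 + ‖L‖) := by nlinarith [norm_nonneg L]
      nlinarith
  by_cases ha : c ^ (m + 1) = 1
  · refine ⟨1 + ‖c‖ * |K₀| + K₁, by have := norm_nonneg c; have := abs_nonneg K₀; nlinarith,
      fun v D L hv0 hv hD hrel => ?_⟩
    have h1 : ‖R v‖ ≤ |K₀| := (hK₀ v (by simpa using hv)).trans (le_abs_self _)
    have e : (m : ℂ) = v * (c * R v - L * (-(m + 1) * c ^ m + v * R v)) := by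
      rw [hRv, ha] at hrel hD
      refine mul_left_cancel₀ hv0 ?_
      rw [pow_succ] at ha
      linear_combination hrel - v * hD - v * (m + 1) * ha
    have h2 : (1 : ℝ) ≤ ‖(m : ℂ)‖ := by rw [Complex.norm_natCast]; exact_mod_cast hm
    rw [e, norm_mul] at h2
    refine h2.trans ?_
    gcongr
    refine (norm_sub_le _ _).trans ?_
    rw [norm_mul, norm_mul]
    have h3 : ‖c‖ * ‖R v‖ ≤ ‖c‖ * |K₀| := by gcongr
    have h4 : ‖L‖ * ‖-(m + 1) * c ^ m + v * R v‖ ≤ ‖L‖ * K₁ := by gcongr; exact hG v hv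
    nlinarith [norm_nonneg L, norm_nonneg c, abs_nonneg K₀, mul_nonneg (norm_nonneg L) (mul_nonneg (norm_nonneg c) (abs_nonneg K₀))]
  · set δ := ‖c * (c ^ (m + 1) - 1)‖ with hδ
    have hδ0 : 0 < δ := norm_pos_iff.mpr (mul_ne_zero hc (sub_ne_zero.mpr ha))
    refine ⟨1 + (K₁ + 1 + ‖c‖ * K₁) / δ, by
      have : 0 ≤ (K₁ + 1 + ‖c‖ * K₁) / δ := by positivity
      linarith, fun v D L _ hv hD hrel => ?_⟩
    have e : c * (c ^ (m + 1) - 1) =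
        v * ((L * (v * (-(m + 1) * c ^ m + v * R v)) - 1) - c * (-(m + 1) * c ^ m + v * R v)) := by
      rw [hRv] at hrel hD
      linear_combination v * hD - hrel
    have h3 : δ ≤ ‖v‖ * ((K₁ + 1 + ‖c‖ * K₁) * (1 + ‖L‖)) := by
      rw [hδ, e, norm_mul]
      gcongr
      refine (norm_sub_le _ _).trans ?_
      refine (add_le_add_left (norm_sub_le _ _) _).trans ?_
      simp only [norm_mul, norm_one]
      have h5 := hG v hv
      set X := ‖-(m + 1) * c ^ m + v * R v‖
      have h4 : ‖L‖ * (‖v‖ * X) ≤ ‖L‖ * (1 * K₁) := by gcongr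
      have h6 : ‖c‖ * X ≤ ‖c‖ * K₁ := by gcongr
      nlinarith [norm_nonneg L, norm_nonneg c, mul_nonneg (norm_nonneg c) hK₁0,
        mul_nonneg (norm_nonneg L) (mul_nonneg (norm_nonneg c) hK₁0)]
    calc (1 : ℝ) = δ / δ := (div_self hδ0.ne').symm
      _ ≤ ‖v‖ * ((K₁ + 1 + ‖c‖ * K₁) * (1 + ‖L‖)) / δ := by gcongr
      _ = ‖v‖ * ((K₁ + 1 + ‖c‖ * K₁) / δ * (1 + ‖L‖)) := by ring
      _ ≤ _ := by gcongr; linarith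

/-- If `v` is zero-free, then `(c - v)^n` and its derivative cannot satisfy the linear relation
`v * (F^(k) - 1) = c * (F - 1)`. -/
theorem false_of_mul_iteratedDeriv_sub_eq {u v : ℂ → ℂ} {c : ℂ} {k n : ℕ} (hk : 1 ≤ k)
    (hn : 2 ≤ n) (hF : IsTranscendentalEntire fun z => (c - v z) ^ n) (hu : Differentiable ℂ u)
    (huv : ∀ z, u z * v z = 1) (hc : c ≠ 0)
    (h : ∀ z, v z * (iteratedDeriv k (fun z => (c - v z) ^ n) z - 1) = c * ((c - v z) ^ n - 1)) :
    False := by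
  obtain ⟨j, rfl⟩ : ∃ j, k = j + 1 := ⟨k - 1, by omega⟩
  obtain ⟨m, rfl⟩ : ∃ m, n = m + 1 := ⟨n - 1, by omega⟩
  obtain ⟨K, hK, hKv⟩ := exists_one_le_norm_mul hc (by omega : 1 ≤ m)
  have hu0 : ∀ z, u z ≠ 0 := fun z => left_ne_zero_of_mul_eq_one (huv z)
  have hinv : ∀ z, (u z)⁻¹ = v z := fun z => inv_eq_of_mul_eq_one_right (huv z)
  have hL := hF.isSmall_iteratedDeriv_div 0 j (c ^ (m + 1))
  have husmall : IsSmall (fun z => (c - v z) ^ (m + 1)) u := by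
    refine hF.isSmall_of_norm_le hL hu.meromorphic (by linarith) ?_
    filter_upwards [hF.eventually_iteratedDeriv_sub_ne 0 (c ^ (m + 1))] with z hz
    rw [zero_add, iteratedDeriv_zero] at *
    have h1 := hKv (v z) _ _ (right_ne_zero_of_mul_eq_one (huv z)) (div_mul_cancel₀ _ hz).symm (h z)
    have h2 : ‖u z‖ * ‖v z‖ = 1 := by rw [← norm_mul, huv, norm_one]
    calc _ = ‖u z‖ * 1 := (mul_one _).symm
      _ ≤ _ := mul_le_mul_of_nonneg_left h1 (norm_nonneg _)
      _ = _ := by rw [← mul_assoc, h2, one_mul]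
  have hv := hF.isSmall_inv hu ⟨0, hu0 0⟩ husmall
  simp only [hinv] at hv
  exact hF.not_isSmall_self (hF.isSmall_pow (hF.isSmall_sub (hF.isSmall_const c) hv) _)

theorem Differentiable.exists_mul_ne_zero {g h : ℂ → ℂ} (hg : Differentiable ℂ g)
    (hh : Differentiable ℂ h) (hg0 : ∃ z, g z ≠ 0) (hh0 : ∃ z, h z ≠ 0) : ∃ z, g z * h z ≠ 0 := by
  by_contra! h0
  rcases AnalyticOnNhd.eq_zero_or_eq_zero_of_mul_eq_zero (U := univ) (fun z _ => hg.analyticAt z)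
    (fun z _ => hh.analyticAt z) (fun z _ => h0 z) isPreconnected_univ with h | h
  · obtain ⟨z, hz⟩ := hg0
    exact hz (h z (mem_univ z))
  · obtain ⟨z, hz⟩ := hh0
    exact hz (h z (mem_univ z))

/-- Solutions of `u' = u² f'` are `1 / (c - f)`. -/
theorem exists_mul_const_sub_eq_one {f u : ℂ → ℂ} (hf : Differentiable ℂ f)
    (hu : Differentiable ℂ u) (hu0 : ∃ z, u z ≠ 0)
    (h : ∀ z, deriv u z - u z ^ 2 * deriv f z = 0) : ∃ c, ∀ z, u z * (c - f z) = 1 := by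
  obtain ⟨a, ha⟩ := hu0
  have hd : Differentiable ℂ fun z => u z * deriv f z := hu.mul hf.differentiable_deriv
  obtain ⟨g, -, hg⟩ := hd.isExactOn_univ.with_val_at a 0
  set c := f a + (u a)⁻¹ with hc
  refine ⟨c, fun z => ?_⟩
  have hder : ∀ w, HasDerivAt (fun w => (u w * (c - f w) - 1) * Complex.exp (-g w)) 0 w := by
    intro w
    have h1 := ((hu w).hasDerivAt.fun_mul ((hf w).hasDerivAt.const_sub c)).sub_const 1
    refine (h1.fun_mul (hg w (mem_univ w)).fun_neg.cexp).congr_deriv ?_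
    linear_combination (c - f w) * Complex.exp (-g w) * h w
  have h2 := is_const_of_deriv_eq_zero (fun w => (hder w).differentiableAt)
    (fun w => (hder w).deriv) z a
  have h3 : u a * (c - f a) - 1 = 0 := by rw [hc, add_sub_cancel_left, mul_inv_cancel₀ ha, sub_self]
  rw [h3, zero_mul] at h2
  exact sub_eq_zero.mp ((mul_eq_zero.mp h2).resolve_right (Complex.exp_ne_zero _))

/-- The key dichotomy: the multiplier relating `f^n - 1` and `(f^n)^(k) - 1` is trivial. -/
theorem eq_one_of_share {f φ : ℂ → ℂ} (hf : Differentiable ℂ f) {k n : ℕ} (hk : 1 ≤ k)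
    (hn : k + 1 ≤ n) (hF : IsTranscendentalEntire fun z => f z ^ n) (hφ : Differentiable ℂ φ)
    (hφ0 : ∀ z, φ z ≠ 0)
    (h : ∀ z, iteratedDeriv k (fun z => f z ^ n) z - 1 = φ z * (f z ^ n - 1)) (z : ℂ) :
    φ z = 1 := by
  have hn0 : (n : ℂ) ≠ 0 := by exact_mod_cast (by omega : n ≠ 0)
  obtain ⟨W₀, hW₀, hW⟩ := exists_iteratedDeriv_pow_eq hf (n := n) (j := k) (by omega)
  set F : ℂ → ℂ := fun z => f z ^ n with hFdef
  set u : ℂ → ℂ := fun z => φ z * f z ^ (n - 1) - f z ^ (n - k - 1) * W₀ z with hudef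
  have hu : Differentiable ℂ u := by fun_prop
  have hFz : ∀ z, F z = f z * f z ^ (n - 1) := fun z => by
    rw [← pow_succ', Nat.sub_add_cancel (by omega)]
  have hφu : ∀ z, φ z - 1 = f z * u z := by
    intro z
    have h1 := h z
    have h2 : f z ^ (n - k) = f z * f z ^ (n - k - 1) := by
      rw [← pow_succ', Nat.sub_add_cancel (by omega)]
    rw [hW, h2, show f z ^ n = f z * f z ^ (n - 1) from hFz z] at h1
    simp only [hudef]
    linear_combination h1
  by_contra hne
  have hu0 : ∃ z, u z ≠ 0 := ⟨z, fun h0 => hne (sub_eq_zero.mp (by rw [hφu, h0, mul_zero]))⟩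
  have hf' := hf.differentiable_deriv
  have hFd : ∀ z, iteratedDeriv 1 F z = n * f z ^ (n - 1) * deriv f z := fun z => by
    rw [iteratedDeriv_one, ((hf z).hasDerivAt.fun_pow n).deriv]
  have hf'0 : ∃ z, deriv f z ≠ 0 := by
    obtain ⟨z, hz⟩ := hF.exists_ne 1
    exact ⟨z, fun h0 => hz (by rw [hFd, h0, mul_zero])⟩
  have hψ : Differentiable ℂ fun z => deriv f z * u z := hf'.mul hu
  obtain ⟨j, rfl⟩ : ∃ j, k = j + 1 := ⟨k - 1, by omega⟩
  have ev0 : ∀ᶠ z in codiscrete ℂ, F z ≠ 0 := by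
    simpa using hF.eventually_iteratedDeriv_sub_ne 0 0
  have ev1 : ∀ᶠ z in codiscrete ℂ, F z - 1 ≠ 0 := by
    simpa using hF.eventually_iteratedDeriv_sub_ne 0 1
  have ev2 : ∀ᶠ z in codiscrete ℂ, deriv f z * u z ≠ 0 :=
    hψ.eventually_codiscrete_ne_zero (hf'.exists_mul_ne_zero hu hf'0 hu0)
  have evf : ∀ᶠ z in codiscrete ℂ, f z ≠ 0 := by
    filter_upwards [ev0] with z hz h0
    exact hz (by rw [hFz, h0, zero_mul])
  have s1 : IsSmall F fun z => iteratedDeriv 1 F z / (F z - 1) := by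
    simpa using hF.isSmall_iteratedDeriv_div 0 0 1
  have s0 : IsSmall F fun z => iteratedDeriv 1 F z / F z := by
    simpa using hF.isSmall_iteratedDeriv_div 0 0 0
  have sk : IsSmall F fun z => iteratedDeriv (j + 1) F z / F z := by
    simpa using hF.isSmall_iteratedDeriv_div 0 j 0
  have sk1 : IsSmall F fun z => iteratedDeriv (j + 2) F z / (iteratedDeriv (j + 1) F z - 1) :=
    hF.isSmall_iteratedDeriv_succ_div (j + 1) 1
  have h' : ∀ z, iteratedDeriv (j + 1) F z - F z = f z * u z * (F z - 1) := fun z => by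
    rw [← hφu]; linear_combination h z
  have hψs : IsSmall F fun z => deriv f z * u z := by
    refine hF.isSmall_congr (hF.isSmall_mul (hF.isSmall_const (n : ℂ)⁻¹) (hF.isSmall_mul s1
      (hF.isSmall_sub sk (hF.isSmall_const 1)))) hψ.meromorphic ?_
    filter_upwards [ev0, ev1] with z h0 h1
    have e : iteratedDeriv (j + 1) F z / F z - 1 = f z * u z * (F z - 1) / F z := by
      rw [← h', sub_div, div_self h0]
    rw [e, hFd]
    field_simp
    rw [hFz]
    ring
  have hψi := hF.isSmall_inv hψ (hf'.exists_mul_ne_zero hu hf'0 hu0) hψs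
  have hfi : IsSmall F fun z => (f z)⁻¹ := by
    refine hF.isSmall_of_pow hf.meromorphic.inv (by omega : n ≠ 0) ?_
    refine hF.isSmall_congr (hF.isSmall_sub (hF.isSmall_const 1) (hF.isSmall_mul
      (hF.isSmall_const (n : ℂ)⁻¹) (hF.isSmall_mul hψi (hF.isSmall_mul s0
      (hF.isSmall_sub sk (hF.isSmall_const 1)))))) (fun z => (hf.meromorphic.inv z).pow n) ?_
    filter_upwards [ev0, ev2, evf] with z h0 h2 hf0
    have e : iteratedDeriv (j + 1) F z / F z - 1 = f z * u z * (F z - 1) / F z := by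
      rw [← h', sub_div, div_self h0]
    rw [e, hFd, inv_pow, show f z ^ n = F z from rfl]
    have h3 := left_ne_zero_of_mul h2
    have h4 := right_ne_zero_of_mul h2
    field_simp
    rw [hFz]
    ring
  set q : ℂ → ℂ := fun z => (deriv u z - u z ^ 2 * deriv f z) / φ z with hq
  have hqd : Differentiable ℂ q :=
    (hu.differentiable_deriv.sub ((hu.pow 2).mul hf')).div hφ hφ0
  have hφd : ∀ z, deriv φ z = deriv f z * u z + f z * deriv u z := by
    intro z
    have : φ = fun z => f z * u z + 1 := funext fun z => by rw [← hφu]; ring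
    rw [this, (((hf z).hasDerivAt.fun_mul (hu z).hasDerivAt).add_const 1).deriv]
  have hfq : IsSmall F fun z => f z * q z := by
    refine hF.isSmall_congr (hF.isSmall_sub (hF.isSmall_sub sk1 s1) hψs)
      (hf.mul hqd).meromorphic ?_
    filter_upwards [ev1] with z h1
    have e1 : iteratedDeriv (j + 2) F z =
        deriv φ z * (F z - 1) + φ z * iteratedDeriv 1 F z := by
      have e : iteratedDeriv (j + 1) F = fun z => φ z * (F z - 1) + 1 :=
        funext fun z => by rw [← h z]; ring
      rw [iteratedDeriv_succ, e, (((hφ z).hasDerivAt.fun_mul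
        ((hF.differentiable z).hasDerivAt.sub_const 1)).add_const 1).deriv, iteratedDeriv_one]
    rw [e1, h z, show f z ^ n - 1 = F z - 1 from rfl, hφd]
    have h2 := hφ0 z
    have h3 : φ z = f z * u z + 1 := by rw [← hφu]; ring
    simp only [hq]
    field_simp
    rw [h3]
    ring
  by_cases hq0 : ∃ z, q z ≠ 0
  · have evq := hqd.eventually_codiscrete_ne_zero hq0
    have hqs : IsSmall F q := by
      refine hF.isSmall_congr (hF.isSmall_mul hfq hfi) hqd.meromorphic ?_
      filter_upwards [evf] with z hz
      field_simp
    have hfs : IsSmall F f := by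
      refine hF.isSmall_congr (hF.isSmall_mul hfq (hF.isSmall_inv hqd hq0 hqs)) hf.meromorphic ?_
      filter_upwards [evq] with z hz
      field_simp
    exact hF.not_isSmall_self (hF.isSmall_pow hfs n)
  · push Not at hq0
    obtain ⟨c, hc⟩ := exists_mul_const_sub_eq_one hf hu hu0 fun z =>
      (div_eq_zero_iff.mp (hq0 z)).resolve_right (hφ0 z)
    have hφc : ∀ z, φ z = u z * c := fun z => by linear_combination hφu z - hc z
    have hc0 : c ≠ 0 := fun h0 => hφ0 z (by rw [hφc, h0, mul_zero])
    have hfv : (fun z => (c - (c - f z)) ^ n) = F := funext fun z => by rw [sub_sub_cancel]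
    refine false_of_mul_iteratedDeriv_sub_eq (v := fun z => c - f z) (k := j + 1) (n := n) hk
      (by omega) (by rwa [hfv]) hu hc hc0 fun z => ?_
    simp only [hfv]
    rw [h z, hφc, sub_sub_cancel]
    linear_combination c * (f z ^ n - 1) * hc z

end

/-- Zhang–Yang (paper's Theorem 2.E): if `n ≥ k + 1` and `f^n`, `(f^n)^(k)`
share `1` CM, then `f^n ≡ (f^n)^(k)`, i.e. `f(z) = c e^{(λ/n) z}` with
`λ^k = 1`. -/
theorem zhang_yang_CM
    (f : ℂ → ℂ) (hf : Differentiable ℂ f) (hnc : ¬∃ c : ℂ, ∀ z, f z = c)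
    (k n : ℕ) (hk : 1 ≤ k) (hn : k + 1 ≤ n)
    (hshare : ∃ φ : ℂ → ℂ, Differentiable ℂ φ ∧ (∀ z, φ z ≠ 0) ∧
      ∀ z, iteratedDeriv k (fun w => f w ^ n) z - 1 = φ z * (f z ^ n - 1)) :
    (∀ z, iteratedDeriv k (fun w => f w ^ n) z = f z ^ n) ∧
    ∃ c l : ℂ, c ≠ 0 ∧ l ≠ 0 ∧ l ^ k = 1 ∧
      ∀ z, f z = c * Complex.exp (l / (n : ℂ) * z) := by
  obtain ⟨φ, hφ, hφ0, h⟩ := hshare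
  have hFnc : ¬∃ c : ℂ, ∀ z, f z ^ n = c := by
    rintro ⟨c, hc⟩
    have h1 : ∀ z, f z ^ (n - 1) * deriv f z = 0 := by
      intro z
      have h2 : deriv (fun w => f w ^ n) z = 0 := by
        rw [show (fun w => f w ^ n) = fun _ => c from funext hc, deriv_const]
      rw [((hf z).hasDerivAt.fun_pow n).deriv, mul_assoc] at h2
      exact (mul_eq_zero.mp h2).resolve_left (by exact_mod_cast (by omega : n ≠ 0))
    by_contra hcon
    refine (hf.fun_pow (n - 1)).exists_mul_ne_zero hf.differentiable_deriv ?_ ?_ |>.elim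
      fun z hz => hz (h1 z)
    · by_contra! h0
      exact hnc ⟨0, fun z => eq_zero_of_pow_eq_zero (h0 z)⟩
    · by_contra! h0
      exact hnc ⟨f 0, fun z => is_const_of_deriv_eq_zero hf h0 z 0⟩
  have hF := isTranscendentalEntire_of_share (hf.fun_pow n) hFnc hk hφ.continuous hφ0 h
  have heq : ∀ z, iteratedDeriv k (fun w => f w ^ n) z = f z ^ n := fun z => by
    have h1 := h z
    rw [eq_one_of_share hf hk hn hF hφ hφ0 h z, one_mul] at h1
    exact sub_left_injective h1
  exact ⟨heq, exists_eq_mul_exp_of_iteratedDeriv_pow_eq hf hnc hk hn heq⟩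
end
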